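/- arXiv:1801.05209 — 2 statements merged into one kernel-verified Lean document; each statement's English description precedes it below -/
import Mathlib

section
/- For every n ≥ 4, the natural homomorphism from Aut(B_n) to Aut(B_n/Z) is a group isomorphism. Precisely: since the center Z of B_n is a characteristic subgroup, every automorphism f of B_n induces an automorphism of the quotient B_n ⧸ Z, and the map MulAut B_n →* MulAut (B_n ⧸ Subgroup.center B_n) sending f to this induced automorphism is bijective. -/
/-- The braid relations on `n` strands, as elements of the free group on `Fin (n-1)`. -/
def braidRels (n : ℕ) : Set (FreeGroup (Fin (n - 1))) :=
  {r | ∃ i j : Fin (n - 1), 2 ≤ |(i : ℤ) - (j : ℤ)| ∧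
      r = FreeGroup.of i * FreeGroup.of j * (FreeGroup.of j * FreeGroup.of i)⁻¹} ∪
  {r | ∃ i j : Fin (n - 1), |(i : ℤ) - (j : ℤ)| = 1 ∧
      r = FreeGroup.of i * FreeGroup.of j * FreeGroup.of i *
        (FreeGroup.of j * FreeGroup.of i * FreeGroup.of j)⁻¹}

/-- The braid group on `n` strands. -/
abbrev B (n : ℕ) : Type := PresentedGroup (braidRels n)

/-- The standard generators of the braid group. -/
def σ {n : ℕ} (i : Fin (n - 1)) : B n := PresentedGroup.of i

namespace Braid

/-! ### Generators indexed by natural numbers -/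

/-- The `i`-th standard generator of the braid group, or `1` when `i` is out of range. -/
def gen (n i : ℕ) : B n := if h : i < n - 1 then σ ⟨i, h⟩ else 1

variable {n : ℕ}

theorem gen_of_lt {i : ℕ} (h : i < n - 1) : gen n i = σ ⟨i, h⟩ := dif_pos h

theorem gen_of_not_lt {i : ℕ} (h : ¬ i < n - 1) : gen n i = 1 := dif_neg h

theorem gen_comm {i j : ℕ} (hij : i + 2 ≤ j) : gen n i * gen n j = gen n j * gen n i := by
  by_cases hj : j < n - 1
  · have hi : i < n - 1 := by omega
    rw [gen_of_lt hi, gen_of_lt hj]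
    refine PresentedGroup.mk_eq_mk_of_mul_inv_mem (Or.inl ⟨⟨i, hi⟩, ⟨j, hj⟩, ?_, rfl⟩)
    rw [abs_sub_comm, le_abs]
    left
    push_cast
    omega
  · rw [gen_of_not_lt hj, mul_one, one_mul]

theorem gen_braid {i : ℕ} (hi : i + 1 < n - 1) :
    gen n i * gen n (i + 1) * gen n i = gen n (i + 1) * gen n i * gen n (i + 1) := by
  have hi' : i < n - 1 := by omega
  rw [gen_of_lt hi, gen_of_lt hi']
  refine PresentedGroup.mk_eq_mk_of_mul_inv_mem (Or.inr ⟨⟨i, hi'⟩, ⟨i + 1, hi⟩, ?_, rfl⟩)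
  rw [abs_sub_comm]
  simp

/-- The homomorphism out of the braid group determined by images of the generators. -/
def lift {G : Type*} [Group G] (f : ℕ → G)
    (hc : ∀ i j, i + 2 ≤ j → j < n - 1 → f i * f j = f j * f i)
    (hb : ∀ i, i + 1 < n - 1 → f i * f (i + 1) * f i = f (i + 1) * f i * f (i + 1)) :
    B n →* G :=
  PresentedGroup.toGroup (f := fun i : Fin (n - 1) => f i) <| by
    rintro r (⟨i, j, hij, rfl⟩ | ⟨i, j, hij, rfl⟩)
    · simp only [map_mul, map_inv, FreeGroup.lift_apply_of, mul_inv_eq_one]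
      rcases le_abs.1 hij with h | h
      · exact (hc j i (by omega) i.2).symm
      · exact hc i j (by omega) j.2
    · simp only [map_mul, map_inv, FreeGroup.lift_apply_of, mul_inv_eq_one]
      rcases (abs_eq zero_le_one).1 hij with h | h
      · have h' : (i : ℕ) = j + 1 := by omega
        have := i.2
        rw [h'] at this ⊢
        exact (hb j this).symm
      · have h' : (j : ℕ) = i + 1 := by omega
        have := j.2
        rw [h'] at this ⊢
        exact hb i this

theorem lift_gen {G : Type*} [Group G] {f : ℕ → G} {hc hb} {i : ℕ} (hi : i < n - 1) :
    lift (n := n) f hc hb (gen n i) = f i := by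
  rw [gen_of_lt hi]
  exact PresentedGroup.toGroup.of _

theorem closure_gen : Subgroup.closure {g | ∃ i < n - 1, gen n i = g} = ⊤ := by
  rw [eq_top_iff, ← PresentedGroup.closure_range_of]
  refine Subgroup.closure_mono ?_
  rintro _ ⟨i, rfl⟩
  exact ⟨i, i.2, gen_of_lt i.2⟩

/-- Induction on a braid word, multiplying by generators on the left. -/
theorem induction {P : B n → Prop} (one : P 1)
    (gen_mul : ∀ i < n - 1, ∀ g, P (gen n i * g) ↔ P g) (g : B n) : P g := by
  have hg : g ∈ Subgroup.closure {g | ∃ i < n - 1, gen n i = g} := by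
    rw [closure_gen]; trivial
  induction hg using Subgroup.closure_induction_left with
  | one => exact one
  | mul_left x hx y hy ih =>
    obtain ⟨i, hi, rfl⟩ := hx
    exact (gen_mul i hi y).2 ih
  | inv_mul_cancel x hx y hy ih =>
    obtain ⟨i, hi, rfl⟩ := hx
    exact (gen_mul i hi _).1 (by rwa [mul_inv_cancel_left])

theorem hom_ext {G : Type*} [Group G] {f g : B n →* G}
    (h : ∀ i < n - 1, f (gen n i) = g (gen n i)) : f = g := by
  refine PresentedGroup.ext fun i => ?_
  have := h i i.2
  rwa [gen_of_lt i.2] at this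

theorem conj_gen {i : ℕ} (hi : i + 1 < n - 1) :
    gen n (i + 1) = (gen n i * gen n (i + 1)) * gen n i * (gen n i * gen n (i + 1))⁻¹ := by
  rw [gen_braid hi]
  group

theorem hom_gen_eq {A : Type*} [CommGroup A] (f : B n →* A) {i : ℕ} (hi : i < n - 1) :
    f (gen n i) = f (gen n 0) := by
  induction i with
  | zero => rfl
  | succ i ih =>
    rw [← ih (by omega), conj_gen hi]
    simp only [map_mul, map_inv]
    exact mul_inv_cancel_comm _ _

/-! ### The exponent sum -/

/-- The abelianization map, sending every generator to `1 : ℤ`. -/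
def expSum (n : ℕ) : B n →* Multiplicative ℤ :=
  lift (fun _ => Multiplicative.ofAdd 1) (fun _ _ _ _ => rfl) (fun _ _ => rfl)

/-- The exponent sum of a braid. -/
def deg (g : B n) : ℤ := (expSum n g).toAdd

theorem deg_gen {i : ℕ} (hi : i < n - 1) : deg (gen n i) = 1 := by
  simp [deg, expSum, lift_gen hi]

@[simp] theorem deg_one : deg (1 : B n) = 0 := by simp [deg]

@[simp] theorem deg_mul (g h : B n) : deg (g * h) = deg g + deg h := by simp [deg]

@[simp] theorem deg_inv (g : B n) : deg g⁻¹ = -deg g := by simp [deg]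

@[simp] theorem deg_pow (g : B n) (k : ℕ) : deg (g ^ k) = k * deg g := by simp [deg]

@[simp] theorem deg_zpow (g : B n) (k : ℤ) : deg (g ^ k) = k * deg g := by simp [deg]

theorem hom_eq_zpow_deg {A : Type*} [CommGroup A] (f : B n →* A) (g : B n) :
    f g = f (gen n 0) ^ deg g := by
  have : f = (zpowersHom A (f (gen n 0))).comp (expSum n) := by
    refine hom_ext fun i hi => ?_
    rw [hom_gen_eq f hi, MonoidHom.comp_apply, expSum, lift_gen hi]
    simp
  conv_lhs => rw [this]
  rfl

/-! ### Strand permutations and crossing numbers -/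

/-- The transposition of the positions `k` and `k + 1`. -/
def adjSwap (n k : ℕ) : Equiv.Perm (Fin n) :=
  if h : k + 1 < n then Equiv.swap ⟨k, by omega⟩ ⟨k + 1, h⟩ else 1

theorem adjSwap_val {k : ℕ} (h : k + 1 < n) (x : Fin n) :
    (adjSwap n k x : ℕ) = if (x : ℕ) = k then k + 1 else if (x : ℕ) = k + 1 then k else x := by
  rw [adjSwap, dif_pos h, Equiv.swap_apply_def]
  simp only [Fin.ext_iff]
  split_ifs <;> rfl

/-- The contribution of the generator `k` to the crossing number of two strands. -/
def weight (k i j : ℕ) : ℤ := if (i = k ∧ j = k + 1) ∨ (i = k + 1 ∧ j = k) then 1 else 0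

/-- The action of a generator on pairs of strands, recording their crossings. -/
def crossPerm (n k : ℕ) : Equiv.Perm (Fin n × Fin n × ℤ) where
  toFun x := (adjSwap n k x.1, adjSwap n k x.2.1, x.2.2 + weight k x.1 x.2.1)
  invFun x := ((adjSwap n k)⁻¹ x.1, (adjSwap n k)⁻¹ x.2.1,
    x.2.2 - weight k ((adjSwap n k)⁻¹ x.1 : Fin n) ((adjSwap n k)⁻¹ x.2.1 : Fin n))
  left_inv x := by simp
  right_inv x := by simp

theorem crossPerm_apply (k : ℕ) (i j : Fin n) (m : ℤ) : crossPerm n k (i, j, m) =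
    (adjSwap n k i, adjSwap n k j, m + weight k i j) := rfl

theorem adjSwap_comm {i j : ℕ} (hij : i + 2 ≤ j) (hj : j < n - 1) :
    adjSwap n i * adjSwap n j = adjSwap n j * adjSwap n i := by
  have h1 : i + 1 < n := by omega
  have h2 : j + 1 < n := by omega
  ext x
  simp only [Equiv.Perm.mul_apply, adjSwap_val h1, adjSwap_val h2]
  grind

theorem adjSwap_braid {i : ℕ} (hi : i + 1 < n - 1) :
    adjSwap n i * adjSwap n (i + 1) * adjSwap n i =
      adjSwap n (i + 1) * adjSwap n i * adjSwap n (i + 1) := by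
  have h1 : i + 1 < n := by omega
  have h2 : i + 1 + 1 < n := by omega
  ext x
  simp only [Equiv.Perm.mul_apply, adjSwap_val h1, adjSwap_val h2]
  grind

/-- The permutation of the strands underlying a braid. -/
def perm (n : ℕ) : B n →* Equiv.Perm (Fin n) :=
  lift (adjSwap n) (fun _ _ => adjSwap_comm) (fun _ => adjSwap_braid)

theorem perm_gen {k : ℕ} (h : k < n - 1) : perm n (gen n k) = adjSwap n k := lift_gen h

/-- The action of the braid group on pairs of strands together with a counter. -/
def crossHom (n : ℕ) : B n →* Equiv.Perm (Fin n × Fin n × ℤ) :=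
  lift (crossPerm n)
    (fun i j hij hj => by
      have h1 : i + 1 < n := by omega
      have h2 : j + 1 < n := by omega
      refine Equiv.ext fun ⟨x, y, m⟩ => ?_
      simp only [Equiv.Perm.mul_apply, crossPerm_apply, Prod.mk.injEq]
      refine ⟨DFunLike.congr_fun (adjSwap_comm hij hj) x,
        DFunLike.congr_fun (adjSwap_comm hij hj) y, ?_⟩
      simp only [adjSwap_val h1, adjSwap_val h2, weight]
      grind)
    (fun i hi => by
      have h1 : i + 1 < n := by omega
      have h2 : i + 1 + 1 < n := by omega
      refine Equiv.ext fun ⟨x, y, m⟩ => ?_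
      simp only [Equiv.Perm.mul_apply, crossPerm_apply, Prod.mk.injEq]
      refine ⟨DFunLike.congr_fun (adjSwap_braid hi) x,
        DFunLike.congr_fun (adjSwap_braid hi) y, ?_⟩
      simp only [adjSwap_val h1, adjSwap_val h2, weight]
      have e1 : i ≠ i + 1 + 1 := by omega
      have e2 : i + 1 + 1 ≠ i := by omega
      have key : ∀ a : ℕ, a = i ∨ a = i + 1 ∨ a = i + 2 ∨ (a ≠ i ∧ a ≠ i + 1 ∧ a ≠ i + 1 + 1) := by
        intro a; omega
      rcases key x with hx | hx | hx | ⟨hx, hx', hx''⟩ <;>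
      rcases key y with hy | hy | hy | ⟨hy, hy', hy''⟩ <;>
      simp [*])

/-- The signed number of crossings of the strands starting at `i` and `j`. -/
def cross (g : B n) (i j : Fin n) : ℤ := (crossHom n g (i, j, 0)).2.2

theorem crossHom_apply (g : B n) (i j : Fin n) (m : ℤ) :
    crossHom n g (i, j, m) = (perm n g i, perm n g j, m + cross g i j) := by
  have key : ∀ g : B n, ∀ i j m, ∃ c, crossHom n g (i, j, m) = (perm n g i, perm n g j, m + c) ∧
      crossHom n g (i, j, 0) = (perm n g i, perm n g j, c) := by
    intro g
    induction g using induction with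
    | one => intro i j m; exact ⟨0, by simp, by simp⟩
    | gen_mul k hk g =>
      have hg : crossHom n (gen n k) = crossPerm n k := lift_gen hk
      refine forall_congr' fun i => forall_congr' fun j => forall_congr' fun m => ?_
      simp only [map_mul, Equiv.Perm.mul_apply, hg, perm_gen hk]
      constructor
      · rintro ⟨c, h1, h2⟩
        refine ⟨c - weight k (perm n g i) (perm n g j), (crossPerm n k).injective ?_,
          (crossPerm n k).injective ?_⟩
        · rw [h1, crossPerm_apply]; ring_nf
        · rw [h2, crossPerm_apply]; ring_nf
      · rintro ⟨c, h1, h2⟩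
        refine ⟨c + weight k (perm n g i) (perm n g j), ?_, ?_⟩
        · rw [h1, crossPerm_apply]; ring_nf
        · rw [h2, crossPerm_apply]
  obtain ⟨c, h1, h2⟩ := key g i j m
  rw [h1, cross, h2]

theorem cross_mul (g h : B n) (i j : Fin n) :
    cross (g * h) i j = cross h i j + cross g (perm n h i) (perm n h j) := by
  rw [cross, map_mul, Equiv.Perm.mul_apply, crossHom_apply h, crossHom_apply g, zero_add]

theorem cross_gen {k : ℕ} (hk : k < n - 1) (i j : Fin n) :
    cross (gen n k) i j = weight k i j := by
  have h : crossHom n (gen n k) = crossPerm n k := lift_gen hk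
  rw [cross, h, crossPerm_apply]
  exact zero_add _

@[simp] theorem cross_one (i j : Fin n) : cross (1 : B n) i j = 0 := by simp [cross]

theorem cross_inv (g : B n) (i j : Fin n) :
    cross g⁻¹ i j = -cross g ((perm n g)⁻¹ i) ((perm n g)⁻¹ j) := by
  have := cross_mul g g⁻¹ i j
  simp only [mul_inv_cancel, cross_one, map_inv] at this
  linarith

theorem cross_pow (g : B n) {i j : Fin n} (hi : perm n g i = i) (hj : perm n g j = j) (k : ℕ) :
    cross (g ^ k) i j = k * cross g i j := by
  induction k with
  | zero => simp
  | succ k ih => rw [pow_succ, cross_mul, hi, hj, ih]; push_cast; ring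

theorem cross_conj (g : B n) {p : B n} (hp : perm n p = 1) (i j : Fin n) :
    cross (g * p * g⁻¹) i j = cross p ((perm n g)⁻¹ i) ((perm n g)⁻¹ j) := by
  simp only [cross_mul, cross_inv, map_inv, hp, Equiv.Perm.one_apply]
  ring

theorem sum_cross (g : B n) : ∑ i, ∑ j, cross g i j = 2 * deg g := by
  induction g using induction with
  | one => simp
  | gen_mul k hk g =>
    have h1 : ∑ i, ∑ j, cross (gen n k * g) i j =
        ∑ i, ∑ j, cross g i j + ∑ i : Fin n, ∑ j : Fin n, weight k i j := by
      simp only [cross_mul, Finset.sum_add_distrib, cross_gen hk]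
      congr 1
      rw [← Equiv.sum_comp (perm n g) fun i : Fin n => ∑ j : Fin n, weight k i j]
      refine Finset.sum_congr rfl fun i _ => ?_
      exact Equiv.sum_comp (perm n g) fun j : Fin n => weight k (perm n g i) j
    have h2 : ∑ i : Fin n, ∑ j : Fin n, weight k i j = 2 := by
      set a : Fin n := ⟨k, by omega⟩
      set b : Fin n := ⟨k + 1, by omega⟩
      have : ∀ i j : Fin n, weight k i j =
          (if i = a then if j = b then 1 else 0 else 0) +
            (if i = b then if j = a then 1 else 0 else 0) := by
        intro i j
        simp only [weight, Fin.ext_iff, a, b]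
        grind
      simp only [this, Finset.sum_add_distrib]
      simp
    rw [h1, h2, deg_mul, deg_gen hk]
    constructor <;> intro h <;> linarith

/-- The parity of a crossing number records whether the two strands are exchanged. -/
theorem even_cross (g : B n) (i j : Fin n) (hij : i ≠ j) :
    Even (cross g i j) ↔ (i < j ↔ perm n g i < perm n g j) := by
  induction g using induction with
  | one => simp
  | gen_mul k hk g =>
    have hne : perm n g i ≠ perm n g j := fun h => hij ((perm n g).injective h)
    rw [cross_mul, cross_gen hk, map_mul, perm_gen hk]
    simp only [Equiv.Perm.mul_apply]
    generalize perm n g i = x at *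
    generalize perm n g j = y at *
    simp only [Fin.lt_def, adjSwap_val (show k + 1 < n by omega), ne_eq, Fin.ext_iff] at *
    rw [Int.even_add, weight]
    grind

theorem even_cross_of_fixed (g : B n) {i j : Fin n} (hij : i ≠ j) (hi : perm n g i = i)
    (hj : perm n g j = j) : Even (cross g i j) := by
  rw [even_cross g i j hij, hi, hj]

theorem perm_surjective : Function.Surjective (perm n) := by
  rcases n with _ | n
  · exact fun x => ⟨1, Subsingleton.elim _ _⟩
  rw [← MonoidHom.range_eq_top, eq_top_iff, ← Subgroup.toSubmonoid_le]
  rw [Subgroup.top_toSubmonoid, ← Equiv.Perm.mclosure_swap_castSucc_succ, Submonoid.closure_le]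
  rintro _ ⟨i, rfl⟩
  refine ⟨gen (n + 1) i, ?_⟩
  rw [perm_gen (by simp), adjSwap, dif_pos (by simp)]
  rfl

@[simp] theorem cross_self (g : B n) (i : Fin n) : cross g i i = 0 := by
  induction g using induction with
  | one => simp
  | gen_mul k hk g =>
    rw [cross_mul, cross_gen hk, weight, if_neg (by omega), add_zero]

/-! ### The generator of the center -/

/-- The product of the first `k` generators. -/
def genProd (n : ℕ) : ℕ → B n
  | 0 => 1
  | k + 1 => genProd n k * gen n k

theorem genProd_comm {k j : ℕ} (h : k + 1 ≤ j) :
    genProd n k * gen n j = gen n j * genProd n k := by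
  induction k with
  | zero => simp [genProd]
  | succ k ih =>
    rw [genProd, mul_assoc, gen_comm (by omega), ← mul_assoc, ih (by omega), mul_assoc]

theorem genProd_mul_gen {k i : ℕ} (hi : i + 1 < k) (hk : k ≤ n - 1) :
    genProd n k * gen n i = gen n (i + 1) * genProd n k := by
  induction k with
  | zero => omega
  | succ k ih =>
    rcases Nat.lt_or_ge (i + 1) k with h | h
    · rw [genProd, mul_assoc, ← gen_comm (by omega), ← mul_assoc, ih h (by omega), mul_assoc]
    · obtain rfl : k = i + 1 := by omega
      have h1 := gen_braid (n := n) (i := i) (by omega)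
      have h2 := genProd_comm (n := n) (k := i) (j := i + 1) le_rfl
      calc genProd n (i + 1 + 1) * gen n i
          = genProd n i * (gen n i * gen n (i + 1) * gen n i) := by
            simp only [genProd, mul_assoc]
        _ = (genProd n i * gen n (i + 1)) * gen n i * gen n (i + 1) := by
            rw [h1]; simp only [mul_assoc]
        _ = _ := by rw [h2]; simp only [genProd, mul_assoc]

/-- The product of all generators, rotating the strands. -/
def δ (n : ℕ) : B n := genProd n (n - 1)

theorem δ_mul_gen {i : ℕ} (hi : i + 1 < n - 1) : δ n * gen n i = gen n (i + 1) * δ n :=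
  genProd_mul_gen hi le_rfl

theorem δ_mul_genProd {k : ℕ} (hk : k < n - 1) :
    gen n 0 * δ n * genProd n k = genProd n (k + 1) * δ n := by
  induction k with
  | zero => simp [genProd]
  | succ k ih =>
    rw [genProd, ← mul_assoc, ih (by omega), mul_assoc, δ_mul_gen hk, ← mul_assoc]
    rfl

theorem δ_sq_mul_gen (hn : 2 ≤ n) : gen n 0 * δ n ^ 2 = δ n ^ 2 * gen n (n - 2) := by
  have h := δ_mul_genProd (n := n) (k := n - 2) (by omega)
  have h2 : δ n = genProd n (n - 2) * gen n (n - 2) := by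
    have : genProd n (n - 2 + 1) = genProd n (n - 2) * gen n (n - 2) := rfl
    rwa [show n - 2 + 1 = n - 1 by omega] at this
  rw [show n - 2 + 1 = n - 1 by omega] at h
  change _ = δ n * δ n at h
  have h3 : δ n * δ n * gen n (n - 2) = gen n 0 * δ n * (genProd n (n - 2) * gen n (n - 2)) := by
    rw [← mul_assoc, h]
  rw [pow_two, h3, ← h2, mul_assoc]

theorem δ_pow_mul_gen {k : ℕ} (hk : k < n - 1) : δ n ^ k * gen n 0 = gen n k * δ n ^ k := by
  induction k with
  | zero => simp
  | succ k ih =>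
    rw [pow_succ', mul_assoc, ih (by omega), ← mul_assoc, δ_mul_gen hk, mul_assoc]

theorem gen_eq_conj {k : ℕ} (hk : k < n - 1) : gen n k = δ n ^ k * gen n 0 * (δ n ^ k)⁻¹ := by
  rw [δ_pow_mul_gen hk, mul_inv_cancel_right]

/-- The full twist. -/
def fullTwist (n : ℕ) : B n := δ n ^ n

theorem mem_center_of_gen {c : B n} (h : ∀ i < n - 1, gen n i * c = c * gen n i) :
    c ∈ Subgroup.center (B n) := by
  rw [Subgroup.mem_center_iff]
  intro g
  induction g using induction with
  | one => simp
  | gen_mul k hk g =>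
    rw [mul_assoc, ← mul_assoc c, ← h k hk, mul_assoc]
    exact mul_right_inj _

theorem fullTwist_mem_center (hn : 2 ≤ n) : fullTwist n ∈ Subgroup.center (B n) := by
  have h0 : Commute (fullTwist n) (gen n 0) := by
    have h : fullTwist n = δ n ^ 2 * δ n ^ (n - 2) := by
      rw [fullTwist, ← pow_add, Nat.add_sub_cancel' hn]
    rw [Commute, SemiconjBy, h, mul_assoc, δ_pow_mul_gen (by omega), ← mul_assoc,
      ← δ_sq_mul_gen hn, mul_assoc]
  refine mem_center_of_gen fun i hi => Commute.symm ?_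
  rw [gen_eq_conj hi]
  have h1 : Commute (fullTwist n) (δ n ^ i) := Commute.pow_pow_self _ _ _
  exact (h1.mul_right h0).mul_right h1.inv_right

theorem deg_genProd {k : ℕ} (hk : k ≤ n - 1) : deg (genProd n k) = k := by
  induction k with
  | zero => simp [genProd]
  | succ k ih => rw [genProd, deg_mul, deg_gen (by omega), ih (by omega)]; simp

theorem deg_δ : deg (δ n) = (n - 1 : ℕ) := deg_genProd le_rfl

theorem deg_fullTwist : deg (fullTwist n) = n * (n - 1 : ℕ) := by
  rw [fullTwist, deg_pow, deg_δ]

theorem gen_mul_δ_pow {k : ℕ} (hk : k ≤ n - 1) :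
    (gen n 0 * δ n) ^ k = genProd n k * δ n ^ k := by
  induction k with
  | zero => simp [genProd]
  | succ k ih =>
    rw [pow_succ', ih (by omega), ← mul_assoc, δ_mul_genProd (by omega), mul_assoc, ← pow_succ']

theorem gen_mul_δ_pow_eq (hn : 1 ≤ n) : (gen n 0 * δ n) ^ (n - 1) = fullTwist n := by
  have h : fullTwist n = δ n * δ n ^ (n - 1) := by
    rw [fullTwist, ← pow_succ', Nat.sub_add_cancel hn]
  rw [gen_mul_δ_pow le_rfl, h]
  rfl

/-! ### Central elements -/

theorem perm_eq_one_of_mem_center (hn : 3 ≤ n) {c : B n} (hc : c ∈ Subgroup.center (B n)) :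
    perm n c = 1 := by
  have hcomm : ∀ s, Commute (perm n c) s := by
    intro s
    obtain ⟨g, rfl⟩ := perm_surjective s
    rw [Commute, SemiconjBy, ← map_mul, ← map_mul, Subgroup.mem_center_iff.1 hc g]
  ext i
  by_contra hne
  have hne : perm n c i ≠ i := fun h => hne (by simp [h])
  obtain ⟨k, hk⟩ : ∃ k, k ∉ ({i, perm n c i} : Finset (Fin n)) := by
    by_contra! h
    have := (Finset.card_le_card (fun x _ => h x : Finset.univ ⊆ _)).trans Finset.card_le_two
    rw [Finset.card_univ, Fintype.card_fin] at this
    omega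
  simp only [Finset.mem_insert, Finset.mem_singleton, not_or] at hk
  have h := DFunLike.congr_fun (hcomm (Equiv.swap (perm n c i) k)).eq i
  simp only [Equiv.Perm.mul_apply, Equiv.swap_apply_left] at h
  rw [Equiv.swap_apply_of_ne_of_ne hne.symm (Ne.symm hk.1)] at h
  exact hk.2 h.symm

theorem cross_of_commute {c g : B n} (hc : perm n c = 1) (h : Commute g c) (i j : Fin n) :
    cross c (perm n g i) (perm n g j) = cross c i j := by
  have := cross_conj g hc (perm n g i) (perm n g j)
  rw [h.eq, mul_inv_cancel_right] at this
  simpa using this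

theorem exists_perm_pair {i j k l : Fin n} (hij : i ≠ j) (hkl : k ≠ l) :
    ∃ s : Equiv.Perm (Fin n), s i = k ∧ s j = l := by
  have hne : Equiv.swap i k j ≠ k := by
    intro h
    exact hij ((Equiv.swap i k).injective (h.trans (Equiv.swap_apply_left i k).symm)).symm
  refine ⟨Equiv.swap (Equiv.swap i k j) l * Equiv.swap i k, ?_, ?_⟩
  · rw [Equiv.Perm.mul_apply, Equiv.swap_apply_left, Equiv.swap_apply_of_ne_of_ne hne.symm hkl]
  · rw [Equiv.Perm.mul_apply, Equiv.swap_apply_left]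

theorem cross_of_mem_center (hn : 3 ≤ n) {c : B n} (hc : c ∈ Subgroup.center (B n)) :
    ∃ m : ℤ, (∀ i j, i ≠ j → cross c i j = 2 * m) ∧ deg c = m * (n * (n - 1)) := by
  have hp := perm_eq_one_of_mem_center hn hc
  set a : Fin n := ⟨0, by omega⟩
  set b : Fin n := ⟨1, by omega⟩
  have hab : a ≠ b := by simp [a, b]
  obtain ⟨m, hm⟩ := even_cross_of_fixed c hab (by simp [hp]) (by simp [hp])
  have key : ∀ i j, i ≠ j → cross c i j = 2 * m := by
    intro i j hij
    obtain ⟨s, rfl, rfl⟩ := exists_perm_pair hab hij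
    obtain ⟨g, rfl⟩ := perm_surjective s
    rw [cross_of_commute hp (Subgroup.mem_center_iff.1 hc g), hm, two_mul]
  refine ⟨m, key, ?_⟩
  have h : ∀ i j, cross c i j = 2 * m - if i = j then 2 * m else 0 := by
    intro i j
    split_ifs with hij
    · simp [hij]
    · simp [key i j hij]
  have hs := sum_cross c
  simp only [h, Finset.sum_sub_distrib, Finset.sum_const, Finset.card_univ, Fintype.card_fin,
    Finset.sum_ite_eq, Finset.mem_univ, if_true, nsmul_eq_mul] at hs
  linarith

/-! ### The Artin action on the free group -/

open FreeGroup (of)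

/-- The Artin automorphism of the free group attached to the `m`-th braid generator. -/
def artinGen (m : ℕ) : MulAut (FreeGroup ℕ) :=
  MonoidHom.toMulEquiv
    (FreeGroup.lift fun j => if j = m then of (m + 1) else
      if j = m + 1 then (of (m + 1))⁻¹ * of m * of (m + 1) else of j)
    (FreeGroup.lift fun j => if j = m then of m * of (m + 1) * (of m)⁻¹ else
      if j = m + 1 then of m else of j)
    (FreeGroup.ext_hom _ _ fun j => by
      rcases eq_or_ne j m with rfl | h1
      · simp
      rcases eq_or_ne j (m + 1) with rfl | h2
      · simp [mul_assoc]
      simp [h1, h2])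
    (FreeGroup.ext_hom _ _ fun j => by
      rcases eq_or_ne j m with rfl | h1
      · simp [mul_assoc]
      rcases eq_or_ne j (m + 1) with rfl | h2
      · simp
      simp [h1, h2])

theorem artinGen_self (m : ℕ) : artinGen m (of m) = of (m + 1) := by
  simp [artinGen]

theorem artinGen_succ (m : ℕ) :
    artinGen m (of (m + 1)) = (of (m + 1))⁻¹ * of m * of (m + 1) := by
  simp [artinGen]

theorem artinGen_of_ne {m j : ℕ} (h : j ≠ m) (h' : j ≠ m + 1) :
    artinGen m (of j) = of j := by
  simp [artinGen, h, h']

theorem mulAut_ext {α : Type*} {e f : MulAut (FreeGroup α)} (h : ∀ j, e (of j) = f (of j)) :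
    e = f :=
  MulEquiv.toMonoidHom_injective (FreeGroup.ext_hom _ _ h)

/-- The Artin action of the braid group on a free group. -/
def artin (n : ℕ) : B n →* MulAut (FreeGroup ℕ) :=
  lift artinGen
    (fun i j hij _ => mulAut_ext fun k => by
      simp only [MulAut.mul_apply]
      rcases eq_or_ne k i with rfl | h1
      · rw [artinGen_of_ne (m := j) (by omega) (by omega), artinGen_self,
          artinGen_of_ne (by omega) (by omega)]
      rcases eq_or_ne k (i + 1) with rfl | h2
      · rw [artinGen_of_ne (m := j) (by omega) (by omega), artinGen_succ]
        simp only [map_mul, map_inv]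
        rw [artinGen_of_ne (m := j) (by omega) (by omega),
          artinGen_of_ne (m := j) (by omega) (by omega)]
      rw [artinGen_of_ne h1 h2]
      rcases eq_or_ne k j with rfl | h3
      · rw [artinGen_self, artinGen_of_ne (by omega) (by omega)]
      rcases eq_or_ne k (j + 1) with rfl | h4
      · rw [artinGen_succ]
        simp only [map_mul, map_inv]
        rw [artinGen_of_ne (m := i) (by omega) (by omega),
          artinGen_of_ne (m := i) (by omega) (by omega)]
      rw [artinGen_of_ne h3 h4, artinGen_of_ne h1 h2])
    (fun i _ => mulAut_ext fun k => by
      simp only [MulAut.mul_apply]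
      have e1 : artinGen i (of (i + 1 + 1)) = of (i + 1 + 1) :=
        artinGen_of_ne (by omega) (by omega)
      have e2 : artinGen (i + 1) (of i) = of i := artinGen_of_ne (by omega) (by omega)
      rcases eq_or_ne k i with rfl | h1
      · simp only [artinGen_self, e1, e2]
      rcases eq_or_ne k (i + 1) with rfl | h2
      · simp only [artinGen_self, artinGen_succ, e1, e2, map_mul, map_inv]
      rcases eq_or_ne k (i + 1 + 1) with rfl | h3
      · simp only [artinGen_self, artinGen_succ, e1, e2, map_mul, map_inv]
        group
      rw [artinGen_of_ne h1 h2, artinGen_of_ne h2 h3, artinGen_of_ne h1 h2, artinGen_of_ne h2 h3])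

theorem artin_gen {m : ℕ} (h : m < n - 1) : artin n (gen n m) = artinGen m := lift_gen h

/-! ### Combing -/

/-- The braid group on `n` strands extended by a free group. -/
abbrev Comb (n : ℕ) : Type := FreeGroup ℕ ⋊[artin n] B n

/-- The free generators inside the combing group. -/
def combX (n j : ℕ) : Comb n := SemidirectProduct.inl (of j)

/-- The braid generators inside the combing group. -/
def combS (n m : ℕ) : Comb n := SemidirectProduct.inr (gen n m)

theorem combS_mul_combX_self {m : ℕ} (h : m < n - 1) :
    combS n m * combX n m = combX n (m + 1) * combS n m := by
  ext <;> simp [combS, combX, artin_gen h, artinGen_self]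

theorem combS_mul_combX_mul_combX {m : ℕ} (h : m < n - 1) :
    combS n m * (combX n m * combX n (m + 1)) = combX n m * combX n (m + 1) * combS n m := by
  ext <;> simp [combS, combX, artin_gen h, artinGen_self, artinGen_succ, mul_assoc]

theorem combS_mul_combX_of_ne {m j : ℕ} (hm : m < n - 1) (h : j ≠ m) (h' : j ≠ m + 1) :
    combS n m * combX n j = combX n j * combS n m := by
  ext <;> simp [combS, combX, artin_gen hm, artinGen_of_ne h h']

theorem combS_comm {i j : ℕ} (hij : i + 2 ≤ j) :
    combS n i * combS n j = combS n j * combS n i := by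
  simp only [combS, ← map_mul, gen_comm hij]

theorem combS_braid {i : ℕ} (hi : i + 1 < n - 1) :
    combS n i * combS n (i + 1) * combS n i = combS n (i + 1) * combS n i * combS n (i + 1) := by
  simp only [combS, ← map_mul, gen_braid hi]

/-- The contribution of the generator `i` when the combed strand sits in position `k`. -/
def combWeight (n i k : ℕ) : Comb n :=
  if k = i then 1 else if k = i + 1 then combX n i else if k < i then combS n (i - 1)
  else combS n i

theorem combWeight_self (i : ℕ) : combWeight n i i = 1 := by simp [combWeight]

theorem combWeight_succ (i : ℕ) : combWeight n i (i + 1) = combX n i := by simp [combWeight]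

theorem combWeight_of_lt {i k : ℕ} (h : k < i) : combWeight n i k = combS n (i - 1) := by
  rw [combWeight, if_neg (by omega), if_neg (by omega), if_pos h]

theorem combWeight_of_gt {i k : ℕ} (h : i + 1 < k) : combWeight n i k = combS n i := by
  rw [combWeight, if_neg (by omega), if_neg (by omega), if_neg (by omega)]

/-- The action of a generator on positions and elements of the combing group. -/
def combPerm (n i : ℕ) : Equiv.Perm (Fin (n + 1) × Comb n) where
  toFun x := (adjSwap (n + 1) i x.1, combWeight n i x.1 * x.2)
  invFun x := ((adjSwap (n + 1) i)⁻¹ x.1,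
    (combWeight n i ((adjSwap (n + 1) i)⁻¹ x.1 : Fin (n + 1)))⁻¹ * x.2)
  left_inv x := by simp
  right_inv x := by simp

theorem combPerm_apply (i : ℕ) (k : Fin (n + 1)) (h : Comb n) :
    combPerm n i (k, h) = (adjSwap (n + 1) i k, combWeight n i k * h) := rfl

theorem combWeight_comm {i j : ℕ} (hij : i + 2 ≤ j) (hj : j < n) (k : Fin (n + 1)) :
    combWeight n i (adjSwap (n + 1) j k : Fin (n + 1)) * combWeight n j k =
      combWeight n j (adjSwap (n + 1) i k : Fin (n + 1)) * combWeight n i k := by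
  rw [adjSwap_val (by omega), adjSwap_val (by omega)]
  generalize hk' : (k : ℕ) = l
  have hk : l ≤ n := by omega
  clear hk' k
  rcases lt_trichotomy l i with h | rfl | h
  · rw [if_neg (by omega), if_neg (by omega), if_neg (by omega), if_neg (by omega),
      combWeight_of_lt h, combWeight_of_lt (by omega), combS_comm (by omega)]
  · rw [if_neg (by omega), if_neg (by omega), if_pos rfl, combWeight_self,
      combWeight_of_lt (by omega), combWeight_of_lt (by omega), one_mul, mul_one]
  obtain rfl | h := eq_or_lt_of_le (Nat.succ_le_of_lt h)
  · rw [if_neg (by omega), if_neg (by omega), if_neg (by omega), if_pos rfl,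
      Nat.succ_eq_add_one, combWeight_succ,
      combWeight_of_lt (by omega), combWeight_of_lt (by omega),
      combS_mul_combX_of_ne (by omega) (by omega) (by omega)]
  rw [if_neg (c := l = i) (by omega), if_neg (c := l = i + 1) (by omega)]
  rcases lt_trichotomy l j with h' | rfl | h'
  · rw [if_neg (by omega), if_neg (by omega),
      combWeight_of_gt (by omega), combWeight_of_lt (by omega), combS_comm (by omega)]
  · rw [if_pos rfl, combWeight_self, combWeight_of_gt (by omega), combWeight_of_gt (by omega),
      one_mul, mul_one]
  obtain rfl | h' := eq_or_lt_of_le (Nat.succ_le_of_lt h')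
  · rw [if_neg (by omega), if_pos rfl, Nat.succ_eq_add_one, combWeight_succ,
      combWeight_of_gt (by omega), combWeight_of_gt (by omega),
      combS_mul_combX_of_ne (by omega) (by omega) (by omega)]
  · rw [if_neg (by omega), if_neg (by omega), combWeight_of_gt (by omega),
      combWeight_of_gt (by omega), combS_comm (by omega)]

theorem combWeight_braid {i : ℕ} (hi : i + 1 < n) (k : Fin (n + 1)) :
    combWeight n i (adjSwap (n + 1) (i + 1) (adjSwap (n + 1) i k) : Fin (n + 1)) *
        combWeight n (i + 1) (adjSwap (n + 1) i k : Fin (n + 1)) * combWeight n i k =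
      combWeight n (i + 1) (adjSwap (n + 1) i (adjSwap (n + 1) (i + 1) k) : Fin (n + 1)) *
        combWeight n i (adjSwap (n + 1) (i + 1) k : Fin (n + 1)) * combWeight n (i + 1) k := by
  simp only [adjSwap_val (show i + 1 < n + 1 by omega),
    adjSwap_val (show i + 1 + 1 < n + 1 by omega)]
  generalize hk' : (k : ℕ) = l
  have hk : l ≤ n := by omega
  clear hk' k
  have e1 : i + 1 + 1 ≠ i := by omega
  have e2 : i ≠ i + 1 + 1 := by omega
  have c1 : combWeight n (i + 1) i = combS n i := combWeight_of_lt (by omega)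
  have c2 : combWeight n i (i + 1 + 1) = combS n i := combWeight_of_gt (by omega)
  rcases lt_trichotomy l i with h | rfl | h
  · have f1 : l ≠ i := by omega
    have f2 : l ≠ i + 1 := by omega
    have f3 : l ≠ i + 1 + 1 := by omega
    have := combS_braid (n := n) (i := i - 1) (by omega)
    rw [show i - 1 + 1 = i by omega] at this
    simp only [f1, f2, f3, if_false, combWeight_of_lt h, combWeight_of_lt (show l < i + 1 by omega),
      Nat.add_sub_cancel, this]
  · simp [e2, c1, c2, combWeight_self]
  obtain rfl | h := eq_or_lt_of_le (Nat.succ_le_of_lt h)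
  · simp [e1, e2, c1, c2, combWeight_self, combWeight_succ,
      combS_mul_combX_self (n := n) (m := i) (by omega)]
  obtain rfl | h := eq_or_lt_of_le (Nat.succ_le_of_lt h)
  · simp [e1, c1, c2, combWeight_succ,
      ← combS_mul_combX_mul_combX (n := n) (m := i) (by omega), mul_assoc]
  · have f1 : l ≠ i := by omega
    have f2 : l ≠ i + 1 := by omega
    have f3 : l ≠ i + 1 + 1 := by omega
    simp only [f1, f2, f3, if_false, combWeight_of_gt (show i + 1 < l by omega),
      combWeight_of_gt (show i + 1 + 1 < l by omega), combS_braid (n := n) (i := i) (by omega)]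

/-- The combing action of the braid group on `n + 1` strands. -/
def combHom (n : ℕ) : B (n + 1) →* Equiv.Perm (Fin (n + 1) × Comb n) :=
  lift (combPerm n)
    (fun i j hij hj => by
      refine Equiv.ext fun ⟨k, h⟩ => ?_
      simp only [Equiv.Perm.mul_apply, combPerm_apply, Prod.mk.injEq]
      refine ⟨DFunLike.congr_fun (adjSwap_comm hij hj) k, ?_⟩
      rw [← mul_assoc, ← mul_assoc, combWeight_comm (n := n) hij hj])
    (fun i hi => by
      refine Equiv.ext fun ⟨k, h⟩ => ?_
      simp only [Equiv.Perm.mul_apply, combPerm_apply, Prod.mk.injEq]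
      refine ⟨DFunLike.congr_fun (adjSwap_braid hi) k, ?_⟩
      simp only [← mul_assoc, combWeight_braid (n := n) hi])

/-- The element of the combing group recorded by moving the strand starting at `k`. -/
def comb (g : B (n + 1)) (k : Fin (n + 1)) : Comb n := (combHom n g (k, 1)).2

@[simp] theorem comb_one (k : Fin (n + 1)) : comb (1 : B (n + 1)) k = 1 := by simp [comb]

theorem combHom_apply (g : B (n + 1)) (k : Fin (n + 1)) (h : Comb n) :
    combHom n g (k, h) = (perm (n + 1) g k, comb g k * h) := by
  have key : ∀ g : B (n + 1), ∀ k h, ∃ c,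
      combHom n g (k, h) = (perm (n + 1) g k, c * h) ∧
      combHom n g (k, 1) = (perm (n + 1) g k, c) := by
    intro g
    induction g using induction with
    | one => intro i m; exact ⟨1, by simp, by simp⟩
    | gen_mul i hi g =>
      have hg : combHom n (gen (n + 1) i) = combPerm n i := lift_gen hi
      refine forall_congr' fun k => forall_congr' fun h => ?_
      simp only [map_mul, Equiv.Perm.mul_apply, hg, perm_gen hi]
      constructor
      · rintro ⟨c, h1, h2⟩
        refine ⟨(combWeight n i (perm (n + 1) g k : Fin (n + 1)))⁻¹ * c,
          (combPerm n i).injective ?_, (combPerm n i).injective ?_⟩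
        · rw [h1, combPerm_apply, mul_assoc, mul_inv_cancel_left]
        · rw [h2, combPerm_apply, mul_inv_cancel_left]
      · rintro ⟨c, h1, h2⟩
        refine ⟨combWeight n i (perm (n + 1) g k : Fin (n + 1)) * c, ?_, ?_⟩
        · rw [h1, combPerm_apply, mul_assoc]
        · rw [h2, combPerm_apply]
  obtain ⟨c, h1, h2⟩ := key g k h
  rw [h1, comb, h2]

theorem comb_mul (g h : B (n + 1)) (k : Fin (n + 1)) :
    comb (g * h) k = comb g (perm (n + 1) h k) * comb h k := by
  rw [comb, map_mul, Equiv.Perm.mul_apply, combHom_apply h, combHom_apply g, mul_one]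

theorem comb_gen {i : ℕ} (hi : i < n) (k : Fin (n + 1)) :
    comb (gen (n + 1) i) k = combWeight n i k := by
  have h : combHom n (gen (n + 1) i) = combPerm n i := lift_gen hi
  rw [comb, h, combPerm_apply, mul_one]

/-! ### Recovering a braid from its combing -/

/-- The inclusion of the braid group acting on all strands but the first. -/
def shift (n : ℕ) : B n →* B (n + 1) :=
  lift (fun i => gen (n + 1) (i + 1)) (fun i j hij _ => gen_comm (by omega))
    (fun i hi => gen_braid (by omega))

theorem shift_gen {i : ℕ} (hi : i < n - 1) : shift n (gen n i) = gen (n + 1) (i + 1) :=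
  lift_gen hi

/-- The braid moving the first strand to position `k`. -/
def transport (n : ℕ) : ℕ → B n
  | 0 => 1
  | k + 1 => gen n k * transport n k

theorem commute_gen {i j : ℕ} (hij : i + 2 ≤ j) : Commute (gen n i) (gen n j) := gen_comm hij

theorem commute_transport {i k : ℕ} (h : k + 1 ≤ i) : Commute (gen n i) (transport n k) := by
  induction k with
  | zero => exact Commute.one_right _
  | succ k ih => exact (commute_gen (by omega)).symm.mul_right (ih (by omega))

theorem gen_mul_transport {i k : ℕ} (h : i + 2 ≤ k) (hk : k < n) :
    gen n i * transport n k = transport n k * gen n (i + 1) := by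
  induction k with
  | zero => omega
  | succ k ih =>
    rcases Nat.lt_or_ge (i + 1) k with h' | h'
    · rw [transport, ← mul_assoc, gen_comm (by omega), mul_assoc, ih h' (by omega), mul_assoc]
    · obtain rfl : k = i + 1 := by omega
      simp only [transport]
      rw [← mul_assoc, ← mul_assoc, gen_braid (by omega), mul_assoc, (commute_transport le_rfl).eq]
      simp only [mul_assoc]

/-- The pure braid in which the first strand circles the strand `j + 1`. -/
def pureGen (n j : ℕ) : B n :=
  if j < n - 1 then (transport n j)⁻¹ * gen n j ^ 2 * transport n j else 1

section BraidIdentities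

variable {G : Type*} [Group G] {a b t : G}

theorem conj_sq_of_braid (h : a * b * a = b * a * b) : b * a ^ 2 = a⁻¹ * b ^ 2 * a * b := by
  rw [mul_assoc, mul_assoc, eq_inv_mul_iff_mul_eq]
  calc a * (b * a ^ 2) = (a * b * a) * a := by simp only [pow_two, mul_assoc]
    _ = b * (a * b * a) := by
      rw [h]
      simp only [mul_assoc]
      rw [← mul_assoc a b a, h]
      simp only [mul_assoc]
    _ = b ^ 2 * (a * b) := by rw [h]; simp only [pow_two, mul_assoc]

theorem sq_mul_conj_sq_of_braid (h : a * b * a = b * a * b) :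
    b * (a ^ 2 * (a⁻¹ * b ^ 2 * a)) = a ^ 2 * (a⁻¹ * b ^ 2 * a) * b := by
  have h1 : a ^ 2 * (a⁻¹ * b ^ 2 * a) = a * b * (b * a) := by
    simp only [pow_two, mul_assoc, mul_inv_cancel_left]
  rw [h1]
  calc b * (a * b * (b * a)) = (b * a * b) * (b * a) := by simp only [mul_assoc]
    _ = a * b * (a * b * a) := by rw [← h]; simp only [mul_assoc]
    _ = a * b * (b * a) * b := by rw [h]; simp only [mul_assoc]

theorem conj_of_commute (hb : Commute b t) (c : G) : b * (t⁻¹ * c * t) = t⁻¹ * (b * c) * t := by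
  rw [← mul_assoc, ← mul_assoc, hb.inv_right.eq]
  simp only [mul_assoc]

theorem conj_of_commute' (hb : Commute b t) (c : G) : t⁻¹ * c * t * b = t⁻¹ * (c * b) * t := by
  rw [mul_assoc, ← hb.eq]
  simp only [mul_assoc]

end BraidIdentities

theorem gen_mul_pureGen_self {m : ℕ} (hm : m + 1 < n - 1) :
    gen n (m + 1) * pureGen n m = pureGen n (m + 1) * gen n (m + 1) := by
  have hc : Commute (gen n (m + 1)) (transport n m) := commute_transport le_rfl
  rw [pureGen, if_pos (by omega), pureGen, if_pos hm, transport, conj_of_commute hc,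
    conj_sq_of_braid (gen_braid hm), ← conj_of_commute' hc]
  simp only [mul_inv_rev, mul_assoc]

theorem gen_mul_pureGen_mul_pureGen {m : ℕ} (hm : m + 1 < n - 1) :
    gen n (m + 1) * (pureGen n m * pureGen n (m + 1)) =
      pureGen n m * pureGen n (m + 1) * gen n (m + 1) := by
  have hc : Commute (gen n (m + 1)) (transport n m) := commute_transport le_rfl
  have h : pureGen n m * pureGen n (m + 1) = (transport n m)⁻¹ *
      (gen n m ^ 2 * ((gen n m)⁻¹ * gen n (m + 1) ^ 2 * gen n m)) * transport n m := by
    rw [pureGen, if_pos (by omega), pureGen, if_pos hm, transport]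
    group
  rw [h, conj_of_commute hc, conj_of_commute' hc, sq_mul_conj_sq_of_braid (gen_braid hm)]

theorem gen_mul_pureGen_of_ne {m j : ℕ} (h : j ≠ m) (h' : j ≠ m + 1) :
    gen n (m + 1) * pureGen n j = pureGen n j * gen n (m + 1) := by
  rw [pureGen]
  split_ifs with hj
  · rcases Nat.lt_or_ge j m with hlt | hge
    · have hc : Commute (gen n (m + 1)) (transport n j) := commute_transport (by omega)
      have hc' : Commute (gen n (m + 1)) (gen n j ^ 2) :=
        (commute_gen (by omega)).symm.pow_right 2
      exact (hc.inv_right.mul_right hc').mul_right hc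
    · have h1 := gen_mul_transport (n := n) (i := m) (k := j) (by omega) (by omega)
      have h2 : Commute (gen n m) (gen n j ^ 2) := (commute_gen (by omega)).pow_right 2
      have h3 : gen n (m + 1) = (transport n j)⁻¹ * gen n m * transport n j := by
        rw [mul_assoc, h1, inv_mul_cancel_left]
      rw [h3]
      simp only [mul_assoc, mul_inv_cancel_left]
      rw [← mul_assoc (gen n m), h2.eq, mul_assoc]
  · simp

/-- The pure braids in which only the first strand moves. -/
def pureHom (n : ℕ) : FreeGroup ℕ →* B (n + 1) := FreeGroup.lift (pureGen (n + 1))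

theorem pureHom_artin (b : B n) (w : FreeGroup ℕ) :
    pureHom n (artin n b w) = shift n b * pureHom n w * (shift n b)⁻¹ := by
  induction b using induction generalizing w with
  | one => simp
  | gen_mul m hm g =>
    have key : ∀ w, pureHom n (artinGen m w) =
        gen (n + 1) (m + 1) * pureHom n w * (gen (n + 1) (m + 1))⁻¹ := by
      suffices h : (pureHom n).comp (artinGen m).toMonoidHom =
          (MulAut.conj (gen (n + 1) (m + 1))).toMonoidHom.comp (pureHom n) from
        fun w => DFunLike.congr_fun h w
      refine FreeGroup.ext_hom _ _ fun j => ?_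
      simp only [MonoidHom.comp_apply, MulEquiv.coe_toMonoidHom, MulAut.conj_apply]
      have e : ∀ j, pureHom n (of j) = pureGen (n + 1) j := fun j => by simp [pureHom]
      rcases eq_or_ne j m with rfl | h1
      · rw [artinGen_self, e, e, gen_mul_pureGen_self (by omega), mul_inv_cancel_right]
      rcases eq_or_ne j (m + 1) with rfl | h2
      · rw [artinGen_succ, map_mul, map_mul, map_inv, e, e, mul_assoc,
          inv_mul_eq_iff_eq_mul, ← mul_assoc, ← mul_assoc, eq_mul_inv_iff_mul_eq,
          ← gen_mul_pureGen_mul_pureGen (by omega), ← mul_assoc, gen_mul_pureGen_self (by omega)]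
      · rw [artinGen_of_ne h1 h2, e, gen_mul_pureGen_of_ne h1 h2, mul_inv_cancel_right]
    rw [map_mul, map_mul, artin_gen hm, shift_gen hm]
    refine forall_congr' fun w => ?_
    rw [MulAut.mul_apply, key, mul_inv_rev]
    rw [← mul_assoc, mul_left_inj, mul_assoc, mul_assoc, mul_right_inj, ← mul_assoc]

/-- The braid on `n + 1` strands encoded by an element of the combing group. -/
def uncomb (n : ℕ) : Comb n →* B (n + 1) :=
  SemidirectProduct.lift (pureHom n) (shift n) fun b => MonoidHom.ext fun w => by
    simp [pureHom_artin]

theorem uncomb_combX (j : ℕ) : uncomb n (combX n j) = pureGen (n + 1) j := by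
  simp [uncomb, combX, pureHom]

theorem uncomb_combS {m : ℕ} (h : m < n - 1) : uncomb n (combS n m) = gen (n + 1) (m + 1) := by
  simp [uncomb, combS, shift_gen h]

theorem gen_mul_transport_eq {i : ℕ} (hi : i < n) (k : Fin (n + 1)) :
    gen (n + 1) i * transport (n + 1) k =
      transport (n + 1) (adjSwap (n + 1) i k : Fin (n + 1)) * uncomb n (combWeight n i k) := by
  rw [adjSwap_val (by omega)]
  generalize hk' : (k : ℕ) = l
  have hk : l ≤ n := by omega
  clear hk' k
  rcases lt_trichotomy l i with h | rfl | h
  · rw [if_neg (by omega), if_neg (by omega), combWeight_of_lt h, uncomb_combS (by omega),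
      Nat.sub_add_cancel (by omega), (commute_transport h).eq]
  · rw [if_pos rfl, combWeight_self, map_one, mul_one, transport]
  rw [if_neg (by omega)]
  obtain rfl | h := eq_or_lt_of_le (Nat.succ_le_of_lt h)
  · rw [if_pos rfl, Nat.succ_eq_add_one, combWeight_succ, uncomb_combX, pureGen,
      if_pos (by omega), transport]
    simp only [pow_two, mul_assoc, mul_inv_cancel_left]
  · rw [if_neg (by omega), combWeight_of_gt (by omega), uncomb_combS (by omega),
      gen_mul_transport (by omega) (by omega)]

theorem mul_transport_eq (g : B (n + 1)) (k : Fin (n + 1)) :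
    g * transport (n + 1) k =
      transport (n + 1) (perm (n + 1) g k : Fin (n + 1)) * uncomb n (comb g k) := by
  induction g using induction with
  | one => simp
  | gen_mul i hi g =>
    rw [comb_mul, map_mul, comb_gen (n := n) hi, map_mul, perm_gen hi, Equiv.Perm.mul_apply,
      ← mul_assoc, ← gen_mul_transport_eq (n := n) hi, mul_assoc, mul_assoc]
    exact mul_right_inj _

theorem eq_uncomb (g : B (n + 1)) (hg : perm (n + 1) g 0 = 0) : g = uncomb n (comb g 0) := by
  have := mul_transport_eq g 0
  simpa [hg, transport] using this

theorem deg_eq_sum_cross_add (g : B (n + 1)) (k : Fin (n + 1)) :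
    deg g = ∑ j, cross g k j + deg (comb g k).right := by
  induction g using induction with
  | one => simp
  | gen_mul i hi g =>
    have h1 : ∑ j, cross (gen (n + 1) i * g) k j =
        ∑ j, cross g k j + ∑ j : Fin (n + 1), weight i (perm (n + 1) g k : Fin (n + 1)) j := by
      simp only [cross_mul, Finset.sum_add_distrib, cross_gen hi]
      congr 1
      exact Equiv.sum_comp (perm (n + 1) g)
        fun j : Fin (n + 1) => weight i (perm (n + 1) g k : Fin (n + 1)) j
    have h2 : ∑ j : Fin (n + 1), weight i (perm (n + 1) g k : Fin (n + 1)) j +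
        deg (combWeight n i (perm (n + 1) g k : Fin (n + 1))).right = 1 := by
      generalize hl' : ((perm (n + 1) g k : Fin (n + 1)) : ℕ) = l
      have hl : l ≤ n := by omega
      clear hl'
      rcases lt_trichotomy l i with h | rfl | h
      · rw [combWeight_of_lt h, Finset.sum_eq_zero fun j _ => ?_, combS,
          SemidirectProduct.right_inr, deg_gen (by omega), zero_add]
        rw [weight, if_neg (by omega)]
      · rw [combWeight_self, Finset.sum_eq_single ⟨l + 1, by omega⟩]
        · simp [weight]
        · intro j _ hj
          have : (j : ℕ) ≠ l + 1 := fun h => hj (Fin.ext h)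
          rw [weight, if_neg (by omega)]
        · simp
      obtain rfl | h := eq_or_lt_of_le (Nat.succ_le_of_lt h)
      · rw [Nat.succ_eq_add_one, combWeight_succ, Finset.sum_eq_single ⟨i, by omega⟩]
        · simp [weight, combX]
        · intro j _ hj
          have : (j : ℕ) ≠ i := fun h => hj (Fin.ext h)
          rw [weight, if_neg (by omega)]
        · simp
      · rw [combWeight_of_gt (by omega), Finset.sum_eq_zero fun j _ => ?_, combS,
          SemidirectProduct.right_inr, deg_gen (by omega), zero_add]
        rw [weight, if_neg (by omega)]
    rw [h1, comb_mul, comb_gen (n := n) hi, SemidirectProduct.mul_right, deg_mul, deg_mul,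
      deg_gen hi]
    constructor <;> intro h <;> linarith

/-! ### The center -/

theorem freeGroup_eq_one_of_commute {α : Type*} {a b : α} (hab : a ≠ b) {w : FreeGroup α}
    (ha : Commute w (of a)) (hb : Commute w (of b)) : w = 1 := by
  classical
  by_contra hw
  obtain ⟨x, L, hL⟩ : ∃ x L, w.toWord = x :: L := by
    cases h : w.toWord with
    | nil => exact absurd (FreeGroup.toWord_eq_nil_iff.1 h) hw
    | cons x L => exact ⟨x, L, rfl⟩
  obtain ⟨y, hy, hc⟩ : ∃ y, y ≠ x.1 ∧ Commute w (of y) := by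
    rcases eq_or_ne a x.1 with rfl | h
    · exact ⟨b, hab.symm, hb⟩
    · exact ⟨a, h, ha⟩
  have h1 : (of y * w).toWord = (y, true) :: x :: L := by
    rw [FreeGroup.toWord_mul, FreeGroup.toWord_of, hL, List.singleton_append,
      FreeGroup.reduce.cons, ← hL, FreeGroup.reduce_toWord, hL]
    simp [hy]
  have h2 := FreeGroup.toWord_mul_sublist w (of y)
  rw [hc.eq, h1, FreeGroup.toWord_of, hL] at h2
  have h3 := h2.eq_of_length (by simp)
  simp only [List.cons_append, List.cons.injEq] at h3
  exact hy (congrArg Prod.fst h3.1)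

theorem commute_comb {c g : B (n + 1)} (hc : perm (n + 1) c = 1) (h : Commute c g)
    (hg : perm (n + 1) g 0 = 0) : Commute (comb c 0) (comb g 0) := by
  have h1 := comb_mul c g 0
  rw [h.eq, comb_mul, hg, hc] at h1
  exact h1.symm

/-- A central braid is determined by its exponent sum. -/
theorem eq_one_of_mem_center (hn : 2 ≤ n) {c : B n} (hc : c ∈ Subgroup.center (B n))
    (hd : deg c = 0) : c = 1 := by
  induction n, hn using Nat.le_induction with
  | base =>
    have key : ∀ g : B 2, g = gen 2 0 ^ deg g := by
      intro g
      induction g using induction with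
      | one => simp
      | gen_mul i hi g =>
        obtain rfl : i = 0 := by omega
        rw [deg_mul, deg_gen hi, zpow_add, zpow_one]
        exact mul_right_inj _
    rw [key c, hd, zpow_zero]
  | succ n hn ih =>
    have hp := perm_eq_one_of_mem_center (by omega) hc
    have hcomm : ∀ g, Commute c g := fun g => (Subgroup.mem_center_iff.1 hc g).symm
    have hS : ∀ m < n - 1, Commute (comb c 0) (combS n m) := by
      intro m hm
      have h1 : m + 1 < n + 1 - 1 := by omega
      have h := commute_comb hp (hcomm (gen (n + 1) (m + 1))) (by
        rw [perm_gen h1]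
        ext
        rw [adjSwap_val (by omega)]
        simp)
      rw [comb_gen (by omega)] at h
      rwa [Fin.val_zero, combWeight_of_lt (by omega)] at h
    have hX0 : Commute (comb c 0) (combX n 0) := by
      have h0 : 0 < n + 1 - 1 := by omega
      have hs : ((adjSwap (n + 1) 0 0 : Fin (n + 1)) : ℕ) = 0 + 1 := by
        rw [adjSwap_val (by omega)]; simp
      have h := commute_comb hp (hcomm (gen (n + 1) 0 * gen (n + 1) 0)) (by
        rw [map_mul, perm_gen h0]
        ext
        rw [Equiv.Perm.mul_apply, adjSwap_val (by omega), hs]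
        simp)
      rw [comb_mul, comb_gen (by omega), comb_gen (by omega), perm_gen h0, hs, Fin.val_zero,
        combWeight_succ, combWeight_self, mul_one] at h
      exact h
    have hX1 : Commute (comb c 0) (combX n 1) := by
      have h := combS_mul_combX_self (n := n) (m := 0) (by omega)
      rw [show combX n 1 = _ from eq_mul_inv_iff_mul_eq.2 h.symm]
      exact ((hS 0 (by omega)).mul_right hX0).mul_right (hS 0 (by omega)).inv_right
    have hb : (comb c 0).right = 1 := by
      refine ih (mem_center_of_gen fun m hm => ?_) ?_
      · have := congrArg SemidirectProduct.right (hS m hm).eq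
        simpa [combS] using this.symm
      · obtain ⟨m, hm, hd'⟩ := cross_of_mem_center (by omega) hc
        have hm0 : m = 0 := by
          rw [hd] at hd'
          rcases mul_eq_zero.1 hd'.symm with h | h
          · exact h
          · exact absurd h (mul_ne_zero (by omega) (by push_cast; omega))
        have h0 : ∀ j, cross c 0 j = 0 := by
          intro j
          rcases eq_or_ne 0 j with rfl | h
          · simp
          · rw [hm 0 j h, hm0, mul_zero]
        have := deg_eq_sum_cross_add c 0
        rw [hd] at this
        simpa [h0] using this.symm
    have hw : comb c 0 = SemidirectProduct.inl (comb c 0).left := by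
      ext <;> simp [hb]
    have hw1 : (comb c 0).left = 1 := by
      refine freeGroup_eq_one_of_commute (a := 0) (b := 1) (by simp) ?_ ?_
      · have h := hX0
        rw [hw] at h
        exact SemidirectProduct.inl_injective (by simpa [combX] using h.eq)
      · have h := hX1
        rw [hw] at h
        exact SemidirectProduct.inl_injective (by simpa [combX] using h.eq)
    rw [eq_uncomb c (by simp [hp]), hw, hw1, map_one, map_one]

theorem eq_of_mem_center (hn : 2 ≤ n) {c c' : B n} (hc : c ∈ Subgroup.center (B n))
    (hc' : c' ∈ Subgroup.center (B n)) (h : deg c = deg c') : c = c' := by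
  rw [← mul_inv_eq_one]
  refine eq_one_of_mem_center hn (mul_mem hc (inv_mem hc')) ?_
  rw [deg_mul, deg_inv, h, add_neg_cancel]

theorem exists_eq_fullTwist_zpow (hn : 3 ≤ n) {c : B n} (hc : c ∈ Subgroup.center (B n)) :
    ∃ m : ℤ, c = fullTwist n ^ m := by
  obtain ⟨m, -, hd⟩ := cross_of_mem_center hn hc
  refine ⟨m, eq_of_mem_center (by omega) hc
    (zpow_mem (fullTwist_mem_center (by omega)) m) ?_⟩
  rw [hd, deg_zpow, deg_fullTwist, Nat.cast_sub (by omega), Nat.cast_one]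

/-! ### Generation of the pure braid group -/

theorem shift_mem {b : B n} (K : Subgroup (B (n + 1))) [K.Normal]
    (hK : ∀ i < n, gen (n + 1) i ^ 2 ∈ K) : 
    b ∈ Subgroup.normalClosure {g | ∃ i < n - 1, gen n i ^ 2 = g} → shift n b ∈ K := by
  intro hb
  have : Subgroup.normalClosure {g | ∃ i < n - 1, gen n i ^ 2 = g} ≤ K.comap (shift n) := by
    refine Subgroup.normalClosure_le_normal ?_
    rintro _ ⟨i, hi, rfl⟩
    simp only [SetLike.mem_coe, Subgroup.mem_comap, map_pow, shift_gen hi]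
    exact hK _ (by omega)
  exact this hb

theorem perm_shift (b : B n) (i : Fin n) : perm (n + 1) (shift n b) i.succ = (perm n b i).succ := by
  induction b using induction generalizing i with
  | one => simp
  | gen_mul m hm g =>
    have h1 : m + 1 < n + 1 - 1 := by omega
    have key : ∀ j : Fin n, adjSwap (n + 1) (m + 1) j.succ = (adjSwap n m j).succ := by
      intro j
      ext
      rw [adjSwap_val (by omega), Fin.val_succ, Fin.val_succ, adjSwap_val (by omega)]
      split_ifs <;> omega
    refine forall_congr' fun i => ?_
    rw [map_mul, map_mul, map_mul, shift_gen hm, perm_gen h1, perm_gen hm, Equiv.Perm.mul_apply,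
      Equiv.Perm.mul_apply, ← key]
    exact (adjSwap (n + 1) (m + 1)).injective.eq_iff

theorem perm_pureHom (w : FreeGroup ℕ) : perm (n + 1) (pureHom n w) = 1 := by
  have : (perm (n + 1)).comp (pureHom n) = 1 := by
    refine FreeGroup.ext_hom _ _ fun j => ?_
    simp only [MonoidHom.comp_apply, pureHom, FreeGroup.lift_apply_of, MonoidHom.one_apply, pureGen]
    split_ifs with h
    · have h2 : adjSwap (n + 1) j ^ 2 = 1 := by
        rw [adjSwap, dif_pos (by omega), pow_two, Equiv.swap_mul_self]
      simp [perm_gen h, h2]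
    · simp
  exact DFunLike.congr_fun this w

theorem pureHom_mem (K : Subgroup (B (n + 1))) [hN : K.Normal]
    (hK : ∀ i < n, gen (n + 1) i ^ 2 ∈ K) (w : FreeGroup ℕ) : pureHom n w ∈ K := by
  have : (QuotientGroup.mk' K).comp (pureHom n) = 1 := by
    refine FreeGroup.ext_hom _ _ fun j => ?_
    simp only [MonoidHom.comp_apply, pureHom, FreeGroup.lift_apply_of, MonoidHom.one_apply, pureGen]
    split_ifs with h
    · rw [QuotientGroup.mk'_apply, QuotientGroup.eq_one_iff]
      have := hN.conj_mem _ (hK j (by omega)) (transport (n + 1) j)⁻¹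
      rwa [inv_inv] at this
    · simp
  have := DFunLike.congr_fun this w
  rwa [MonoidHom.comp_apply, QuotientGroup.mk'_apply, MonoidHom.one_apply,
    QuotientGroup.eq_one_iff] at this

/-- Pure braids are products of conjugates of squares of generators. -/
theorem mem_normalClosure_of_perm_eq_one {g : B n} (hg : perm n g = 1) :
    g ∈ Subgroup.normalClosure {g | ∃ i < n - 1, gen n i ^ 2 = g} := by
  induction n with
  | zero =>
    rw [show g = 1 from ?_]
    · exact one_mem _
    · induction g using induction with
      | one => rfl
      | gen_mul i hi g => omega
  | succ n ih =>
    have hK : ∀ i < n, gen (n + 1) i ^ 2 ∈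
        Subgroup.normalClosure {g | ∃ i < n + 1 - 1, gen (n + 1) i ^ 2 = g} :=
      fun i hi => Subgroup.subset_normalClosure ⟨i, by omega, rfl⟩
    have h := eq_uncomb g (by rw [hg]; rfl)
    have h' : g = pureHom n (comb g 0).left * shift n (comb g 0).right := h
    have hs : perm (n + 1) (shift n (comb g 0).right) = 1 := by
      rw [h', map_mul, perm_pureHom, one_mul] at hg
      exact hg
    rw [h']
    refine mul_mem (pureHom_mem _ hK _) (shift_mem _ hK (ih ?_))
    ext i
    have := perm_shift (comb g 0).right i
    rw [hs] at this
    rw [← Fin.succ_inj.1 this]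
    rfl

/-! ### Endomorphisms inducing automorphisms modulo the center -/

theorem deg_hom (F : B n →* B n) (g : B n) : deg (F g) = deg (F (gen n 0)) * deg g := by
  have h := hom_eq_zpow_deg ((expSum n).comp F) g
  have hadd := congrArg Multiplicative.toAdd h
  rw [toAdd_zpow, smul_eq_mul, mul_comm] at hadd
  exact hadd

/-- An endomorphism compatible with the center, and surjective modulo the center. -/
structure IsCentralLift (F : B n →* B n) : Prop where
  map_fullTwist : F (fullTwist n) = fullTwist n ^ deg (F (gen n 0))
  exists_eq : ∀ g, ∃ g' : B n, ∃ j : ℤ, F g' * fullTwist n ^ j = g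

theorem fullTwist_zpow_mem_center (hn : 2 ≤ n) (k : ℤ) :
    fullTwist n ^ k ∈ Subgroup.center (B n) :=
  zpow_mem (fullTwist_mem_center hn) k

theorem commute_fullTwist_zpow (hn : 2 ≤ n) (k : ℤ) (g : B n) : Commute (fullTwist n ^ k) g :=
  (Subgroup.mem_center_iff.1 (fullTwist_zpow_mem_center hn k) g).symm

theorem mk_eq_mk_iff {g h : B n} :
    (g : B n ⧸ Subgroup.center (B n)) = h ↔ g⁻¹ * h ∈ Subgroup.center (B n) :=
  QuotientGroup.eq

theorem eq_of_mk_eq_mk (hn : 2 ≤ n) {g h : B n}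
    (hgh : (g : B n ⧸ Subgroup.center (B n)) = h) (hd : deg g = deg h) : g = h := by
  rw [mk_eq_mk_iff] at hgh
  have := eq_one_of_mem_center hn hgh (by rw [deg_mul, deg_inv, hd, neg_add_cancel])
  rwa [inv_mul_eq_one] at this

theorem exists_eq_mul_of_mk_eq_mk (hn : 3 ≤ n) {g h : B n}
    (hgh : (g : B n ⧸ Subgroup.center (B n)) = h) : ∃ j : ℤ, g * fullTwist n ^ j = h := by
  rw [mk_eq_mk_iff] at hgh
  obtain ⟨j, hj⟩ := exists_eq_fullTwist_zpow hn hgh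
  exact ⟨j, by rw [← hj, mul_inv_cancel_left]⟩

theorem mk_mul_fullTwist_zpow (hn : 2 ≤ n) (g : B n) (j : ℤ) :
    ((g * fullTwist n ^ j : B n) : B n ⧸ Subgroup.center (B n)) = g :=
  QuotientGroup.mk_mul_of_mem g (fullTwist_zpow_mem_center hn j)

theorem isCentralLift_of_mk_eq (hn : 3 ≤ n) (φ : MulAut (B n ⧸ Subgroup.center (B n)))
    {F : B n →* B n} (hF : ∀ g : B n, (F g : B n ⧸ Subgroup.center (B n)) = φ g) :
    IsCentralLift F where
  map_fullTwist := by
    have h : ((F (fullTwist n) : B n) : B n ⧸ Subgroup.center (B n)) = (1 : B n) := by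
      rw [hF, (QuotientGroup.eq_one_iff _).2 (fullTwist_mem_center (by omega)), map_one]
      rfl
    refine eq_of_mk_eq_mk (by omega) ?_ ?_
    · rw [h, QuotientGroup.mk_one, eq_comm, QuotientGroup.eq_one_iff]
      exact fullTwist_zpow_mem_center (by omega) _
    · rw [deg_hom, deg_zpow]
  exists_eq g := by
    obtain ⟨x, hx⟩ := φ.surjective (g : B n ⧸ Subgroup.center (B n))
    obtain ⟨g', rfl⟩ := QuotientGroup.mk_surjective x
    rw [← hF] at hx
    exact ⟨g', exists_eq_mul_of_mk_eq_mk hn hx⟩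

theorem exists_lift (hn : 3 ≤ n) (φ : MulAut (B n ⧸ Subgroup.center (B n))) :
    ∃ F : B n →* B n, ∀ g : B n, (F g : B n ⧸ Subgroup.center (B n)) = φ g := by
  obtain ⟨a, ha⟩ := QuotientGroup.mk_surjective (φ (gen n 0 : B n))
  have key : ∀ i < n - 1, ∃ b : B n,
      (b : B n ⧸ Subgroup.center (B n)) = φ (gen n i : B n) ∧ deg b = deg a := by
    intro i hi
    induction i with
    | zero => exact ⟨a, ha, rfl⟩
    | succ i ih =>
      obtain ⟨b, hb, hd⟩ := ih (by omega)
      obtain ⟨b', hb'⟩ := QuotientGroup.mk_surjective (φ (gen n (i + 1) : B n))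
      have hc : (b' * b * b')⁻¹ * (b * b' * b) ∈ Subgroup.center (B n) := by
        rw [← mk_eq_mk_iff]
        simp only [QuotientGroup.mk_mul, hb, hb', ← map_mul]
        rw [← QuotientGroup.mk_mul, ← QuotientGroup.mk_mul, ← QuotientGroup.mk_mul,
          ← QuotientGroup.mk_mul, gen_braid hi]
      refine ⟨b' * ((b' * b * b')⁻¹ * (b * b' * b)), ?_, ?_⟩
      · rw [QuotientGroup.mk_mul_of_mem _ hc, hb']
      · simp only [deg_mul, deg_inv]
        linarith
  choose! b hb hd using key
  have hcomm : ∀ i j, i + 2 ≤ j → j < n - 1 → b i * b j = b j * b i := by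
    intro i j hij hj
    refine eq_of_mk_eq_mk (by omega) ?_ ?_
    · rw [QuotientGroup.mk_mul, QuotientGroup.mk_mul, hb i (by omega), hb j hj, ← map_mul,
        ← map_mul, ← QuotientGroup.mk_mul, ← QuotientGroup.mk_mul, gen_comm hij]
    · rw [deg_mul, deg_mul, add_comm]
  have hbraid : ∀ i, i + 1 < n - 1 → b i * b (i + 1) * b i = b (i + 1) * b i * b (i + 1) := by
    intro i hi
    have hi' : i < n - 1 := by omega
    refine eq_of_mk_eq_mk (by omega) ?_ ?_
    · simp only [QuotientGroup.mk_mul, hb i hi', hb (i + 1) hi, ← map_mul]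
      rw [← QuotientGroup.mk_mul, ← QuotientGroup.mk_mul, ← QuotientGroup.mk_mul,
        ← QuotientGroup.mk_mul, gen_braid hi]
    · simp only [deg_mul, hd i hi', hd (i + 1) hi]
  refine ⟨lift b hcomm hbraid, fun g => ?_⟩
  have h : (QuotientGroup.mk' (Subgroup.center (B n))).comp (lift b hcomm hbraid) =
      φ.toMonoidHom.comp (QuotientGroup.mk' (Subgroup.center (B n))) :=
    hom_ext fun i hi => by
      simp only [MonoidHom.comp_apply, lift_gen hi, QuotientGroup.mk'_apply, hb i hi]
      rfl
  exact DFunLike.congr_fun h g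

/-- Multiplying an endomorphism by a power of the full twist. -/
def twist (hn : 2 ≤ n) (F : B n →* B n) (k : ℤ) : B n →* B n where
  toFun g := F g * fullTwist n ^ (k * deg g)
  map_one' := by simp
  map_mul' g h := by
    rw [map_mul, deg_mul, mul_add, zpow_add, mul_assoc, mul_assoc, ← mul_assoc (F h),
      ← mul_assoc (fullTwist n ^ (k * deg g)), (commute_fullTwist_zpow hn _ (F h)).eq]

theorem bijective_of_deg (hn : 3 ≤ n) (φ : MulAut (B n ⧸ Subgroup.center (B n)))
    {F : B n →* B n} (hF : ∀ g : B n, (F g : B n ⧸ Subgroup.center (B n)) = φ g)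
    (hd : deg (F (gen n 0)) ^ 2 = 1) : Function.Bijective F := by
  have hL := isCentralLift_of_mk_eq hn φ hF
  constructor
  · rw [injective_iff_map_eq_one]
    intro g hg
    have h : φ (g : B n) = 1 := by rw [← hF, hg]; rfl
    rw [map_eq_one_iff φ φ.injective, QuotientGroup.eq_one_iff] at h
    refine eq_one_of_mem_center (by omega) h ?_
    have h' := deg_hom F g
    rw [hg, deg_one] at h'
    rcases mul_eq_zero.1 h'.symm with h0 | h0
    · simp [h0] at hd
    · exact h0
  · intro g
    obtain ⟨g', j, h⟩ := hL.exists_eq g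
    refine ⟨g' * fullTwist n ^ (deg (F (gen n 0)) * j), ?_⟩
    rw [map_mul, map_zpow, hL.map_fullTwist, ← zpow_mul, ← mul_assoc, ← pow_two, hd, one_mul, h]

theorem surjective_of_deg_congr (hn : 3 ≤ n)
    (hdeg : ∀ F : B n →* B n, IsCentralLift F →
      ∃ k γ : ℤ, γ ^ 2 = 1 ∧ deg (F (gen n 0)) = k * (n * (n - 1)) + γ)
    (Φ : MulAut (B n) →* MulAut (B n ⧸ Subgroup.center (B n)))
    (hΦ : ∀ (f : MulAut (B n)) (x : B n),
      Φ f (QuotientGroup.mk x) = QuotientGroup.mk (f x)) : Function.Surjective Φ := by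
  intro φ
  obtain ⟨F, hF⟩ := exists_lift hn φ
  obtain ⟨k, γ, hγ, hd⟩ := hdeg F (isCentralLift_of_mk_eq hn φ hF)
  have hn2 : 2 ≤ n := by omega
  have hF' : ∀ g : B n, (twist hn2 F (-k) g : B n ⧸ Subgroup.center (B n)) = φ g := by
    intro g
    rw [← hF]
    exact mk_mul_fullTwist_zpow hn2 _ _
  have hd' : deg (twist hn2 F (-k) (gen n 0)) = γ := by
    change deg (F (gen n 0) * fullTwist n ^ (-k * deg (gen n 0))) = γ
    rw [deg_mul, deg_zpow, deg_gen (by omega), deg_fullTwist, hd, Nat.cast_sub (by omega)]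
    push_cast
    ring
  have hb := bijective_of_deg hn φ hF' (by rw [hd', hγ])
  refine ⟨MulEquiv.ofBijective _ hb, MulEquiv.ext fun x => ?_⟩
  obtain ⟨g, rfl⟩ := QuotientGroup.mk_surjective x
  rw [hΦ, ← hF']
  rfl

theorem injective_of_three_le (hn : 3 ≤ n)
    (Φ : MulAut (B n) →* MulAut (B n ⧸ Subgroup.center (B n)))
    (hΦ : ∀ (f : MulAut (B n)) (x : B n),
      Φ f (QuotientGroup.mk x) = QuotientGroup.mk (f x)) : Function.Injective Φ := by
  rw [injective_iff_map_eq_one]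
  intro f hf
  have hmk : ∀ g : B n, (g : B n ⧸ Subgroup.center (B n)) = (f g : B n) := by
    intro g
    rw [← hΦ, hf]
    rfl
  have h0 := deg_hom f.toMonoidHom
  have h1 : deg (f (gen n 0)) = 1 := by
    obtain ⟨k, hk⟩ := exists_eq_mul_of_mk_eq_mk hn (hmk (gen n 0))
    have hd := congrArg deg hk
    rw [deg_mul, deg_zpow, deg_gen (by omega), deg_fullTwist, Nat.cast_sub (by omega),
      Nat.cast_one] at hd
    obtain ⟨y, hy⟩ := f.surjective (gen n 0)
    have hu := h0 y
    change deg (f y) = deg (f (gen n 0)) * deg y at hu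
    rw [hy, deg_gen (by omega)] at hu
    have hN : (6 : ℤ) ≤ n * (n - 1) := by
      have : (3 : ℤ) ≤ n := by exact_mod_cast hn
      nlinarith
    rcases Int.eq_one_or_neg_one_of_mul_eq_one hu.symm with h | h
    · exact h
    · rw [h] at hd
      have hk0 : k = 0 ∨ k ≤ -1 ∨ 1 ≤ k := by omega
      rcases hk0 with rfl | hk0 | hk0
      · simp at hd
      · nlinarith
      · nlinarith
  refine MulEquiv.ext fun g => ?_
  refine (eq_of_mk_eq_mk (by omega) (hmk g) ?_).symm
  have := h0 g
  change deg (f g) = deg (f (gen n 0)) * deg g at this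
  rw [this, h1, one_mul]

/-! ### Cyclically homogeneous permutation representations -/

/-- A permutation `u` of `ℤ/n` whose rotates `x ↦ u (x - k) + k` satisfy the braid relations,
such that `x ↦ u (x + 1)` fixes `0` and acts on the other points with orbits of length `n - 1`. -/
structure IsCyclicRep (u : Equiv.Perm (ZMod n)) : Prop where
  map_one : u 1 = 0
  comm : ∀ k : ℕ, 2 ≤ k → k + 2 ≤ n → ∀ x : ZMod n, u (u (x - k) + k) = u (u x - k) + k
  braid : ∀ x : ZMod n, u (u (u x - 1) + 1) = u (u (u (x - 1) + 1) - 1) + 1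
  iterate_injOn : ∀ a : ZMod n, a ≠ 0 → ∀ i j, i < n - 1 → j < n - 1 →
    (fun x => u (x + 1))^[i] a = (fun x => u (x + 1))^[j] a → i = j

namespace IsCyclicRep

variable {u : Equiv.Perm (ZMod n)}

theorem natCast_ne_zero {k : ℕ} (hk : k ≠ 0) (hkn : k < n) : (k : ZMod n) ≠ 0 := by
  rw [Ne, ZMod.natCast_eq_zero_iff]
  exact Nat.not_dvd_of_pos_of_lt (by omega) hkn

theorem step (hu : IsCyclicRep u) {k : ℕ} (h2 : 2 ≤ k) (hk : k + 2 ≤ n) :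
    u k - k = u (u ((k + 1 : ℕ) : ZMod n) - (k + 1 : ℕ) + 1) := by
  have h := hu.comm k h2 hk ((k + 1 : ℕ) : ZMod n)
  have e1 : ((k + 1 : ℕ) : ZMod n) - k = 1 := by push_cast; ring
  have e2 : u ((k + 1 : ℕ) : ZMod n) - (k + 1 : ℕ) + 1 = u ((k + 1 : ℕ) : ZMod n) - k := by
    push_cast; ring
  rw [e1, hu.map_one, zero_add] at h
  rw [e2, h, add_sub_cancel_right]

theorem sub_eq_iterate (hu : IsCyclicRep u) {i : ℕ} (hi : i + 3 ≤ n) :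
    u ((n - 1 - i : ℕ) : ZMod n) - (n - 1 - i : ℕ) =
      (fun x => u (x + 1))^[i] (u (-1) + 1) := by
  induction i with
  | zero =>
    have : ((n - 1 - 0 : ℕ) : ZMod n) = -1 := by
      rw [Nat.sub_zero, Nat.cast_sub (by omega), ZMod.natCast_self, Nat.cast_one, zero_sub]
    rw [this, Function.iterate_zero, id, sub_neg_eq_add]
  | succ i ih =>
    rw [Function.iterate_succ_apply', ← ih (by omega), hu.step (by omega) (by omega)]
    have : n - 1 - (i + 1) + 1 = n - 1 - i := by omega
    rw [this]

theorem exists_eq_of_ne [NeZero n] {x : ZMod n} (h0 : x ≠ 0) (h1 : x ≠ 1) :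
    ∃ i, i + 3 ≤ n ∧ x = (n - 1 - i : ℕ) := by
  have hx := ZMod.natCast_zmod_val x
  have h0' : x.val ≠ 0 := fun h => h0 (by rw [← hx, h, Nat.cast_zero])
  have h1' : x.val ≠ 1 := fun h => h1 (by rw [← hx, h, Nat.cast_one])
  have hlt := ZMod.val_lt x
  refine ⟨n - 1 - x.val, by omega, ?_⟩
  rw [show n - 1 - (n - 1 - x.val) = x.val by omega, hx]

theorem iterate_zero_eq (hu : IsCyclicRep u) (i : ℕ) : (fun x => u (x + 1))^[i] 0 = 0 := by
  induction i with
  | zero => rfl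
  | succ i ih => rw [Function.iterate_succ_apply', ih, zero_add, hu.map_one]

theorem eq_swap (hu : IsCyclicRep u) [NeZero n] (h : u (-1) = -1) : u = Equiv.swap 0 1 := by
  have hfix : ∀ x, x ≠ 0 → x ≠ 1 → u x = x := by
    intro x h0 h1
    obtain ⟨i, hi, rfl⟩ := exists_eq_of_ne h0 h1
    rw [← sub_eq_zero, hu.sub_eq_iterate hi, h, neg_add_cancel, hu.iterate_zero_eq]
  refine Equiv.ext fun x => ?_
  by_cases h1 : x = 1
  · rw [h1, hu.map_one, Equiv.swap_apply_right]
  by_cases h0 : x = 0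
  · rw [h0, Equiv.swap_apply_left]
    by_contra hne
    obtain ⟨y, hy⟩ := u.surjective 1
    have hy0 : y ≠ 0 := fun e => hne (by rw [← e, hy])
    have hy1 : y ≠ 1 := fun e => by
      rw [e, hu.map_one] at hy
      exact h1 (by rw [h0, hy])
    exact hy1 (by rw [← hfix y hy0 hy1, hy])
  · rw [hfix x h0 h1, Equiv.swap_apply_of_ne_of_ne h0 h1]

theorem iterate_injective : ∀ i, Function.Injective (fun x => u (x + 1))^[i] := fun i =>
  Function.Injective.iterate (fun _ _ h => add_right_cancel (u.injective h)) i

theorem apply_ne (hu : IsCyclicRep u) [NeZero n] (h : u (-1) ≠ -1) (h10 : (1 : ZMod n) ≠ 0)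
    (x : ZMod n) : u x ≠ x := by
  by_cases h1 : x = 1
  · rw [h1, hu.map_one]
    exact h10.symm
  by_cases h0 : x = 0
  · rw [h0]
    intro e
    exact h10 (u.injective (by rw [hu.map_one, e]))
  obtain ⟨i, hi, rfl⟩ := exists_eq_of_ne h0 h1
  rw [Ne, ← sub_eq_zero, hu.sub_eq_iterate hi, ← hu.iterate_zero_eq i,
    (iterate_injective i).eq_iff]
  exact fun e => h (eq_neg_of_add_eq_zero_left e)

theorem sub_injOn (hu : IsCyclicRep u) [NeZero n] (h : u (-1) ≠ -1) {x y : ZMod n}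
    (hx0 : x ≠ 0) (hx1 : x ≠ 1) (hy0 : y ≠ 0) (hy1 : y ≠ 1) (hxy : u x - x = u y - y) :
    x = y := by
  obtain ⟨i, hi, rfl⟩ := exists_eq_of_ne hx0 hx1
  obtain ⟨j, hj, rfl⟩ := exists_eq_of_ne hy0 hy1
  rw [hu.sub_eq_iterate hi, hu.sub_eq_iterate hj] at hxy
  rw [hu.iterate_injOn _ (fun e => h (eq_neg_of_add_eq_zero_left e)) i j (by omega) (by omega) hxy]

/-- The rotate of `u` by `c`. -/
def rot (u : Equiv.Perm (ZMod n)) (c x : ZMod n) : ZMod n := u (x - c) + c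

theorem rot_comm (hu : IsCyclicRep u) {k : ℕ} (h2 : 2 ≤ k) (hk : k + 2 ≤ n) (c x : ZMod n) :
    rot u c (rot u (c + k) x) = rot u (c + k) (rot u c x) := by
  have h := hu.comm k h2 hk (x - c)
  simp only [rot]
  rw [show u (x - (c + k)) + (c + k) - c = u (x - c - k) + k by rw [sub_sub]; ring, h,
    show u (x - c) + c - (c + k) = u (x - c) - k by ring]
  ring

theorem rot_braid (hu : IsCyclicRep u) (c x : ZMod n) :
    rot u c (rot u (c + 1) (rot u c x)) = rot u (c + 1) (rot u c (rot u (c + 1) x)) := by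
  have h := hu.braid (x - c)
  simp only [rot]
  rw [show u (x - c) + c - (c + 1) = u (x - c) - 1 by ring,
    show u (u (x - c) - 1) + (c + 1) - c = u (u (x - c) - 1) + 1 by ring, h,
    show u (x - (c + 1)) + (c + 1) - c = u (x - c - 1) + 1 by rw [sub_sub]; ring,
    show u (u (x - c - 1) + 1) + c - (c + 1) = u (u (x - c - 1) + 1) - 1 by ring]
  ring

theorem rot_injective (c : ZMod n) : Function.Injective (rot u c) := fun x y h => by
  simpa [rot] using h

theorem rot_zero (x : ZMod n) : rot u 0 x = u x := by simp [rot]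

theorem apply_eq_rot_iff {c x : ZMod n} : u x = rot u c x ↔ u x - x = u (x - c) - (x - c) := by
  rw [rot, sub_eq_iff_eq_add, show u (x - c) - (x - c) + x = u (x - c) + c by ring]

theorem rot_ne (hu : ∀ x, u x ≠ x) (c x : ZMod n) : rot u c x ≠ x := by
  intro h
  exact hu (x - c) (by rw [rot] at h; exact eq_sub_of_add_eq h)

theorem comm_apply (hu : IsCyclicRep u) {k : ℕ} (h2 : 2 ≤ k) (hk : k + 2 ≤ n) (x : ZMod n) :
    u (rot u k x) = rot u k (u x) := by
  have := hu.rot_comm h2 hk 0 x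
  rwa [rot_zero, rot_zero, zero_add] at this

/-- If `u` agrees with a far rotate somewhere, then it does so at `1` or at `k + 1`. -/
theorem exists_eq_of_rot_eq (hu : IsCyclicRep u) [NeZero n] (h : u (-1) ≠ -1) {k : ℕ}
    (h2 : 2 ≤ k) (hk : k + 2 ≤ n) {x : ZMod n} (hx : u x = rot u k x) :
    u 1 - 1 = u (1 - k) - (1 - k) ∨ u (k + 1) - (k + 1) = u 1 - 1 := by
  have hk0 : (k : ZMod n) ≠ 0 := natCast_ne_zero (by omega) (by omega)
  have key : u 1 = rot u k 1 ∨ u (k + 1) = rot u k (k + 1) := by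
    have hx' := apply_eq_rot_iff.1 hx
    have hmem : x = 1 ∨ x = 0 ∨ x = k + 1 ∨ x = k := by
      by_contra! hne
      obtain ⟨a, b, c, d⟩ := hne
      have := hu.sub_injOn h b a (sub_ne_zero.2 d) (fun e => c (by rw [← e]; ring)) hx'
      exact hk0 (by simpa using this.symm)
    rcases hmem with rfl | rfl | rfl | rfl
    · exact Or.inl hx
    · left
      have h1 := hu.comm_apply h2 hk 1
      rw [hu.map_one, ← hx] at h1
      rw [hu.map_one]
      exact (u.injective h1).symm
    · exact Or.inr hx
    · right
      have h1 := hu.comm_apply h2 hk (k + 1)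
      have h3 : rot u k ((k : ZMod n) + 1) = k := by
        rw [rot, add_sub_cancel_left, hu.map_one, zero_add]
      rw [h3]
      rw [h3, hx] at h1
      exact (rot_injective _ h1).symm
  rcases key with h1 | h1
  · exact Or.inl (apply_eq_rot_iff.1 h1)
  · right
    rw [apply_eq_rot_iff.1 h1, add_sub_cancel_left]

theorem exists_rot_succ_eq (hu : IsCyclicRep u) {k : ℕ} (h2 : 2 ≤ k) (hk : k + 3 ≤ n) {x : ZMod n}
    (hx : u x = rot u k x) : ∃ y, u y = rot u (k + 1) y := by
  refine ⟨rot u k (rot u (k + 1) x), ?_⟩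
  have h1 := hu.comm_apply h2 (by omega) (rot u (k + 1) x)
  have h3 := hu.comm_apply (k := k + 1) (by omega) (by omega) x
  rw [Nat.cast_add, Nat.cast_one] at h3
  rw [h1, h3, hx, hu.rot_braid]

theorem exists_rot_eq_of_succ (hu : IsCyclicRep u) {k : ℕ} (h2 : 2 ≤ k) (hk : k + 3 ≤ n)
    {x : ZMod n} (hx : u x = rot u (k + 1) x) : ∃ y, u y = rot u k y := by
  refine ⟨rot u (k + 1) (rot u k x), ?_⟩
  have h1 := hu.comm_apply h2 (by omega) x
  have h3 := hu.comm_apply (k := k + 1) (by omega) (by omega) (rot u k x)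
  rw [Nat.cast_add, Nat.cast_one] at h3
  rw [h3, h1, hx, ← hu.rot_braid]

theorem rot_ne_of_six_le (hu : IsCyclicRep u) [NeZero n] (h : u (-1) ≠ -1) (hn : 6 ≤ n) {k : ℕ}
    (h2 : 2 ≤ k) (hk : k + 2 ≤ n) (x : ZMod n) : u x ≠ rot u k x := by
  have n1 : (1 : ZMod n) ≠ 0 := by
    simpa using natCast_ne_zero (n := n) (k := 1) (by omega) (by omega)
  have n2 : (2 : ZMod n) ≠ 0 := natCast_ne_zero (n := n) (k := 2) (by omega) (by omega)
  have n3 : (3 : ZMod n) ≠ 0 := natCast_ne_zero (n := n) (k := 3) (by omega) (by omega)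
  have n4 : (4 : ZMod n) ≠ 0 := natCast_ne_zero (n := n) (k := 4) (by omega) (by omega)
  have n5 : (5 : ZMod n) ≠ 0 := natCast_ne_zero (n := n) (k := 5) (by omega) (by omega)
  induction k, h2 using Nat.le_induction generalizing x with
  | base =>
    intro hx
    obtain ⟨y, hy⟩ := hu.exists_rot_succ_eq le_rfl (by omega) hx
    have hy' : u y = rot u (3 : ℕ) y := by rw [hy]; norm_num
    have e1 := hu.exists_eq_of_rot_eq h le_rfl (by omega) hx
    have e2 := hu.exists_eq_of_rot_eq h (by norm_num) (by omega) hy'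
    have i1 : ∀ a b : ZMod n, a = 1 - 2 ∨ a = 2 + 1 → b = 1 - 3 ∨ b = 3 + 1 →
        u 1 - 1 = u a - a → u 1 - 1 = u b - b → False := by
      intro a b ha hb h1 h3
      have : a = b := by
        refine hu.sub_injOn h ?_ ?_ ?_ ?_ (h1.symm.trans h3)
        · rcases ha with rfl | rfl
          · exact fun e => n1 (by linear_combination -e)
          · exact fun e => n3 (by linear_combination e)
        · rcases ha with rfl | rfl
          · exact fun e => n2 (by linear_combination -e)
          · exact fun e => n2 (by linear_combination e)
        · rcases hb with rfl | rfl
          · exact fun e => n2 (by linear_combination -e)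
          · exact fun e => n4 (by linear_combination e)
        · rcases hb with rfl | rfl
          · exact fun e => n3 (by linear_combination -e)
          · exact fun e => n3 (by linear_combination e)
      rcases ha with rfl | rfl <;> rcases hb with rfl | rfl
      · exact n1 (by linear_combination this)
      · exact n5 (by linear_combination -this)
      · exact n5 (by linear_combination this)
      · exact n1 (by linear_combination -this)
    push_cast at e1 e2
    rcases e1 with e1 | e1 <;> rcases e2 with e2 | e2
    · exact i1 _ _ (Or.inl rfl) (Or.inl rfl) e1 e2
    · exact i1 _ _ (Or.inl rfl) (Or.inr rfl) e1 e2.symm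
    · exact i1 _ _ (Or.inr rfl) (Or.inl rfl) e1.symm e2
    · exact i1 _ _ (Or.inr rfl) (Or.inr rfl) e1.symm e2.symm
  | succ k h2 ih =>
    intro hx
    rw [Nat.cast_add, Nat.cast_one] at hx
    obtain ⟨y, hy⟩ := hu.exists_rot_eq_of_succ h2 (by omega) hx
    exact ih (by omega) y hy

theorem rot_one_ne_of_six_le (hu : IsCyclicRep u) [NeZero n] (h : u (-1) ≠ -1) (hn : 6 ≤ n)
    (x : ZMod n) : u x ≠ rot u 1 x := by
  have n1 : (1 : ZMod n) ≠ 0 := by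
    simpa using natCast_ne_zero (n := n) (k := 1) (by omega) (by omega)
  have n2 : (2 : ZMod n) ≠ 0 := natCast_ne_zero (n := n) (k := 2) (by omega) (by omega)
  have n3 : (3 : ZMod n) ≠ 0 := natCast_ne_zero (n := n) (k := 3) (by omega) (by omega)
  have n4 : (4 : ZMod n) ≠ 0 := natCast_ne_zero (n := n) (k := 4) (by omega) (by omega)
  have n5 : (5 : ZMod n) ≠ 0 := natCast_ne_zero (n := n) (k := 5) (by omega) (by omega)
  have hfp := hu.apply_ne h n1
  have hmem : ∀ x, u x = rot u 1 x → x = 0 ∨ x = 1 ∨ x = 2 := by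
    intro x hx
    by_contra! hne
    obtain ⟨a, b, c⟩ := hne
    have := hu.sub_injOn h a b (sub_ne_zero.2 b) (fun e => c (by linear_combination e))
      (apply_eq_rot_iff.1 hx)
    exact n1 (by simpa using this.symm)
  have s3 : ∀ x, u x = rot u 1 x → u (rot u 3 x) = rot u 1 (rot u 3 x) := by
    intro x hx
    have c0 := hu.comm_apply (k := 3) (by omega) (by omega) x
    have c1 := hu.rot_comm (k := 2) (by omega) (by omega) 1 x
    push_cast at c0 c1
    rw [show (1 : ZMod n) + 2 = 3 by norm_num] at c1
    rw [c0, c1, hx]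
  have s4 : ∀ x, u x = rot u 1 x → u (rot u 4 x) = rot u 1 (rot u 4 x) := by
    intro x hx
    have c0 := hu.comm_apply (k := 4) (by omega) (by omega) x
    have c1 := hu.rot_comm (k := 3) (by omega) (by omega) 1 x
    push_cast at c0 c1
    rw [show (1 : ZMod n) + 3 = 4 by norm_num] at c1
    rw [c0, c1, hx]
  have hnot : ¬ (u 0 = rot u 1 0 ∧ u 1 = rot u 1 1 ∧ u 2 = rot u 1 2) := by
    rintro ⟨a, b, c⟩
    rw [apply_eq_rot_iff] at a b c
    rw [sub_self] at b
    rw [show (2 : ZMod n) - 1 = 1 by norm_num] at c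
    rw [zero_sub] at a
    have := hu.sub_injOn h n2 (fun e => n1 (by linear_combination e)) (neg_ne_zero.2 n1)
      (fun e => n2 (by linear_combination -e)) (c.trans (b.trans a))
    exact n3 (by linear_combination this)
  intro hx
  have f3 := rot_ne hfp 3
  have f4 := rot_ne hfp 4
  have val : ∀ c a b : ZMod n, rot u c a = b → u (a - c) = b - c := fun c a b e => by
    rw [← e, rot, add_sub_cancel_right]
  by_cases m0 : u 0 = rot u 1 0 <;> by_cases m1 : u 1 = rot u 1 1 <;>
    by_cases m2 : u 2 = rot u 1 2
  · exact hnot ⟨m0, m1, m2⟩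
  · have a : rot u 3 1 = 0 := by
      rcases hmem _ (s3 1 m1) with e | e | e
      · exact e
      · exact absurd e (f3 1)
      · exact absurd (e ▸ s3 1 m1) m2
    have b : rot u 4 0 = 1 := by
      rcases hmem _ (s4 0 m0) with e | e | e
      · exact absurd e (f4 0)
      · exact e
      · exact absurd (e ▸ s4 0 m0) m2
    have := u.injective (((val _ _ _ a).trans (by norm_num)).trans (val _ _ _ b).symm)
    exact n2 (by linear_combination this)
  · have a : rot u 3 0 = 2 := by
      rcases hmem _ (s3 0 m0) with e | e | e
      · exact absurd e (f3 0)
      · exact absurd (e ▸ s3 0 m0) m1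
      · exact e
    have b : rot u 4 0 = 2 := by
      rcases hmem _ (s4 0 m0) with e | e | e
      · exact absurd e (f4 0)
      · exact absurd (e ▸ s4 0 m0) m1
      · exact e
    have := hu.sub_injOn h (x := 0 - 3) (y := 0 - 4) (fun e => n3 (by linear_combination -e))
      (fun e => n4 (by linear_combination -e)) (fun e => n4 (by linear_combination -e))
      (fun e => n5 (by linear_combination -e)) (by rw [val _ _ _ a, val _ _ _ b]; ring)
    exact n1 (by linear_combination this)
  · rcases hmem _ (s3 0 m0) with e | e | e
    · exact f3 0 e
    · exact m1 (e ▸ s3 0 m0)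
    · exact m2 (e ▸ s3 0 m0)
  · have a : rot u 3 2 = 1 := by
      rcases hmem _ (s3 2 m2) with e | e | e
      · exact absurd (e ▸ s3 2 m2) m0
      · exact e
      · exact absurd e (f3 2)
    have b : rot u 4 1 = 2 := by
      rcases hmem _ (s4 1 m1) with e | e | e
      · exact absurd (e ▸ s4 1 m1) m0
      · exact absurd e (f4 1)
      · exact e
    have := u.injective (((val _ _ _ a).trans (by norm_num)).trans (val _ _ _ b).symm)
    exact n2 (by linear_combination this)
  · rcases hmem _ (s3 1 m1) with e | e | e
    · exact m0 (e ▸ s3 1 m1)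
    · exact f3 1 e
    · exact m2 (e ▸ s3 1 m1)
  · rcases hmem _ (s3 2 m2) with e | e | e
    · exact m0 (e ▸ s3 2 m2)
    · exact m1 (e ▸ s3 2 m2)
    · exact f3 2 e
  · rcases hmem _ hx with rfl | rfl | rfl
    · exact m0 hx
    · exact m1 hx
    · exact m2 hx

theorem apply_neg_one_of_six_le (hu : IsCyclicRep u) [NeZero n] (hn : 6 ≤ n) : u (-1) = -1 := by
  by_contra h
  have n1 : (1 : ZMod n) ≠ 0 := by
    simpa using natCast_ne_zero (n := n) (k := 1) (by omega) (by omega)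
  have hinj : Function.Injective fun x => u x - x := by
    intro x y hxy
    by_contra hne
    have hc := ZMod.natCast_zmod_val (x - y)
    set k := (x - y).val with hk
    have hkn : k < n := ZMod.val_lt _
    have hk0 : k ≠ 0 := fun e => hne (by rw [e, Nat.cast_zero] at hc; exact (sub_eq_zero.1 hc.symm))
    have hy : y = x - k := by rw [hc]; ring
    have hxk : u x = rot u k x := apply_eq_rot_iff.2 (by rw [← hy]; exact hxy)
    rcases Nat.lt_or_ge k 2 with h2 | h2
    · have : k = 1 := by omega
      rw [this, Nat.cast_one] at hxk
      exact hu.rot_one_ne_of_six_le h hn x hxk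
    rcases Nat.lt_or_ge n (k + 2) with h3 | h3
    · have h4 : ((k + 1 : ℕ) : ZMod n) = 0 := by
        rw [show k + 1 = n by omega, ZMod.natCast_self]
      push_cast at h4
      refine hu.rot_one_ne_of_six_le h hn y (apply_eq_rot_iff.2 ?_)
      rw [show y - 1 = x by rw [hy]; linear_combination -h4]
      exact hxy.symm
    · exact hu.rot_ne_of_six_le h hn h2 h3 x hxk
  obtain ⟨x, hx⟩ := Finite.surjective_of_injective hinj 0
  exact hu.apply_ne h n1 x (sub_eq_zero.1 hx)

theorem fin_five (w : Fin 5 → Fin 5) (hw : Function.Injective w) (h1 : w 1 = 0) (h4 : w 4 ≠ 4)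
    (hc : ∀ x, w (w (x - 2) + 2) = w (w x - 2) + 2) : w 2 - 2 = w 3 - 3 := by
  have key : ∀ a b c d : Fin 5, Function.Injective ![a, 0, b, c, d] → d ≠ 4 →
      (∀ x : Fin 5, ![a, 0, b, c, d] (![a, 0, b, c, d] (x - 2) + 2) =
        ![a, 0, b, c, d] (![a, 0, b, c, d] x - 2) + 2) → b - 2 = c - 3 := by
    decide +kernel
  have hv : w = ![w 0, 0, w 2, w 3, w 4] := by
    funext x
    fin_cases x <;> first | rfl | exact h1
  exact key _ _ _ _ (hv ▸ hw) h4 (hv ▸ hc)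

theorem apply_neg_one_of_five {u : Equiv.Perm (ZMod 5)} (hu : IsCyclicRep u) : u (-1) = -1 := by
  by_contra h
  have h5 := fin_five u u.injective hu.map_one h (hu.comm 2 le_rfl (by norm_num))
  have : (2 : ZMod 5) = 3 := hu.sub_injOn h (x := 2) (y := 3) (by decide) (by decide) (by decide)
    (by decide) h5
  exact absurd this (by decide)

theorem fin_four (w : Fin 4 → Fin 4) (hw : Function.Injective w) (h1 : w 1 = 0) (h3 : w 3 ≠ 3)
    (hc : ∀ x, w (w (x - 2) + 2) = w (w x - 2) + 2)
    (hb : w (w (w 0 - 1) + 1) = w (w (w (0 - 1) + 1) - 1) + 1)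
    (h5 : w 2 - 2 ≠ w 3 - 3) : w 0 = 2 ∧ w 2 = 3 ∧ w 3 = 1 := by
  have key : ∀ a b c : Fin 4, Function.Injective ![a, 0, b, c] ∧ c ≠ 3 ∧
      (∀ x : Fin 4, ![a, 0, b, c] (![a, 0, b, c] (x - 2) + 2) =
        ![a, 0, b, c] (![a, 0, b, c] x - 2) + 2) ∧
      (![a, 0, b, c] (![a, 0, b, c] (![a, 0, b, c] 0 - 1) + 1) =
        ![a, 0, b, c] (![a, 0, b, c] (![a, 0, b, c] (0 - 1) + 1) - 1) + 1) ∧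
      b - 2 ≠ c - 3 → a = 2 ∧ b = 3 ∧ c = 1 := by
    decide +kernel
  have hv : w = ![w 0, 0, w 2, w 3] := by
    funext x
    fin_cases x <;> first | rfl | exact h1
  exact key _ _ _ ⟨hv ▸ hw, h3, hv ▸ hc, hv ▸ hb, h5⟩

theorem apply_of_four {u : Equiv.Perm (ZMod 4)} (hu : IsCyclicRep u) :
    u (-1) = -1 ∨ (u 0 = 2 ∧ u 2 = 3 ∧ u 3 = 1) := by
  by_cases h : u (-1) = -1
  · exact Or.inl h
  refine Or.inr (fin_four u u.injective hu.map_one h (hu.comm 2 le_rfl (by norm_num)) (hu.braid 0)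
    fun h5 => ?_)
  have : (2 : ZMod 4) = 3 := hu.sub_injOn h (x := 2) (y := 3) (by decide) (by decide) (by decide)
    (by decide) h5
  exact absurd this (by decide)

end IsCyclicRep

/-! ### The permutation action of an endomorphism compatible with the center -/

theorem deg_fullTwist_zpow (hn : 1 ≤ n) (d : ℤ) : deg (fullTwist n ^ d) = d * (n * (n - 1)) := by
  rw [deg_zpow, deg_fullTwist, Nat.cast_sub hn, Nat.cast_one]

theorem cross_fullTwist_zpow (hn : 3 ≤ n) {i j : Fin n} (hij : i ≠ j) (d : ℤ) :
    cross (fullTwist n ^ d) i j = 2 * d := by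
  obtain ⟨m, hm, hd⟩ := cross_of_mem_center hn (fullTwist_zpow_mem_center (by omega) d)
  rw [deg_fullTwist_zpow (by omega)] at hd
  have h3 : (3 : ℤ) ≤ n := by exact_mod_cast hn
  rw [hm i j hij, mul_right_cancel₀ (by nlinarith) hd]

theorem perm_fullTwist_zpow (hn : 3 ≤ n) (d : ℤ) : perm n (fullTwist n ^ d) = 1 :=
  perm_eq_one_of_mem_center hn (fullTwist_zpow_mem_center (by omega) d)

theorem iterate_injOn_of_pow_eq (hn : 3 ≤ n) {d : ℤ} (hd : IsCoprime d (n * (n - 1)))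
    {g : B n} {M : ℕ} (hMn : (M : ℤ) ∣ n * (n - 1)) (hg : g ^ M = fullTwist n ^ d)
    {i : Fin n} (hi : perm n g i ≠ i) :
    Set.InjOn (fun k => (perm n g)^[k] i) (Set.Iio M) := by
  have hper : ∀ x, Function.IsPeriodicPt (perm n g) M x := fun x => by
    rw [Function.IsPeriodicPt, Function.IsFixedPt, Equiv.Perm.iterate_eq_pow, ← map_pow, hg,
      perm_fullTwist_zpow hn, Equiv.Perm.one_apply]
  obtain ⟨t, ht⟩ := (hper i).minimalPeriod_dvd
  set s := Function.minimalPeriod (perm n g) i with hs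
  have hsi : perm n (g ^ s) i = i := by
    rw [map_pow, ← Equiv.Perm.iterate_eq_pow]
    exact Function.isPeriodicPt_minimalPeriod _ _
  have hsj : perm n (g ^ s) (perm n g i) = perm n g i := by
    rw [← Equiv.Perm.mul_apply, ← map_mul, ← pow_succ, pow_succ', map_mul, Equiv.Perm.mul_apply,
      hsi]
  have hc := cross_pow (g ^ s) hsi hsj t
  rw [← pow_mul, ← ht, hg, cross_fullTwist_zpow hn hi.symm] at hc
  obtain ⟨e, he⟩ := even_cross_of_fixed (g ^ s) hi.symm hsi hsj
  rw [he] at hc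
  have htd : (t : ℤ) ∣ d := ⟨e, by linarith⟩
  have htN : (t : ℤ) ∣ n * (n - 1) :=
    (Int.natCast_dvd_natCast.2 ⟨s, by rw [ht, mul_comm]⟩).trans hMn
  have ht1 : t = 1 := by
    have := Int.isUnit_iff.1 (hd.isUnit_of_dvd' htd htN)
    omega
  rw [ht1, mul_one] at ht
  rw [ht, hs]
  exact Function.iterate_injOn_Iio_minimalPeriod

theorem not_forall_mem_zpowers (hn : 3 ≤ n) {f : B n →* Equiv.Perm (Fin n)}
    (hf : Function.Surjective f) (a : Equiv.Perm (Fin n)) :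
    ¬ ∀ k < n - 1, f (gen n k) ∈ Subgroup.zpowers a := by
  intro h
  have hall : ∀ g, f g ∈ Subgroup.zpowers a := by
    intro g
    induction g using induction with
    | one => simp [one_mem]
    | gen_mul i hi g => rw [map_mul]; exact Subgroup.mul_mem_cancel_left _ (h i hi)
  obtain ⟨x, hx⟩ := hf (Equiv.swap ⟨0, by omega⟩ ⟨1, by omega⟩)
  obtain ⟨y, hy⟩ := hf (Equiv.swap ⟨1, by omega⟩ ⟨2, by omega⟩)
  obtain ⟨p, hp⟩ := Subgroup.mem_zpowers_iff.1 (hall x)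
  obtain ⟨q, hq⟩ := Subgroup.mem_zpowers_iff.1 (hall y)
  have hc : f x * f y = f y * f x := by rw [← hp, ← hq, ← zpow_add, ← zpow_add, add_comm]
  rw [hx, hy] at hc
  have := DFunLike.congr_fun hc ⟨0, by omega⟩
  simp [Equiv.swap_apply_def] at this

namespace IsCentralLift

variable {F : B n →* B n}

theorem isCoprime_deg (hF : IsCentralLift F) (hn : 2 ≤ n) :
    IsCoprime (deg (F (gen n 0))) (n * (n - 1)) := by
  obtain ⟨g, j, h⟩ := hF.exists_eq (gen n 0)
  have := congrArg deg h
  rw [deg_mul, deg_fullTwist_zpow (by omega), deg_hom, deg_gen (by omega)] at this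
  exact ⟨deg g, j, by linarith⟩

theorem perm_comp_surjective (hF : IsCentralLift F) (hn : 3 ≤ n) :
    Function.Surjective ((perm n).comp F) := by
  intro s
  obtain ⟨g, rfl⟩ := perm_surjective s
  obtain ⟨g', j, rfl⟩ := hF.exists_eq g
  exact ⟨g', by rw [map_mul, perm_fullTwist_zpow hn, mul_one]; rfl⟩

theorem perm_map_δ_ne (hF : IsCentralLift F) (hn : 3 ≤ n) (x : Fin n) :
    perm n (F (δ n)) x ≠ x ∧
      Function.Bijective fun k : Fin n => (perm n (F (δ n)))^[k] x := by
  have hinj : ∀ i, perm n (F (δ n)) i ≠ i →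
      Function.Injective fun k : Fin n => (perm n (F (δ n)))^[k] i := by
    intro i hi a b hab
    refine Fin.ext (iterate_injOn_of_pow_eq hn (hF.isCoprime_deg (by omega)) (M := n)
      (Dvd.intro _ rfl) ?_ hi a.2 b.2 hab)
    rw [← map_pow]
    exact hF.map_fullTwist
  suffices h : ∀ x, perm n (F (δ n)) x ≠ x from
    ⟨h x, Finite.injective_iff_bijective.1 (hinj x (h x))⟩
  have hex : ∃ i, perm n (F (δ n)) i ≠ i := by
    by_contra! h
    refine not_forall_mem_zpowers hn (hF.perm_comp_surjective hn) (perm n (F (gen n 0)))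
      fun k hk => ?_
    have h1 : perm n (F (δ n)) = 1 := Equiv.ext h
    rw [gen_eq_conj hk]
    simp [h1]
  obtain ⟨i, hi⟩ := hex
  intro x hx
  obtain ⟨k, rfl⟩ := (Finite.injective_iff_bijective.1 (hinj i hi)).2 x
  simp only [← Function.iterate_succ_apply' (perm n (F (δ n)))] at hx
  rw [Function.iterate_succ_apply] at hx
  exact hi (((perm n (F (δ n))).injective.iterate k) hx)

theorem perm_map_gen_mul_δ (hF : IsCentralLift F) (hn : 3 ≤ n) :
    ∃ x, perm n (F (gen n 0 * δ n)) x = x ∧ ∀ a ≠ x,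
      Set.InjOn (fun k => (perm n (F (gen n 0 * δ n)))^[k] a) (Set.Iio (n - 1)) := by
  set E := perm n (F (gen n 0 * δ n)) with hE
  have hpow : F (gen n 0 * δ n) ^ (n - 1) = fullTwist n ^ deg (F (gen n 0)) := by
    rw [← map_pow, gen_mul_δ_pow_eq (by omega), hF.map_fullTwist]
  have hinj : ∀ i, E i ≠ i → Set.InjOn (fun k => E^[k] i) (Set.Iio (n - 1)) := by
    intro i hi
    refine iterate_injOn_of_pow_eq hn (hF.isCoprime_deg (by omega)) (M := n - 1)
      ⟨n, ?_⟩ hpow hi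
    rw [Nat.cast_sub (by omega), mul_comm, Nat.cast_one]
  have hex : ∃ i, E i ≠ i := by
    by_contra! h
    refine not_forall_mem_zpowers hn (hF.perm_comp_surjective hn) (perm n (F (gen n 0)))
      fun k hk => ?_
    have h1 : E = 1 := Equiv.ext h
    rw [hE, map_mul, map_mul, mul_eq_one_iff_inv_eq] at h1
    rw [gen_eq_conj hk, MonoidHom.comp_apply]
    simp only [map_mul, map_pow, map_inv, ← h1]
    refine mul_mem (mul_mem (pow_mem (inv_mem ?_) _) ?_) (inv_mem (pow_mem (inv_mem ?_) _)) <;>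
      exact Subgroup.mem_zpowers _
  obtain ⟨i, hi⟩ := hex
  have hEn : ∀ x, E^[n - 1] x = x := by
    intro x
    rw [Equiv.Perm.iterate_eq_pow, hE, ← map_pow, hpow, perm_fullTwist_zpow hn,
      Equiv.Perm.one_apply]
  set O : Finset (Fin n) := (Finset.range (n - 1)).image fun k => E^[k] i with hO
  have hcard : O.card = n - 1 := by
    rw [hO, Finset.card_image_of_injOn, Finset.card_range]
    intro a ha b hb
    exact hinj i hi (by simpa using ha) (by simpa using hb)
  obtain ⟨x, hx⟩ : ∃ x, x ∉ O := by
    by_contra! h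
    have := (Finset.eq_univ_iff_forall.2 h) ▸ hcard
    rw [Finset.card_univ, Fintype.card_fin] at this
    omega
  have huniq : ∀ y, y ∉ O → y = x := by
    intro y hy
    by_contra hne
    have h1 : (insert y (insert x O)).card = n + 1 := by
      rw [Finset.card_insert_of_notMem (by simp [hne, hy]), Finset.card_insert_of_notMem hx, hcard]
      omega
    have := Finset.card_le_univ (insert y (insert x O))
    rw [h1, Fintype.card_fin] at this
    omega
  refine ⟨x, huniq _ fun h => hx ?_, fun a ha => hinj a fun h => hi ?_⟩
  · obtain ⟨k, hk, he⟩ := Finset.mem_image.1 h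
    rw [Finset.mem_range] at hk
    rcases k with _ | k
    · refine Finset.mem_image.2 ⟨n - 2, Finset.mem_range.2 (by omega), E.injective ?_⟩
      rw [← he, ← Function.iterate_succ_apply' E, show (n - 2).succ = n - 1 by omega, hEn]
      rfl
    · refine Finset.mem_image.2 ⟨k, Finset.mem_range.2 (by omega), E.injective ?_⟩
      rw [← he, Function.iterate_succ_apply']
  · have : a ∈ O := by
      by_contra hO'
      exact ha (huniq a hO')
    obtain ⟨k, -, rfl⟩ := Finset.mem_image.1 this
    rw [← Function.iterate_succ_apply' E, Function.iterate_succ_apply] at h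
    exact E.injective.iterate k h

/-- The permutations induced by an endomorphism compatible with the center, up to renaming. -/
theorem exists_isCyclicRep (hF : IsCentralLift F) (hn : 4 ≤ n) :
    ∃ (e : ZMod n ≃ Fin n) (u : Equiv.Perm (ZMod n)), IsCyclicRep u ∧
      ∀ k < n - 1, ∀ x, perm n (F (gen n k)) (e x) = e (u (x - k) + k) := by
  have : NeZero n := ⟨by omega⟩
  obtain ⟨x₀, hx₀, hinj⟩ := hF.perm_map_gen_mul_δ (by omega)
  set D := perm n (F (δ n)) with hD
  set f := perm n (F (gen n 0)) with hf
  have hE : perm n (F (gen n 0 * δ n)) = f * D := by rw [map_mul, map_mul]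
  rw [hE] at hx₀ hinj
  have hDn : ∀ x, D^[n] x = x := by
    intro x
    rw [Equiv.Perm.iterate_eq_pow, hD, ← map_pow, ← map_pow]
    change perm n (F (fullTwist n)) x = x
    rw [hF.map_fullTwist, perm_fullTwist_zpow (by omega), Equiv.Perm.one_apply]
  have hbij : Function.Bijective fun x : ZMod n => D^[x.val] x₀ := by
    have hb := (hF.perm_map_δ_ne (by omega) x₀).2
    have hval : Function.Bijective fun x : ZMod n => (⟨x.val, ZMod.val_lt x⟩ : Fin n) :=
      (Fintype.bijective_iff_injective_and_card _).2
        ⟨fun a b h => ZMod.val_injective n (Fin.ext_iff.1 h), by rw [ZMod.card, Fintype.card_fin]⟩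
    exact hb.comp hval
  set e : ZMod n ≃ Fin n := Equiv.ofBijective _ hbij with he
  have he_apply : ∀ x, e x = D^[x.val] x₀ := fun _ => rfl
  have hadd : ∀ x, e (x + 1) = D (e x) := by
    intro x
    rw [he_apply, he_apply, ← Function.iterate_succ_apply' D]
    rcases Nat.lt_or_ge (x.val + 1) n with h | h
    · rw [ZMod.val_add_of_lt, ZMod.val_one_eq_one_mod, Nat.mod_eq_of_lt (by omega)]
      rwa [ZMod.val_one_eq_one_mod, Nat.mod_eq_of_lt (by omega)]
    · have hlt := ZMod.val_lt x
      have hz : x + 1 = 0 := by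
        rw [← ZMod.natCast_zmod_val x, ← Nat.cast_succ, show x.val.succ = n by omega,
          ZMod.natCast_self]
      rw [hz, ZMod.val_zero, show x.val.succ = n by omega, hDn]
      rfl
  have haddk : ∀ (k : ℕ) x, e (x + k) = (D ^ k) (e x) := by
    intro k
    induction k with
    | zero => simp
    | succ k ih =>
      intro x
      rw [Nat.cast_succ, ← add_assoc, hadd, ih, pow_succ', Equiv.Perm.mul_apply]
  set u : Equiv.Perm (ZMod n) := (e.trans f).trans e.symm with hu
  have hu_apply : ∀ x, e (u x) = f (e x) := by simp [hu]
  have hgen : ∀ k < n - 1, ∀ x, perm n (F (gen n k)) (e x) = e (u (x - k) + k) := by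
    intro k hk x
    rw [haddk, hu_apply, gen_eq_conj hk]
    simp only [map_mul, map_inv, map_pow, Equiv.Perm.mul_apply, ← hD, ← hf]
    congr 2
    rw [Equiv.Perm.inv_eq_iff_eq, ← haddk, sub_add_cancel]
  have hf0 : ∀ x, perm n (F (gen n 0)) (e x) = e (u x) := fun x => (hu_apply x).symm
  have he0 : e 0 = x₀ := by rw [he_apply, ZMod.val_zero]; rfl
  have hit : ∀ i a, e ((fun x => u (x + 1))^[i] a) = (f * D)^[i] (e a) := by
    intro i
    induction i with
    | zero => exact fun _ => rfl
    | succ i ih =>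
      intro a
      rw [Function.iterate_succ_apply, Function.iterate_succ_apply, ih, hu_apply, hadd]
      rfl
  refine ⟨e, u, ⟨?_, ?_, ?_, ?_⟩, hgen⟩
  · apply e.injective
    rw [hu_apply, he0]
    have := hadd 0
    rw [zero_add, he0] at this
    rw [this]
    exact hx₀
  · intro k h2 hk x
    apply e.injective
    have hc : perm n (F (gen n 0 * gen n k)) (e x) = perm n (F (gen n k * gen n 0)) (e x) := by
      rw [gen_comm (by omega)]
    simpa only [map_mul, Equiv.Perm.mul_apply, hgen k (by omega), hf0] using hc
  · intro x
    apply e.injective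
    have h1 := hgen 1 (by omega)
    rw [Nat.cast_one] at h1
    have hc := congrArg (fun g => perm n (F g) (e x)) (gen_braid (n := n) (i := 0) (by omega))
    simp only [map_mul, Equiv.Perm.mul_apply, zero_add, h1, hf0] at hc
    exact hc
  · intro a ha i j hi hj hij
    refine hinj (e a) (fun h => ha (e.injective (h.trans he0.symm))) hi hj ?_
    change (f * D)^[i] (e a) = (f * D)^[j] (e a)
    rw [← hit, ← hit, hij]

end IsCentralLift

theorem weight_comm (k i j : ℕ) : weight k i j = weight k j i := by
  unfold weight
  congr 1
  exact propext ⟨fun h => by omega, fun h => by omega⟩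

theorem cross_comm (g : B n) (i j : Fin n) : cross g i j = cross g j i := by
  induction g using induction with
  | one => simp
  | gen_mul k hk g =>
    rw [cross_mul, cross_mul _ g j, cross_gen hk, cross_gen hk, weight_comm, add_left_inj]

namespace IsCentralLift

theorem not_exotic {F : B 4 →* B 4} (hF : IsCentralLift F) (e : ZMod 4 ≃ Fin 4)
    {u : Equiv.Perm (ZMod 4)}
    (he : ∀ k < 3, ∀ x, perm 4 (F (gen 4 k)) (e x) = e (u (x - k) + k)) :
    ¬ (u 0 = 2 ∧ u 1 = 0 ∧ u 2 = 3 ∧ u 3 = 1) := by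
  rintro ⟨u0, u1, u2, u3⟩
  have h0 : ∀ x, perm 4 (F (gen 4 0)) (e x) = e (u x) := by
    intro x
    have := he 0 (by norm_num) x
    rwa [Nat.cast_zero, sub_zero, add_zero] at this
  set c := F (gen 4 0 * gen 4 2) with hc
  have hp : perm 4 c = 1 := by
    refine Equiv.ext fun y => ?_
    obtain ⟨x, rfl⟩ := e.surjective y
    rw [hc, map_mul, map_mul, Equiv.Perm.mul_apply, he 2 (by norm_num), h0, Equiv.Perm.one_apply]
    congr 1
    fin_cases x
    · change u (u 2 + 2) = 0
      rw [u2]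
      exact u1
    · change u (u 3 + 2) = 1
      rw [u3]
      exact u3
    · change u (u 0 + 2) = 2
      rw [u0]
      exact u0
    · change u (u 1 + 2) = 3
      rw [u1]
      exact u2
  have hcomm : Commute (F (gen 4 0)) c := by
    change _ * _ = _ * _
    rw [hc, ← map_mul, ← map_mul, mul_assoc, gen_comm (i := 0) (j := 2) le_rfl]
  have hinv : ∀ x y, cross c (e (u x)) (e (u y)) = cross c (e x) (e y) := by
    intro x y
    rw [← h0, ← h0, cross_of_commute hp hcomm]
  have hsum := sum_cross c
  rw [← e.sum_comp] at hsum
  have hsum' : ∀ i, ∑ j, cross c i j = ∑ y, cross c i (e y) := fun i => (e.sum_comp _).symm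
  simp only [hsum'] at hsum
  change ∑ x : Fin 4, ∑ y : Fin 4, cross c (e x) (e y) = _ at hsum
  simp only [Fin.sum_univ_four] at hsum
  change cross c (e 0) (e 0) + cross c (e 0) (e 1) + cross c (e 0) (e 2) + cross c (e 0) (e 3) +
    (cross c (e 1) (e 0) + cross c (e 1) (e 1) + cross c (e 1) (e 2) + cross c (e 1) (e 3)) +
    (cross c (e 2) (e 0) + cross c (e 2) (e 1) + cross c (e 2) (e 2) + cross c (e 2) (e 3)) +
    (cross c (e 3) (e 0) + cross c (e 3) (e 1) + cross c (e 3) (e 2) + cross c (e 3) (e 3)) = _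
    at hsum
  have i02 := hinv 0 2
  have i23 := hinv 2 3
  have i31 := hinv 3 1
  have i03 := hinv 0 3
  rw [u0, u2] at i02
  rw [u2, u3] at i23
  rw [u3, u1] at i31
  rw [u0, u3] at i03
  have hd : deg c = deg (F (gen 4 0)) * 2 := by
    rw [hc, deg_hom, deg_mul, deg_gen (by norm_num), deg_gen (by norm_num)]
    rfl
  obtain ⟨b, hb⟩ := even_cross_of_fixed c (i := e 0) (j := e 3)
    (e.injective.ne (by decide)) (by rw [hp]; rfl) (by rw [hp]; rfl)
  rw [cross_self, cross_self, cross_self, cross_self, hd, cross_comm c (e 1) (e 0),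
    cross_comm c (e 2) (e 0), cross_comm c (e 3) (e 0), cross_comm c (e 2) (e 1),
    cross_comm c (e 3) (e 2)] at hsum
  rw [cross_comm c (e 2) (e 1)] at i03
  rw [cross_comm c (e 1) (e 0)] at i31
  have heven : (2 : ℤ) ∣ deg (F (gen 4 0)) := by
    have h13 := cross_comm c (e 1) (e 3)
    exact ⟨cross c (e 0) (e 2) + b, by linarith⟩
  have hcop := hF.isCoprime_deg (by norm_num)
  have := hcop.isUnit_of_dvd' heven ⟨6, by norm_num⟩
  rw [Int.isUnit_iff] at this
  omega

theorem exists_perm_conj {F : B n →* B n} (hF : IsCentralLift F) (hn : 4 ≤ n) :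
    ∃ τ : Equiv.Perm (Fin n), ∀ k < n - 1, perm n (F (gen n k)) = τ * adjSwap n k * τ⁻¹ := by
  have : NeZero n := ⟨by omega⟩
  obtain ⟨e, u, hu, he⟩ := hF.exists_isCyclicRep hn
  have hu' : u (-1) = -1 := by
    rcases Nat.lt_or_ge n 6 with h6 | h6
    · obtain rfl | rfl : n = 4 ∨ n = 5 := by omega
      · rcases hu.apply_of_four with h | ⟨u0, u2, u3⟩
        · exact h
        · exact absurd ⟨u0, hu.map_one, u2, u3⟩ (hF.not_exotic e he)
      · exact hu.apply_neg_one_of_five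
    · exact hu.apply_neg_one_of_six_le h6
  have hswap := hu.eq_swap hu'
  have hbij : Function.Bijective fun i : Fin n => e (i : ℕ) := by
    refine Finite.injective_iff_bijective.1 fun i j hij => Fin.ext ?_
    have := congrArg ZMod.val (e.injective hij)
    rwa [ZMod.val_natCast_of_lt i.2, ZMod.val_natCast_of_lt j.2] at this
  refine ⟨Equiv.ofBijective _ hbij, fun k hk => ?_⟩
  have hk1 : k + 1 < n := by omega
  rw [adjSwap, dif_pos hk1, ← Equiv.swap_apply_apply]
  refine Equiv.ext fun y => ?_
  obtain ⟨x, rfl⟩ := e.surjective y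
  rw [he k hk, hswap]
  simp only [Equiv.ofBijective_apply]
  rw [← e.injective.map_swap]
  congr 1
  have h := (add_left_injective (k : ZMod n)).map_swap 0 1 (x - k)
  simp only [sub_add_cancel, zero_add] at h
  rw [h, Nat.cast_succ, add_comm 1]

/-- Up to an inner automorphism, an endomorphism compatible with the center preserves the
permutation of the strands. -/
theorem exists_perm_eq {F : B n →* B n} (hF : IsCentralLift F) (hn : 4 ≤ n) :
    ∃ G : B n →* B n, IsCentralLift G ∧ deg (G (gen n 0)) = deg (F (gen n 0)) ∧
      ∀ g, perm n (G g) = perm n g := by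
  obtain ⟨τ, hτ⟩ := hF.exists_perm_conj hn
  obtain ⟨b, hb⟩ := perm_surjective τ⁻¹
  have hG : ∀ g, (MulAut.conj b).toMonoidHom.comp F g = b * F g * b⁻¹ := fun _ => rfl
  have hd : ∀ g, deg ((MulAut.conj b).toMonoidHom.comp F g) = deg (F g) := by
    intro g
    rw [hG, deg_mul, deg_mul, deg_inv]
    ring
  refine ⟨(MulAut.conj b).toMonoidHom.comp F, ⟨?_, fun g => ?_⟩, hd _, ?_⟩
  · rw [hd, hG, hF.map_fullTwist, ← (commute_fullTwist_zpow (by omega) _ b).eq,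
      mul_inv_cancel_right]
  · obtain ⟨g', j, h⟩ := hF.exists_eq (b⁻¹ * g * b)
    refine ⟨g', j, ?_⟩
    have hz := (commute_fullTwist_zpow (by omega) j b⁻¹).eq
    rw [hG, mul_assoc, ← hz, ← mul_assoc, mul_assoc b, h]
    group
  · intro g
    have : (perm n).comp ((MulAut.conj b).toMonoidHom.comp F) = perm n := hom_ext fun k hk => by
      rw [MonoidHom.comp_apply, hG, map_mul, map_mul, map_inv, hb, hτ k hk, perm_gen hk]
      group
    exact DFunLike.congr_fun this g

end IsCentralLift

/-! ### The action on crossing numbers -/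

/-- A symmetric function on pairs invariant under the permutations preserving `{0, 1}`. -/
theorem block_form (hn : 4 ≤ n) {V : Fin n → Fin n → ℤ} (hs : ∀ i j, V i j = V j i)
    (hV : ∀ k < n - 1, k = 0 ∨ 2 ≤ k → ∀ i j, V (adjSwap n k i) (adjSwap n k j) = V i j)
    {i j : Fin n} (hij : i ≠ j) :
    V i j = if (i : ℕ) < 2 then
        if (j : ℕ) < 2 then V ⟨0, by omega⟩ ⟨1, by omega⟩ else V ⟨0, by omega⟩ ⟨2, by omega⟩
      else if (j : ℕ) < 2 then V ⟨0, by omega⟩ ⟨2, by omega⟩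
        else V ⟨2, by omega⟩ ⟨3, by omega⟩ := by
  have step : ∀ k, k < n - 1 → k = 0 ∨ 2 ≤ k → ∀ i j i' j' : ℕ, ∀ (hi : i < n) (hj : j < n)
      (hi' : i' < n) (hj' : j' < n),
      i' = (if i = k then k + 1 else if i = k + 1 then k else i) →
      j' = (if j = k then k + 1 else if j = k + 1 then k else j) →
      V ⟨i', hi'⟩ ⟨j', hj'⟩ = V ⟨i, hi⟩ ⟨j, hj⟩ := by
    intro k hk hk' i j i' j' hi hj hi' hj' ei ej
    rw [← hV k hk hk' ⟨i, hi⟩ ⟨j, hj⟩]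
    congr 1 <;> refine Fin.ext ?_ <;> rw [adjSwap_val (by omega)] <;> assumption
  have h1 : ∀ i, ∀ hi : i < 2, ∀ j, 2 ≤ j → ∀ hj : j < n,
      V ⟨i, by omega⟩ ⟨j, hj⟩ = V ⟨i, by omega⟩ ⟨2, by omega⟩ := by
    intro i hi j h2
    induction j, h2 using Nat.le_induction with
    | base => exact fun _ => rfl
    | succ j h2 ih =>
      intro hj
      rw [← ih (by omega)]
      exact step j (by omega) (by omega) i j i (j + 1) _ _ _ _ (by split_ifs <;> omega)
        (by split_ifs <;> omega)
  have h2 : V ⟨1, by omega⟩ ⟨2, by omega⟩ = V ⟨0, by omega⟩ ⟨2, by omega⟩ :=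
    step 0 (by omega) (by omega) 0 2 1 2 _ _ _ _ (by decide) (by decide)
  have h3 : ∀ i, ∀ hi : i < 2, ∀ j, 2 ≤ j → ∀ hj : j < n,
      V ⟨i, by omega⟩ ⟨j, hj⟩ = V ⟨0, by omega⟩ ⟨2, by omega⟩ := by
    intro i hi j hj2 hj
    rw [h1 i hi j hj2 hj]
    obtain rfl | rfl : i = 0 ∨ i = 1 := by omega
    · rfl
    · exact h2
  have h4 : ∀ i j, 2 ≤ i → ∀ hij : i + 1 ≤ j, ∀ hj : j < n,
      V ⟨i, by omega⟩ ⟨j, hj⟩ = V ⟨i, by omega⟩ ⟨i + 1, by omega⟩ := by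
    intro i j hi hij
    induction j, hij using Nat.le_induction with
    | base => exact fun _ => rfl
    | succ j h2 ih =>
      intro hj
      rw [← ih (by omega)]
      exact step j (by omega) (by omega) i j i (j + 1) _ _ _ _ (by split_ifs <;> omega)
        (by split_ifs <;> omega)
  have h5 : ∀ i, 2 ≤ i → ∀ hi : i + 1 < n,
      V ⟨i, by omega⟩ ⟨i + 1, hi⟩ = V ⟨2, by omega⟩ ⟨3, by omega⟩ := by
    intro i h2
    induction i, h2 using Nat.le_induction with
    | base => exact fun _ => rfl
    | succ i h2 ih =>
      intro hi
      rw [← ih (by omega), ← h4 i (i + 1 + 1) h2 (by omega) hi]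
      exact step i (by omega) (by omega) i (i + 1 + 1) (i + 1) (i + 1 + 1) _ _ _ _
        (by split_ifs <;> omega) (by split_ifs <;> omega)
  have h6 : ∀ i j : Fin n, i < j → 2 ≤ (i : ℕ) → V i j = V ⟨2, by omega⟩ ⟨3, by omega⟩ := by
    intro i j hlt hi
    rw [← h5 i hi (by omega)]
    exact h4 i j hi (by omega) j.2
  split_ifs with hi hj hj
  · have hi' := Fin.val_ne_of_ne hij
    obtain ⟨e1, e2⟩ | ⟨e1, e2⟩ : ((i : ℕ) = 0 ∧ (j : ℕ) = 1) ∨ ((i : ℕ) = 1 ∧ (j : ℕ) = 0) := by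
      omega
    · congr 1 <;> exact Fin.ext (by assumption)
    · rw [hs]
      congr 1 <;> exact Fin.ext (by assumption)
  · exact h3 i hi j (by omega) j.2
  · rw [hs]
    exact h3 j hj i (by omega) i.2
  · rcases lt_or_gt_of_ne hij with h | h
    · exact h6 i j h (by omega)
    · rw [hs]
      exact h6 j i h (by omega)

/-- The total crossing number of a strand with the others. -/
def crossSum (g : B n) (i : Fin n) : ℤ := ∑ j, cross g i j

theorem sum_crossSum (g : B n) : ∑ i, crossSum g i = 2 * deg g := sum_cross g

/-- The crossing numbers of the image of a pure braid, in terms of those of the pure braid: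
`x`, `y`, `w` are half the crossing numbers in the image of the square of the first generator. -/
def HasCrossForm (F : B n →* B n) (x y w : ℤ) : Prop :=
  ∀ p : B n, perm n p = 1 → ∀ i j, i ≠ j → cross (F p) i j =
    w * deg p + (y - w) * (crossSum p i + crossSum p j) + (x - 2 * y + w) * cross p i j

theorem cross_gen_sq {k : ℕ} (hk : k < n - 1) (i j : Fin n) :
    cross (gen n k ^ 2) i j = 2 * weight k i j := by
  rw [pow_two, cross_mul, cross_gen hk, perm_gen hk, cross_gen hk]
  have : weight k (adjSwap n k i) (adjSwap n k j) = weight k i j := by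
    rw [adjSwap_val (by omega), adjSwap_val (by omega)]
    unfold weight
    grind
  rw [this, two_mul]

theorem perm_gen_sq {k : ℕ} (hk : k < n - 1) : perm n (gen n k ^ 2) = 1 := by
  rw [map_pow, perm_gen hk, adjSwap, dif_pos (by omega), pow_two, Equiv.swap_mul_self]

theorem sum_weight_zero (hn : 2 ≤ n) (i : Fin n) :
    ∑ j : Fin n, weight 0 i j = if (i : ℕ) < 2 then 1 else 0 := by
  split_ifs with h
  · rw [Finset.sum_eq_single (⟨1 - i, by omega⟩ : Fin n)]
    · unfold weight
      rw [if_pos]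
      dsimp only
      omega
    · intro j _ hj
      have := Fin.val_ne_of_ne hj
      unfold weight
      rw [if_neg]
      dsimp only at this
      omega
    · simp
  · refine Finset.sum_eq_zero fun j _ => ?_
    unfold weight
    rw [if_neg]
    omega

theorem crossSum_gen_zero_sq (hn : 2 ≤ n) (i : Fin n) :
    crossSum (gen n 0 ^ 2) i = if (i : ℕ) < 2 then 2 else 0 := by
  simp only [crossSum, cross_gen_sq (show 0 < n - 1 by omega), ← Finset.mul_sum,
    sum_weight_zero hn]
  split_ifs <;> rfl

theorem crossSum_mul_of_perm_eq_one {p : B n} (g : B n) (hp : perm n p = 1) (i : Fin n) :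
    crossSum (g * p) i = crossSum g i + crossSum p i := by
  simp only [crossSum, cross_mul, hp, Equiv.Perm.one_apply, Finset.sum_add_distrib]
  rw [add_comm]

theorem crossSum_conj (g : B n) {p : B n} (hp : perm n p = 1) (i : Fin n) :
    crossSum (g * p * g⁻¹) i = crossSum p ((perm n g)⁻¹ i) := by
  simp only [crossSum, cross_conj g hp]
  exact Equiv.sum_comp ((perm n g)⁻¹) (fun j => cross p ((perm n g)⁻¹ i) j)

/-- A property of pure braids stable under products, inverses and conjugation holds as soon as
it holds for the square of the first generator. -/
theorem pure_induction {P : B n → Prop} (one : P 1) (sq : P (gen n 0 ^ 2))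
    (mul : ∀ p q, perm n p = 1 → perm n q = 1 → P p → P q → P (p * q))
    (inv : ∀ p, perm n p = 1 → P p → P p⁻¹)
    (conj : ∀ g p, perm n p = 1 → P p → P (g * p * g⁻¹)) {p : B n} (hp : perm n p = 1) : P p := by
  have h := mem_normalClosure_of_perm_eq_one hp
  suffices perm n p = 1 ∧ P p from this.2
  refine Subgroup.closure_induction (p := fun p _ => perm n p = 1 ∧ P p) ?_ ⟨map_one _, one⟩ ?_ ?_ h
  · intro x hx
    obtain ⟨a, ⟨i, hi, rfl⟩, hx⟩ := Group.mem_conjugatesOfSet_iff.1 hx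
    obtain ⟨c, rfl⟩ := isConj_iff.1 hx
    have hi2 : P (gen n i ^ 2) := by
      rw [gen_eq_conj hi, conj_pow]
      exact conj _ _ (perm_gen_sq (Nat.zero_lt_of_lt hi)) sq
    refine ⟨?_, conj _ _ (perm_gen_sq hi) hi2⟩
    rw [map_mul, map_mul, perm_gen_sq hi, map_inv, mul_one, mul_inv_cancel]
  · rintro x y - - ⟨hx, hx'⟩ ⟨hy, hy'⟩
    exact ⟨by rw [map_mul, hx, hy, one_mul], mul x y hx hy hx' hy'⟩
  · rintro x - ⟨hx, hx'⟩
    exact ⟨by rw [map_inv, hx, inv_one], inv x hx hx'⟩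

theorem exists_hasCrossForm (hn : 4 ≤ n) {F : B n →* B n} (hF : ∀ g, perm n (F g) = perm n g) :
    ∃ x y w, HasCrossForm F x y (2 * w) := by
  have h0 : 0 < n - 1 := by omega
  have hp0 : perm n (F (gen n 0 ^ 2)) = 1 := by rw [hF, perm_gen_sq h0]
  have hev : ∀ i j, i ≠ j → Even (cross (F (gen n 0 ^ 2)) i j) := fun i j hij =>
    even_cross_of_fixed _ hij (by rw [hp0]; rfl) (by rw [hp0]; rfl)
  set V := cross (F (gen n 0 ^ 2)) with hV
  obtain ⟨x, hx⟩ := hev ⟨0, by omega⟩ ⟨1, by omega⟩ (by simp)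
  obtain ⟨y, hy⟩ := hev ⟨0, by omega⟩ ⟨2, by omega⟩ (by simp)
  have hfix : ∀ m, ∀ h2 : 2 ≤ m, ∀ hm : m < n, perm n (F (gen n 0)) ⟨m, hm⟩ = ⟨m, hm⟩ := by
    intro m h2 hm
    rw [hF, perm_gen h0]
    refine Fin.ext ?_
    rw [adjSwap_val (by omega), if_neg (by simp; omega), if_neg (by simp; omega)]
  obtain ⟨w, hw⟩ := even_cross_of_fixed (F (gen n 0)) (i := ⟨2, by omega⟩) (j := ⟨3, by omega⟩)
    (by simp) (hfix 2 le_rfl _) (hfix 3 (by omega) _)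
  have hw' : V ⟨2, by omega⟩ ⟨3, by omega⟩ = 4 * w := by
    rw [hV, pow_two, map_mul, cross_mul, hfix 2 le_rfl _, hfix 3 (by omega) _, hw]
    ring
  have hinv : ∀ k < n - 1, k = 0 ∨ 2 ≤ k → ∀ i j,
      V (adjSwap n k i) (adjSwap n k j) = V i j := by
    intro k hk hk' i j
    have hc : Commute (gen n k) (gen n 0) := by
      rcases hk' with rfl | h
      · exact Commute.refl _
      · exact (gen_comm (by omega)).symm
    have := cross_of_commute hp0 ((hc.pow_right 2).map F) i j
    rwa [hF, perm_gen hk] at this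
  rw [hV] at hx hy hw'
  refine ⟨x, y, w, fun p hp => ?_⟩
  refine pure_induction (P := fun p => ∀ i j, i ≠ j → cross (F p) i j = 2 * w * deg p +
    (y - 2 * w) * (crossSum p i + crossSum p j) + (x - 2 * y + 2 * w) * cross p i j)
    ?_ ?_ ?_ ?_ ?_ hp
  · simp [crossSum]
  · intro i j hij
    have hb := block_form hn (fun i j => cross_comm _ i j) hinv hij
    rw [crossSum_gen_zero_sq (by omega), crossSum_gen_zero_sq (by omega), cross_gen_sq h0,
      deg_pow, deg_gen h0, hb, hx, hy, hw']
    have hne := Fin.val_ne_of_ne hij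
    split_ifs with h1 h2 h2
    · rw [weight, if_pos (by omega)]; push_cast; ring
    · rw [weight, if_neg (by omega)]; push_cast; ring
    · rw [weight, if_neg (by omega)]; push_cast; ring
    · rw [weight, if_neg (by omega)]; push_cast; ring
  · intro p q hp hq ihp ihq i j hij
    rw [map_mul, cross_mul, hF q, hq, Equiv.Perm.one_apply, Equiv.Perm.one_apply, ihp i j hij,
      ihq i j hij, deg_mul, crossSum_mul_of_perm_eq_one _ hq, crossSum_mul_of_perm_eq_one _ hq,
      cross_mul, hq, Equiv.Perm.one_apply, Equiv.Perm.one_apply]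
    ring
  · intro p hp ih i j hij
    have hs : ∀ i, crossSum p⁻¹ i = -crossSum p i := by
      intro i
      have := crossSum_mul_of_perm_eq_one p⁻¹ hp i
      rw [inv_mul_cancel] at this
      simp only [crossSum, cross_one, Finset.sum_const_zero] at this ⊢
      linarith
    rw [map_inv, cross_inv, hF, hp, inv_one, Equiv.Perm.one_apply, Equiv.Perm.one_apply,
      ih i j hij, deg_inv, hs, hs, cross_inv, hp, inv_one, Equiv.Perm.one_apply,
      Equiv.Perm.one_apply]
    ring
  · intro g p hp ih i j hij
    rw [map_mul, map_mul, map_inv, cross_conj _ (by rw [hF, hp]), hF,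
      ih _ _ ((perm n g)⁻¹.injective.ne hij), crossSum_conj _ hp, crossSum_conj _ hp,
      cross_conj _ hp, deg_mul, deg_mul, deg_inv]
    ring

namespace HasCrossForm

variable {F : B n →* B n} {x y w : ℤ}

theorem crossSum_map (h : HasCrossForm F x y w) {p : B n} (hp : perm n p = 1) (i : Fin n) :
    crossSum (F p) i = (n - 1) * w * deg p + (y - w) * ((n - 2) * crossSum p i + 2 * deg p) +
      (x - 2 * y + w) * crossSum p i := by
  have hj : ∀ j, cross (F p) i j =
      w * deg p + (y - w) * (crossSum p i + crossSum p j) + (x - 2 * y + w) * cross p i j -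
        if i = j then w * deg p + (y - w) * (2 * crossSum p i) else 0 := by
    intro j
    split_ifs with hij
    · subst hij
      rw [cross_self, cross_self]
      ring
    · rw [h p hp i j hij, sub_zero]
  have hc : ∑ j, cross p i j = crossSum p i := rfl
  unfold crossSum at *
  rw [Finset.sum_congr rfl fun j _ => hj j]
  simp only [Finset.sum_sub_distrib, Finset.sum_add_distrib, ← Finset.mul_sum, Finset.sum_const,
    Finset.card_univ, Fintype.card_fin, nsmul_eq_mul, Finset.sum_ite_eq, Finset.mem_univ, if_true,
    sum_cross]
  ring

theorem deg_map_gen (h : HasCrossForm F x y (2 * w)) (hn : 2 ≤ n) :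
    deg (F (gen n 0)) =
      w * (n * (n - 1)) + 2 * (n - 1) * (y - 2 * w) + (x - 2 * y + 2 * w) := by
  have h0 : 0 < n - 1 := by omega
  have hs := sum_crossSum (F (gen n 0 ^ 2))
  have hs' := sum_crossSum (gen n 0 ^ 2)
  rw [Finset.sum_congr rfl fun i _ => h.crossSum_map (perm_gen_sq h0) i] at hs
  simp only [Finset.sum_add_distrib, ← Finset.mul_sum, Finset.sum_const, hs',
    Finset.card_univ, Fintype.card_fin, nsmul_eq_mul, map_pow, deg_pow, deg_gen h0] at hs
  push_cast at hs
  linarith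

theorem sq_eq_one (h : HasCrossForm F x y w) (hn : 4 ≤ n) (hL : IsCentralLift F)
    (hF : ∀ g, perm n (F g) = perm n g) :
    (x - 2 * y + w) ^ 2 = 1 ∧ ((n - 2) * (y - w) + (x - 2 * y + w)) ^ 2 = 1 := by
  have h0 : 0 < n - 1 := by omega
  obtain ⟨p, j, hpj⟩ := hL.exists_eq (gen n 0 ^ 2)
  have hz := perm_fullTwist_zpow (n := n) (by omega) j
  have hp : perm n p = 1 := by
    have := congrArg (perm n) hpj
    rwa [map_mul, hz, mul_one, hF, perm_gen_sq h0] at this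
  have hev : ∀ a b : Fin n, Even (cross p a b) := by
    intro a b
    by_cases hab : a = b
    · rw [hab, cross_self]; exact Even.zero
    · exact even_cross_of_fixed p hab (by rw [hp]; rfl) (by rw [hp]; rfl)
  have hunit : ∀ a b : ℤ, Even b → a * b = 2 → a ^ 2 = 1 := by
    rintro a _ ⟨b, rfl⟩ hab
    exact Int.isUnit_sq (IsUnit.of_mul_eq_one b (by linarith))
  constructor
  · have hc : ∀ a b : Fin n, a ≠ b → 2 * j + cross (F p) a b = 2 * weight 0 a b := by
      intro a b hab
      rw [← cross_gen_sq h0, ← hpj, cross_mul, hz, cross_fullTwist_zpow (by omega) hab]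
      rfl
    let i0 : Fin n := ⟨0, by omega⟩
    let i1 : Fin n := ⟨1, by omega⟩
    let i2 : Fin n := ⟨2, by omega⟩
    let i3 : Fin n := ⟨3, by omega⟩
    have h01 : i0 ≠ i1 := by simp [i0, i1]
    have h21 : i2 ≠ i1 := by simp [i2, i1]
    have h03 : i0 ≠ i3 := by simp [i0, i3]
    have h23 : i2 ≠ i3 := by simp [i2, i3]
    have e1 := hc _ _ h01
    have e2 := hc _ _ h21
    have e3 := hc _ _ h03
    have e4 := hc _ _ h23
    rw [h p hp _ _ h01, show weight 0 (i0 : ℕ) (i1 : ℕ) = 1 from rfl] at e1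
    rw [h p hp _ _ h21, show weight 0 (i2 : ℕ) (i1 : ℕ) = 0 from rfl] at e2
    rw [h p hp _ _ h03, show weight 0 (i0 : ℕ) (i3 : ℕ) = 0 from rfl] at e3
    rw [h p hp _ _ h23, show weight 0 (i2 : ℕ) (i3 : ℕ) = 0 from rfl] at e4
    refine hunit _ (cross p i0 i1 - cross p i2 i1 - cross p i0 i3 + cross p i2 i3)
      ((((hev _ _).sub (hev _ _)).sub (hev _ _)).add (hev _ _)) ?_
    linear_combination e1 - e2 - e3 + e4
  · have hc : ∀ a : Fin n, crossSum (F p) a + crossSum (fullTwist n ^ j) a =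
        if (a : ℕ) < 2 then 2 else 0 := by
      intro a
      rw [← crossSum_mul_of_perm_eq_one _ hz, hpj, crossSum_gen_zero_sq (by omega)]
    have hzs : ∀ a : Fin n, crossSum (fullTwist n ^ j) a = (n - 1) * (2 * j) := by
      intro a
      have hb : ∀ b, cross (fullTwist n ^ j) a b = 2 * j - if a = b then 2 * j else 0 := by
        intro b
        split_ifs with hab
        · rw [hab, cross_self, sub_self]
        · rw [cross_fullTwist_zpow (by omega) hab, sub_zero]
      unfold crossSum
      rw [Finset.sum_congr rfl fun b _ => hb b]
      simp only [Finset.sum_sub_distrib, Finset.sum_const, Finset.card_univ, Fintype.card_fin,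
        nsmul_eq_mul, Finset.sum_ite_eq, Finset.mem_univ, if_true]
      ring
    have e1 := hc ⟨0, by omega⟩
    have e2 := hc ⟨2, by omega⟩
    rw [hzs, h.crossSum_map hp, if_pos (by simp)] at e1
    rw [hzs, h.crossSum_map hp, if_neg (by simp)] at e2
    refine hunit _ (crossSum p ⟨0, by omega⟩ - crossSum p ⟨2, by omega⟩)
      (Even.sub (Finset.even_sum _ fun _ _ => hev _ _) (Finset.even_sum _ fun _ _ => hev _ _)) ?_
    linear_combination e1 - e2

end HasCrossForm

/-! ### The Burau representation on four strands modulo 27 -/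

/-- The images of the generators of the braid group on four strands under the Burau
representation at `t = 4`, modulo `27`. -/
def burauGen (k : ℕ) : Matrix (Fin 4) (Fin 4) (ZMod 27) :=
  match k with
  | 0 => !![-3, 4, 0, 0; 1, 0, 0, 0; 0, 0, 1, 0; 0, 0, 0, 1]
  | 1 => !![1, 0, 0, 0; 0, -3, 4, 0; 0, 1, 0, 0; 0, 0, 0, 1]
  | 2 => !![1, 0, 0, 0; 0, 1, 0, 0; 0, 0, -3, 4; 0, 0, 1, 0]
  | _ => 1

/-- The inverse of `burauGen`. -/
def burauGenInv (k : ℕ) : Matrix (Fin 4) (Fin 4) (ZMod 27) :=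
  match k with
  | 0 => !![0, 1, 0, 0; 7, -6, 0, 0; 0, 0, 1, 0; 0, 0, 0, 1]
  | 1 => !![1, 0, 0, 0; 0, 0, 1, 0; 0, 7, -6, 0; 0, 0, 0, 1]
  | 2 => !![1, 0, 0, 0; 0, 1, 0, 0; 0, 0, 0, 1; 0, 0, 7, -6]
  | _ => 1

theorem burauGen_mul_inv (k : ℕ) :
    burauGen k * burauGenInv k = 1 ∧ burauGenInv k * burauGen k = 1 := by
  match k with
  | 0 => decide +kernel
  | 1 => decide +kernel
  | 2 => decide +kernel
  | _ + 3 => exact ⟨one_mul _, one_mul _⟩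

/-- The Burau representation of the braid group on four strands at `t = 4`, modulo `27`. -/
def burau : B 4 →* (Matrix (Fin 4) (Fin 4) (ZMod 27))ˣ :=
  lift (fun k => ⟨burauGen k, burauGenInv k, (burauGen_mul_inv k).1, (burauGen_mul_inv k).2⟩)
    (by
      intro i j hij hj
      obtain ⟨rfl, rfl⟩ : i = 0 ∧ j = 2 := by omega
      refine Units.ext (?_ : burauGen 0 * burauGen 2 = burauGen 2 * burauGen 0)
      decide +kernel)
    (by
      intro i hi
      obtain rfl | rfl : i = 0 ∨ i = 1 := by omega
      · refine Units.ext (?_ : burauGen 0 * burauGen 1 * burauGen 0 =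
          burauGen 1 * burauGen 0 * burauGen 1)
        decide +kernel
      · refine Units.ext (?_ : burauGen 1 * burauGen 2 * burauGen 1 =
          burauGen 2 * burauGen 1 * burauGen 2)
        decide +kernel)

theorem burau_gen {k : ℕ} (hk : k < 3) : (burau (gen 4 k)).1 = burauGen k :=
  congrArg Units.val (lift_gen (n := 4) hk)

theorem burau_mul (g h : B 4) : (burau (g * h)).1 = (burau g).1 * (burau h).1 := by
  rw [map_mul, Units.val_mul]

/-- The permutation representation of the braid group on four strands. -/
def permMat : B 4 →* Matrix (Fin 4) (Fin 4) (ZMod 27) where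
  toFun g := ((perm 4 g)⁻¹).permMatrix (ZMod 27)
  map_one' := by simp
  map_mul' g h := by rw [map_mul, mul_inv_rev, Matrix.permMatrix_mul]

theorem permMat_apply (g : B 4) : permMat g = ((perm 4 g)⁻¹).permMatrix (ZMod 27) := rfl

theorem nine_smul_burau (g : B 4) :
    (9 : ZMod 27) • (burau g).1 = (9 : ZMod 27) • permMat g := by
  induction g using induction with
  | one => rw [map_one, map_one, Units.val_one]
  | gen_mul k hk g =>
    have hgen : (9 : ZMod 27) • burauGen k = (9 : ZMod 27) • permMat (gen 4 k) := by
      rw [permMat_apply, perm_gen hk]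
      obtain rfl | rfl | rfl : k = 0 ∨ k = 1 ∨ k = 2 := by omega
      all_goals decide +kernel
    rw [burau_mul, burau_gen hk, map_mul, ← smul_mul_assoc, hgen, smul_mul_assoc,
      ← mul_smul_comm, ← mul_smul_comm (9 : ZMod 27) (permMat (gen 4 k))]
    refine ⟨fun h => ?_, fun h => by rw [h]⟩
    have := congrArg (fun M => permMat (gen 4 k)⁻¹ * M) h
    simpa only [← mul_assoc, ← map_mul, inv_mul_cancel, map_one, one_mul] using this

/-- Half the weighted Laplacian of the crossing numbers. -/
def crossLap (g : B 4) : Matrix (Fin 4) (Fin 4) (ZMod 27) :=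
  Matrix.of fun i j => 14 * (((if i = j then crossSum g i else 0) - cross g i j : ℤ) : ZMod 27)

theorem crossLap_apply (g : B 4) (i j : Fin 4) : crossLap g i j =
    14 * (((if i = j then crossSum g i else 0) - cross g i j : ℤ) : ZMod 27) := rfl

theorem crossLap_mul {p q : B 4} (hq : perm 4 q = 1) :
    crossLap (p * q) = crossLap p + crossLap q := by
  ext i j
  rw [Matrix.add_apply, crossLap_apply, crossLap_apply, crossLap_apply,
    crossSum_mul_of_perm_eq_one _ hq, cross_mul, hq, Equiv.Perm.one_apply, Equiv.Perm.one_apply]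
  split_ifs <;> push_cast <;> ring

theorem crossLap_conj (g : B 4) {p : B 4} (hp : perm 4 p = 1) :
    crossLap (g * p * g⁻¹) = permMat g * crossLap p * permMat g⁻¹ := by
  rw [permMat_apply, permMat_apply, map_inv, inv_inv]
  ext i j
  rw [Equiv.Perm.permMatrix, Equiv.Perm.permMatrix, PEquiv.toMatrix_toPEquiv_mul,
    PEquiv.mul_toMatrix_toPEquiv, Matrix.submatrix_apply, Matrix.submatrix_apply, crossLap_apply,
    crossLap_apply, crossSum_conj _ hp, cross_conj _ hp]
  have h : ((perm 4 g)⁻¹ i = (perm 4 g).symm j) = (i = j) :=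
    propext ((perm 4 g)⁻¹).injective.eq_iff
  simp only [id, h]
  rfl

theorem three_smul_burau {p : B 4} (hp : perm 4 p = 1) :
    (3 : ZMod 27) • (burau p).1 = (3 : ZMod 27) • 1 + (9 : ZMod 27) • crossLap p := by
  have mul_nine : ∀ q, perm 4 q = 1 → ∀ M : Matrix (Fin 4) (Fin 4) (ZMod 27),
      ((9 : ZMod 27) • M) * (burau q).1 = (9 : ZMod 27) • M := by
    intro q hq M
    rw [smul_mul_assoc, ← mul_smul_comm, nine_smul_burau, permMat_apply, hq, inv_one,
      Matrix.permMatrix_one, mul_smul_comm, mul_one]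
  refine pure_induction (P := fun p => (3 : ZMod 27) • (burau p).1 =
    (3 : ZMod 27) • 1 + (9 : ZMod 27) • crossLap p) ?_ ?_ ?_ ?_ ?_ hp
  · have : crossLap 1 = 0 := by
      ext i j
      simp [crossLap_apply, crossSum]
    rw [this, map_one, smul_zero, add_zero, Units.val_one]
  · have : crossLap (gen 4 0 ^ 2) = !![1, -1, 0, 0; -1, 1, 0, 0; 0, 0, 0, 0; 0, 0, 0, 0] := by
      ext i j
      rw [crossLap_apply, crossSum_gen_zero_sq (by omega), cross_gen_sq (by omega)]
      fin_cases i <;> fin_cases j <;> decide +kernel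
    rw [this, pow_two, burau_mul, burau_gen (by omega)]
    decide +kernel
  · intro p q hp hq ihp ihq
    rw [burau_mul, ← smul_mul_assoc, ihp, add_mul, mul_nine q hq, smul_mul_assoc, one_mul, ihq,
      crossLap_mul hq, smul_add]
    abel
  · intro p hp ih
    have hi : perm 4 p⁻¹ = 1 := by rw [map_inv, hp, inv_one]
    have hl : crossLap p⁻¹ = -crossLap p := by
      have := crossLap_mul (p := p) hi
      rw [mul_inv_cancel] at this
      have h1 : crossLap 1 = 0 := by
        ext i j
        simp [crossLap_apply, crossSum]
      rw [h1] at this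
      exact (neg_eq_of_add_eq_zero_right this.symm).symm
    have := congrArg (fun M => M * (burau p⁻¹).1) ih
    rw [add_mul, mul_nine _ hi, smul_mul_assoc, smul_mul_assoc, one_mul, ← burau_mul,
      mul_inv_cancel, map_one, Units.val_one] at this
    rw [hl, this]
    simp
  · intro g p hp ih
    rw [burau_mul, burau_mul, ← smul_mul_assoc, ← mul_smul_comm, ih, mul_add, add_mul,
      mul_smul_comm, mul_one, smul_mul_assoc, ← burau_mul, mul_inv_cancel, map_one,
      Units.val_one, crossLap_conj g hp]
    congr 1
    rw [mul_smul_comm, ← smul_mul_assoc, nine_smul_burau, smul_mul_assoc, smul_mul_assoc,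
      ← mul_smul_comm, nine_smul_burau, mul_smul_comm]

theorem crossLap_commute {p q : B 4} (hp : perm 4 p = 1) (hq : perm 4 q = 1) (h : Commute p q) :
    (9 : ZMod 27) • (crossLap p * crossLap q) = (9 : ZMod 27) • (crossLap q * crossLap p) := by
  have key : ∀ p, perm 4 p = 1 → ∃ A : Matrix (Fin 4) (Fin 4) (ZMod 27),
      (burau p).1 = 1 + (3 : ZMod 27) • A ∧ (9 : ZMod 27) • A = (9 : ZMod 27) • crossLap p := by
    intro p hp
    have h3 : ∀ i j, ∃ y, ((burau p).1 - 1 - (3 : ZMod 27) • crossLap p) i j = 9 * y := by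
      intro i j
      have hz : ∀ a : ZMod 27, 3 * a = 0 → ∃ y, a = 9 * y := by decide +kernel
      refine hz _ ?_
      have := congrFun (congrFun (three_smul_burau hp) i) j
      simp only [Matrix.smul_apply, Matrix.add_apply, Matrix.sub_apply, smul_eq_mul] at this ⊢
      linear_combination this
    choose y hy using h3
    refine ⟨crossLap p + (3 : ZMod 27) • Matrix.of y, ?_, ?_⟩
    · ext i j
      have := hy i j
      simp only [Matrix.smul_apply, Matrix.add_apply, Matrix.sub_apply, smul_eq_mul,
        Matrix.of_apply] at this ⊢
      linear_combination this
    · rw [smul_add, smul_smul, show (9 * 3 : ZMod 27) = 0 from by decide, zero_smul, add_zero]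
  obtain ⟨A, hA, hA'⟩ := key p hp
  obtain ⟨C, hC, hC'⟩ := key q hq
  have hc : (burau p).1 * (burau q).1 = (burau q).1 * (burau p).1 := by
    rw [← burau_mul, ← burau_mul, h.eq]
  have h9 : (9 : ZMod 27) • (A * C) = (9 : ZMod 27) • (C * A) := by
    rw [hA, hC] at hc
    simp only [add_mul, mul_add, one_mul, mul_one, smul_mul_assoc, mul_smul_comm, smul_add] at hc
    rw [smul_smul, smul_smul, show (3 * 3 : ZMod 27) = 9 from rfl] at hc
    have := congrArg (fun M => M - (1 + (3 : ZMod 27) • A + (3 : ZMod 27) • C)) hc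
    convert this using 1 <;> abel
  rw [← smul_mul_assoc, ← hA', smul_mul_assoc, ← mul_smul_comm, ← hC', mul_smul_comm, h9,
    ← smul_mul_assoc, hC', smul_mul_assoc, ← mul_smul_comm, hA', mul_smul_comm]

theorem commute_gen_zero_halfTwist_sq (hn : 3 ≤ n) :
    Commute (gen n 0) ((gen n 0 * gen n 1 * gen n 0) ^ 2) := by
  have h := gen_braid (n := n) (i := 0) (by omega)
  rw [zero_add] at h
  have h1 : gen n 0 * (gen n 0 * gen n 1 * gen n 0) = gen n 0 * gen n 1 * gen n 0 * gen n 1 := by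
    nth_rewrite 1 [h]
    simp only [mul_assoc]
  have h2 : gen n 1 * (gen n 0 * gen n 1 * gen n 0) = gen n 0 * gen n 1 * gen n 0 * gen n 0 := by
    nth_rewrite 2 [h]
    simp only [mul_assoc]
  rw [commute_iff_eq, pow_two, ← mul_assoc, h1, mul_assoc _ (gen n 1), h2, ← mul_assoc]

theorem cross_halfTwist_sq (i j : Fin 4) :
    cross ((gen 4 0 * gen 4 1 * gen 4 0) ^ 2) i j =
      if i = j ∨ (i : ℕ) = 3 ∨ (j : ℕ) = 3 then 0 else 2 := by
  rw [pow_two]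
  simp only [cross_mul, map_mul, Equiv.Perm.mul_apply, cross_gen (n := 4) (k := 0) (by omega),
    cross_gen (n := 4) (k := 1) (by omega), perm_gen (n := 4) (k := 0) (by omega),
    perm_gen (n := 4) (k := 1) (by omega)]
  fin_cases i <;> fin_cases j <;> decide +kernel

theorem perm_halfTwist_sq : perm 4 ((gen 4 0 * gen 4 1 * gen 4 0) ^ 2) = 1 := by
  simp only [map_pow, map_mul, perm_gen (n := 4) (k := 0) (by omega),
    perm_gen (n := 4) (k := 1) (by omega)]
  decide +kernel

theorem HasCrossForm.ne_of_four {F : B 4 →* B 4} {x y w : ℤ} (h : HasCrossForm F x y (2 * w))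
    (hF : ∀ g, perm 4 (F g) = perm 4 g) (he : (y - 2 * w) ^ 2 = 1) :
    x - 2 * y + 2 * w ≠ -(y - 2 * w) := by
  intro hx
  set e := y - 2 * w with he'
  set q := (gen 4 0 * gen 4 1 * gen 4 0) ^ 2 with hq
  have hpp : perm 4 (gen 4 0 ^ 2) = 1 := perm_gen_sq (by omega)
  have hpq : perm 4 q = 1 := perm_halfTwist_sq
  have hc : Commute (gen 4 0 ^ 2) q :=
    (commute_gen_zero_halfTwist_sq (by omega)).pow_left 2
  have hqs : ∀ i : Fin 4, crossSum q i = if (i : ℕ) = 3 then 0 else 4 := by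
    intro i
    simp only [crossSum, hq, cross_halfTwist_sq]
    revert i
    decide +kernel
  have hdp : deg (gen 4 0 ^ 2) = 2 := by rw [deg_pow, deg_gen (by omega)]; rfl
  have hdq : deg q = 6 := by
    rw [hq, deg_pow, deg_mul, deg_mul, deg_gen (by omega), deg_gen (by omega)]; rfl
  have hFp : ∀ i j, cross (F (gen 4 0 ^ 2)) i j = if i = j then 0 else
      2 * (2 * w + e) - if 2 ≤ (i : ℕ) ∧ 2 ≤ (j : ℕ) then 2 * e else 0 := by
    intro i j
    by_cases hij : i = j
    · rw [if_pos hij, hij, cross_self]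
    rw [if_neg hij]
    have := Fin.val_ne_of_ne hij
    rw [h _ hpp i j hij, hx, hdp, crossSum_gen_zero_sq (by omega), crossSum_gen_zero_sq (by omega),
      cross_gen_sq (by omega), ← he', weight]
    split_ifs <;> omega
  have hFq : ∀ i j, cross (F q) i j = if i = j then 0 else
      2 * (6 * w + 3 * e) - if (i : ℕ) = 3 ∨ (j : ℕ) = 3 then 2 * e else 0 := by
    intro i j
    by_cases hij : i = j
    · rw [if_pos hij, hij, cross_self]
    rw [if_neg hij]
    have := Fin.val_ne_of_ne hij
    rw [h _ hpq i j hij, hx, hdq, hqs, hqs, cross_halfTwist_sq, ← he']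
    split_ifs <;> omega
  have hcomm := congrFun (congrFun (crossLap_commute (by rw [hF, hpp]) (by rw [hF, hpq])
    (hc.map F)) 2) 0
  simp only [Matrix.smul_apply, Matrix.mul_apply, Fin.sum_univ_four, crossLap_apply, crossSum, hFp,
    hFq, smul_eq_mul] at hcomm
  simp +decide at hcomm
  have he2 : (e : ZMod 27) ^ 2 = 1 := mod_cast congrArg (Int.cast : ℤ → ZMod 27) he
  have : (7056 : ZMod 27) = 0 := by linear_combination hcomm - 7056 * he2
  revert this
  decide

theorem IsCentralLift.exists_deg_eq {F : B n →* B n} (hL : IsCentralLift F) (hn : 4 ≤ n) :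
    ∃ k γ : ℤ, γ ^ 2 = 1 ∧ deg (F (gen n 0)) = k * (n * (n - 1)) + γ := by
  obtain ⟨G, hG, hd, hF⟩ := hL.exists_perm_eq hn
  obtain ⟨x, y, w, h⟩ := exists_hasCrossForm hn hF
  obtain ⟨h1, h2⟩ := h.sq_eq_one hn hG hF
  refine ⟨w, _, h1, ?_⟩
  suffices he : y - 2 * w = 0 by
    rw [← hd, h.deg_map_gen (by omega), he]
    ring
  by_contra he
  have h3 : ((n : ℤ) - 2) * (y - 2 * w) = -(2 * (x - 2 * y + 2 * w)) := by
    have h4 : ((n : ℤ) - 2) * (y - 2 * w) *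
        (((n : ℤ) - 2) * (y - 2 * w) + 2 * (x - 2 * y + 2 * w)) = 0 := by
      linear_combination h2 - h1
    rcases mul_eq_zero.1 h4 with h5 | h5
    · exact absurd h5 (mul_ne_zero (by omega) he)
    · linarith
  obtain hlt | rfl : 4 < n ∨ n = 4 := by omega
  · have h6 : (((n : ℤ) - 2) * (y - 2 * w)) ^ 2 = 4 := by
      rw [h3]
      linear_combination 4 * h1
    have h7 : 1 ≤ (y - 2 * w) ^ 2 := by
      have := sq_pos_of_ne_zero he
      omega
    have h8 : (3 : ℤ) ≤ n - 2 := by omega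
    rw [mul_pow] at h6
    nlinarith [mul_le_mul_of_nonneg_right (pow_le_pow_left₀ (by norm_num) h8 2)
      (sq_nonneg (y - 2 * w))]
  · have h9 : x - 2 * y + 2 * w = -(y - 2 * w) := by
      push_cast at h3
      linarith
    refine h.ne_of_four hF ?_ h9
    rw [← h1, h9, neg_sq]

end Braid

/-- For every `n ≥ 4`, the natural homomorphism `Aut (B n) → Aut (B n / Z)`,
sending an automorphism `f` to the automorphism of the quotient by the center
induced by `f`, is bijective. -/
theorem aut_braid_to_aut_quotient_center_bijective (n : ℕ) (hn : 4 ≤ n)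
    (Φ : MulAut (B n) →* MulAut (B n ⧸ Subgroup.center (B n)))
    (hΦ : ∀ (f : MulAut (B n)) (x : B n),
      Φ f (QuotientGroup.mk x) = QuotientGroup.mk (f x)) :
    Function.Bijective Φ :=
  ⟨Braid.injective_of_three_le (by omega) Φ hΦ,
    Braid.surjective_of_deg_congr (by omega) (fun _ hF => hF.exists_deg_eq hn) Φ hΦ⟩
end

section
/- For every n ≥ 3, the center of the braid group B_n is the infinite cyclic subgroup generated by the full twist: Subgroup.center B_n equals the subgroup of integer powers (Subgroup.zpowers) of the element (σ_0 σ_1 ⋯ σ_{n-2})^n. -/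
/-- The defining relations of the Artin monoid of a graph: non-adjacent generators commute, and
adjacent generators satisfy the braid relation. -/
inductive ArtinRel {ι : Type*} (G : SimpleGraph ι) : FreeMonoid ι → FreeMonoid ι → Prop
  | comm {i j : ι} (h : ¬ G.Adj i j) : ArtinRel G (.of i * .of j) (.of j * .of i)
  | braid {i j : ι} (h : G.Adj i j) :
      ArtinRel G (.of i * (.of j * .of i)) (.of j * (.of i * .of j))

/-- The Artin monoid of a simply laced Coxeter graph. -/
abbrev ArtinMonoid {ι : Type*} (G : SimpleGraph ι) : Type _ := PresentedMonoid (ArtinRel G)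

namespace ArtinMonoid

variable {ι : Type*} {G : SimpleGraph ι}

/-- The standard generators of an Artin monoid. -/
def gen (G : SimpleGraph ι) (i : ι) : ArtinMonoid G := PresentedMonoid.of (ArtinRel G) i

lemma gen_mul_gen_mul {i j : ι} (h : ¬ G.Adj i j) (x : ArtinMonoid G) :
    gen G i * (gen G j * x) = gen G j * (gen G i * x) := by
  have := PresentedMonoid.mk_eq_mk_of_rel (ArtinRel.comm h)
  simp only [map_mul] at this
  rw [← mul_assoc, ← mul_assoc]
  exact congrArg (· * x) this

lemma braid_mul {i j : ι} (h : G.Adj i j) (x : ArtinMonoid G) :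
    gen G i * (gen G j * (gen G i * x)) = gen G j * (gen G i * (gen G j * x)) := by
  have := PresentedMonoid.mk_eq_mk_of_rel (ArtinRel.braid h)
  simp only [map_mul] at this
  simp only [← mul_assoc] at this ⊢
  exact congrArg (· * x) this

/-- The length homomorphism, sending each generator to `1`. -/
def lengthHom (G : SimpleGraph ι) : ArtinMonoid G →* Multiplicative ℕ :=
  PresentedMonoid.lift (fun _ => .ofAdd 1) (by
    rintro _ _ (h | h) <;> simp)

/-- The length of an element of an Artin monoid. -/
def length (x : ArtinMonoid G) : ℕ := (lengthHom G x).toAdd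

@[simp] lemma length_one : length (1 : ArtinMonoid G) = 0 := by simp [length]

@[simp] lemma length_mul (x y : ArtinMonoid G) : length (x * y) = length x + length y := by
  simp [length]

@[simp] lemma length_pow (x : ArtinMonoid G) (k : ℕ) : length (x ^ k) = k * length x := by
  simp [length]

@[simp] lemma length_gen (i : ι) : length (gen G i) = 1 := rfl

lemma induction_gen_mul {p : ArtinMonoid G → Prop} (one : p 1)
    (gen_mul : ∀ i x, p x → p (gen G i * x)) (x : ArtinMonoid G) : p x := by
  induction x using PresentedMonoid.inductionOn with
  | h w =>
    induction w using FreeMonoid.inductionOn' with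
    | one => exact one
    | of_mul i w ih => rw [map_mul]; exact gen_mul i _ ih

lemma eq_one_or_exists_gen_mul (x : ArtinMonoid G) : x = 1 ∨ ∃ i y, x = gen G i * y := by
  induction x using induction_gen_mul with
  | one => exact .inl rfl
  | gen_mul i x _ => exact .inr ⟨i, x, rfl⟩

/-- `LcmRel i x j y` says that the equality `gen i * x = gen j * y` arises from a factorization
of both sides through the least common right multiple of `gen i` and `gen j`. -/
def LcmRel (i : ι) (x : ArtinMonoid G) (j : ι) (y : ArtinMonoid G) : Prop :=
  (i = j ∧ x = y) ∨
  (i ≠ j ∧ ¬ G.Adj i j ∧ ∃ z, x = gen G j * z ∧ y = gen G i * z) ∨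
  (G.Adj i j ∧ ∃ z, x = gen G j * (gen G i * z) ∧ y = gen G i * (gen G j * z))

lemma LcmRel.symm {i j : ι} {x y : ArtinMonoid G} (h : LcmRel i x j y) : LcmRel j y i x := by
  rcases h with ⟨rfl, rfl⟩ | ⟨h, h', z, rfl, rfl⟩ | ⟨h, z, rfl, rfl⟩
  · exact .inl ⟨rfl, rfl⟩
  · exact .inr (.inl ⟨h.symm, fun h => h' h.symm, z, rfl, rfl⟩)
  · exact .inr (.inr ⟨h.symm, z, rfl, rfl⟩)

lemma LcmRel.mul_right {i j : ι} {x y : ArtinMonoid G} (h : LcmRel i x j y)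
    (t : ArtinMonoid G) : LcmRel i (x * t) j (y * t) := by
  rcases h with ⟨rfl, rfl⟩ | ⟨h, h', z, rfl, rfl⟩ | ⟨h, z, rfl, rfl⟩
  · exact .inl ⟨rfl, rfl⟩
  · exact .inr (.inl ⟨h, h', z * t, by simp only [mul_assoc], by simp only [mul_assoc]⟩)
  · exact .inr (.inr ⟨h, z * t, by simp only [mul_assoc], by simp only [mul_assoc]⟩)

lemma LcmRel.eq {i : ι} {x y : ArtinMonoid G} (h : LcmRel i x i y) : x = y := by
  rcases h with ⟨-, rfl⟩ | ⟨h, -⟩ | ⟨h, -⟩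
  · rfl
  · exact absurd rfl h
  · exact absurd h (G.irrefl)

lemma LcmRel.of_not_adj {i j : ι} {x y : ArtinMonoid G} (h : LcmRel i x j y) (hij : i ≠ j)
    (hadj : ¬ G.Adj i j) : ∃ z, x = gen G j * z ∧ y = gen G i * z := by
  rcases h with ⟨rfl, -⟩ | ⟨-, -, h⟩ | ⟨h, -⟩
  · exact absurd rfl hij
  · exact h
  · exact absurd h hadj

lemma LcmRel.of_adj {i j : ι} {x y : ArtinMonoid G} (h : LcmRel i x j y) (hadj : G.Adj i j) :
    ∃ z, x = gen G j * (gen G i * z) ∧ y = gen G i * (gen G j * z) := by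
  rcases h with ⟨rfl, -⟩ | ⟨-, h, -⟩ | ⟨-, h⟩
  · exact absurd hadj (G.irrefl)
  · exact absurd hadj h
  · exact h

/-- Transitivity of `LcmRel` when the middle generator commutes with the first one and is adjacent
to the last one, assuming Garside's lemma for shorter elements. -/
private lemma LcmRel.trans_comm_braid {N : ℕ}
    (ih : ∀ (a b : ι) (u v : ArtinMonoid G), gen G a * u = gen G b * v → length u < N →
      LcmRel a u b v)
    {i p k : ι} (hik : i ≠ k) (hip : i ≠ p) (hip' : ¬ G.Adj i p) (hpk : G.Adj p k)
    {z z' : ArtinMonoid G} (h : gen G i * z = gen G k * (gen G p * z')) (hN : length z < N) :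
    LcmRel i (gen G p * z) k (gen G p * (gen G k * z')) := by
  have hpi' : ¬ G.Adj p i := fun h => hip' h.symm
  have hr := ih _ _ _ _ h hN
  by_cases hadj : G.Adj i k
  · obtain ⟨v, rfl, hv⟩ := hr.of_adj hadj
    simp only [length_mul, length_gen] at hN
    have hl := congrArg length hv
    simp only [length_mul, length_gen] at hl
    obtain ⟨t, rfl, ht⟩ := (ih _ _ _ _ hv (by omega)).of_not_adj hip.symm hpi'
    obtain ⟨q, rfl, rfl⟩ := (ih _ _ _ _ ht (by omega)).of_adj hpk.symm
    refine .inr (.inr ⟨hadj, gen G p * (gen G k * (gen G i * q)), ?_, ?_⟩)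
    · rw [gen_mul_gen_mul hip', braid_mul hpk, braid_mul hadj.symm, gen_mul_gen_mul hpi']
    · rw [braid_mul hadj.symm, gen_mul_gen_mul hpi', gen_mul_gen_mul hip' q, braid_mul hpk]
  · obtain ⟨v, rfl, hv⟩ := hr.of_not_adj hik hadj
    simp only [length_mul, length_gen] at hN
    have hl := congrArg length hv
    simp only [length_mul, length_gen] at hl
    obtain ⟨t, rfl, rfl⟩ := (ih _ _ _ _ hv (by omega)).of_not_adj hip.symm hpi'
    refine .inr (.inl ⟨hik, hadj, gen G p * (gen G k * t), ?_, ?_⟩)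
    · rw [braid_mul hpk]
    · rw [gen_mul_gen_mul (fun h => hadj h.symm), gen_mul_gen_mul hpi']

/-- Transitivity of `LcmRel`, assuming Garside's lemma for shorter elements. -/
private lemma LcmRel.trans_of_forall (hG : ∀ a b c, G.Adj a b → G.Adj b c → ¬ G.Adj a c) {N : ℕ}
    (ih : ∀ (a b : ι) (u v : ArtinMonoid G), gen G a * u = gen G b * v → length u < N →
      LcmRel a u b v)
    {i p k : ι} {x w y : ArtinMonoid G} (h₁ : LcmRel i x p w) (h₂ : LcmRel p w k y)
    (hN : length w ≤ N) : LcmRel i x k y := by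
  rcases h₁ with ⟨rfl, rfl⟩ | ⟨hip, hip', z, rfl, rfl⟩ | ⟨hip, z, rfl, rfl⟩
  · exact h₂
  · simp only [length_mul, length_gen] at hN
    rcases h₂ with ⟨rfl, rfl⟩ | ⟨hpk, hpk', z', h, rfl⟩ | ⟨hpk, z', h, rfl⟩
    · exact .inr (.inl ⟨hip, hip', z, rfl, rfl⟩)
    · rcases ih _ _ _ _ h (by omega) with ⟨rfl, rfl⟩ | ⟨hik, hik', v, rfl, rfl⟩ | ⟨hik, v, rfl, rfl⟩
      · exact .inl ⟨rfl, rfl⟩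
      · exact .inr (.inl ⟨hik, hik', gen G p * v, gen_mul_gen_mul hpk' _,
          gen_mul_gen_mul (fun h => hip' h.symm) _⟩)
      · refine .inr (.inr ⟨hik, gen G p * v, ?_, ?_⟩)
        · rw [gen_mul_gen_mul hpk', gen_mul_gen_mul (fun h => hip' h.symm)]
        · rw [gen_mul_gen_mul (fun h => hip' h.symm), gen_mul_gen_mul hpk']
    · by_cases hik : i = k
      · exact absurd (hik ▸ hpk.symm) hip'
      · exact LcmRel.trans_comm_braid ih hik hip hip' hpk h (by omega)
  · simp only [length_mul, length_gen] at hN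
    rcases h₂ with ⟨rfl, rfl⟩ | ⟨hpk, hpk', z', h, rfl⟩ | ⟨hpk, z', h, rfl⟩
    · exact .inr (.inr ⟨hip, z, rfl, rfl⟩)
    · have hl := congrArg length h
      simp only [length_mul, length_gen] at hl
      by_cases hik : i = k
      · exact absurd (hik ▸ hip.symm) hpk'
      · exact (LcmRel.trans_comm_braid ih (Ne.symm hik) hpk.symm (fun h => hpk' h.symm)
          hip.symm h.symm (by omega)).symm
    · have hl := congrArg length h
      simp only [length_mul, length_gen] at hl
      by_cases hik : i = k
      · subst hik
        have h' := (ih _ _ _ _ h (by simp only [length_mul, length_gen]; omega)).eq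
        rw [(ih _ _ _ _ h' (by omega)).eq]
        exact .inl ⟨rfl, rfl⟩
      · have hik' := hG _ _ _ hip hpk
        obtain ⟨t, ht, ht'⟩ :=
          (ih _ _ _ _ h (by simp only [length_mul, length_gen]; omega)).of_not_adj hik hik'
        have hlt := congrArg length ht
        simp only [length_mul, length_gen] at hlt
        obtain ⟨r, rfl, rfl⟩ := (ih _ _ _ _ ht (by omega)).of_adj hpk
        obtain ⟨r', rfl, hr⟩ := (ih _ _ _ _ ht' (by omega)).of_adj hip.symm
        have hlr := congrArg length hr
        simp only [length_mul, length_gen] at hl hlt hlr hN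
        have hr := (ih _ _ _ _ hr (by simp only [length_mul, length_gen]; omega)).eq
        obtain ⟨q, rfl, rfl⟩ := (ih _ _ _ _ hr (by omega)).of_not_adj (Ne.symm hik)
          (fun h => hik' h.symm)
        refine .inr (.inl ⟨hik, hik', gen G p * (gen G k * (gen G i * (gen G p * q))), ?_, ?_⟩)
        · rw [gen_mul_gen_mul hik', braid_mul hip, braid_mul hpk]
        · rw [gen_mul_gen_mul (fun h => hik' h.symm), braid_mul hpk.symm, braid_mul hip.symm,
            gen_mul_gen_mul hik']

/-- The property of pairs of words in Garside's lemma: they are both empty or their first letters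
are related through a least common multiple. -/
def WordLcmRel (G : SimpleGraph ι) (w w' : FreeMonoid ι) : Prop :=
  (w = 1 ∧ w' = 1) ∨ ∃ i u j v, w = .of i * u ∧ w' = .of j * v ∧
    LcmRel i (PresentedMonoid.mk (ArtinRel G) u) j (PresentedMonoid.mk (ArtinRel G) v)

lemma length_mk (w : FreeMonoid ι) :
    length (PresentedMonoid.mk (ArtinRel G) w) = FreeMonoid.length w := by
  induction w using FreeMonoid.inductionOn' with
  | one => simp
  | of_mul i w ih =>
    rw [map_mul, length_mul, ih, FreeMonoid.length_mul, FreeMonoid.length_of]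
    rfl

private lemma wordLcmRel_of_conGen (hG : ∀ a b c, G.Adj a b → G.Adj b c → ¬ G.Adj a c) {N : ℕ}
    (ih : ∀ (a b : ι) (u v : ArtinMonoid G), gen G a * u = gen G b * v → length u < N →
      LcmRel a u b v)
    {w w' : FreeMonoid ι} (h : ConGen.Rel (ArtinRel G) w w') (hN : w.length ≤ N + 1) :
    WordLcmRel G w w' := by
  induction h with
  | of w w' h =>
    cases h with
    | @comm i j h =>
      refine .inr ⟨i, .of j, j, .of i, rfl, rfl, ?_⟩
      by_cases hij : i = j
      · subst hij
        exact .inl ⟨rfl, rfl⟩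
      · exact .inr (.inl ⟨hij, h, 1, (mul_one _).symm, (mul_one _).symm⟩)
    | @braid i j h =>
      refine .inr ⟨i, _, j, _, rfl, rfl, .inr (.inr ⟨h, 1, ?_, ?_⟩)⟩ <;> simp [gen] <;> rfl
  | refl w =>
    cases w using FreeMonoid.casesOn with
    | one => exact .inl ⟨rfl, rfl⟩
    | of_mul i w => exact .inr ⟨i, w, i, w, rfl, rfl, .inl ⟨rfl, rfl⟩⟩
  | @symm x y hxy hs =>
    have hl : length (PresentedMonoid.mk (ArtinRel G) x) = length (PresentedMonoid.mk _ y) :=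
      congrArg length (PresentedMonoid.mk_eq_mk_iff.2 hxy)
    rw [length_mk, length_mk] at hl
    rcases hs (by omega) with ⟨h, h'⟩ | ⟨i, u, j, v, h, h', hr⟩
    · exact .inl ⟨h', h⟩
    · exact .inr ⟨j, v, i, u, h', h, hr.symm⟩
  | @trans x y z hxy hyz hs ht =>
    have hl : length (PresentedMonoid.mk (ArtinRel G) x) = length (PresentedMonoid.mk _ y) :=
      congrArg length (PresentedMonoid.mk_eq_mk_iff.2 hxy)
    rw [length_mk, length_mk] at hl
    have ht := ht (by omega)
    rcases hs (by omega) with ⟨rfl, rfl⟩ | ⟨i, u, j, v, rfl, rfl, hr⟩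
    · exact ht
    · rcases ht with ⟨h, -⟩ | ⟨j', v', k, t, h, rfl, hr'⟩
      · simpa using congrArg FreeMonoid.length h
      · obtain ⟨rfl, rfl⟩ : j = j' ∧ v = v' := by
          have := congrArg FreeMonoid.toList h
          simpa using this
        refine .inr ⟨i, u, k, t, rfl, rfl, hr.trans_of_forall hG ih hr' ?_⟩
        rw [length_mk]
        simp only [FreeMonoid.length_mul, FreeMonoid.length_of] at hl hN
        omega
  | @mul w x y z hwx hyz hs ht =>
    simp only [FreeMonoid.length_mul] at hN
    rcases hs (by omega) with ⟨rfl, rfl⟩ | ⟨i, u, j, v, rfl, rfl, hr⟩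
    · simpa using ht (by omega)
    · refine .inr ⟨i, u * y, j, v * z, mul_assoc _ _ _, mul_assoc _ _ _, ?_⟩
      rw [map_mul, map_mul, ← PresentedMonoid.mk_eq_mk_iff.2 hyz]
      exact hr.mul_right _

/-- **Garside's lemma** for simply laced Artin monoids of triangle-free graphs. -/
theorem lcmRel_of_gen_mul_eq (hG : ∀ a b c, G.Adj a b → G.Adj b c → ¬ G.Adj a c) {i j : ι}
    {x y : ArtinMonoid G} (h : gen G i * x = gen G j * y) : LcmRel i x j y := by
  induction hN : length x using Nat.strong_induction_on generalizing i j x y with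
  | _ N ih =>
    induction x using PresentedMonoid.inductionOn with
    | h u =>
    induction y using PresentedMonoid.inductionOn with
    | h v =>
    have h' : PresentedMonoid.mk (ArtinRel G) (.of i * u) = PresentedMonoid.mk _ (.of j * v) := by
      rw [map_mul, map_mul]; exact h
    rcases wordLcmRel_of_conGen hG (fun a b u v h hl => ih _ hl h rfl)
      (PresentedMonoid.mk_eq_mk_iff.1 h') (by
        rw [length_mk] at hN
        simp only [FreeMonoid.length_mul, FreeMonoid.length_of]; omega) with
      ⟨h, -⟩ | ⟨i', u', j', v', h₁, h₂, hr⟩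
    · simpa using congrArg FreeMonoid.length h
    · obtain ⟨rfl, rfl⟩ : i = i' ∧ u = u' := by simpa using congrArg FreeMonoid.toList h₁
      obtain ⟨rfl, rfl⟩ : j = j' ∧ v = v' := by simpa using congrArg FreeMonoid.toList h₂
      exact hr

lemma mul_left_cancel_of_triangleFree (hG : ∀ a b c, G.Adj a b → G.Adj b c → ¬ G.Adj a c)
    {x y z : ArtinMonoid G} (h : x * y = x * z) : y = z := by
  induction x using induction_gen_mul with
  | one => simpa using h
  | gen_mul i x ih =>
    rw [mul_assoc, mul_assoc] at h
    exact ih (lcmRel_of_gen_mul_eq hG h).eq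

end ArtinMonoid

/-- The elements `s 0, …, s (N - 1)` of a monoid satisfy the braid relations. -/
structure IsBraidSeq {M : Type*} [Monoid M] (s : ℕ → M) (N : ℕ) : Prop where
  comm : ∀ {i j : ℕ}, i + 2 ≤ j → j < N → s i * s j = s j * s i
  braid : ∀ {i : ℕ}, i + 1 < N → s i * (s (i + 1) * s i) = s (i + 1) * (s i * s (i + 1))

section BraidSeq

variable {M : Type*} [Monoid M]

/-- The product `s 0 * s 1 * ⋯ * s (m - 1)`. -/
def ascProd (s : ℕ → M) (m : ℕ) : M := ((List.range m).map s).prod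

/-- The product `s (m - 1) * ⋯ * s 1 * s 0`. -/
def descProd (s : ℕ → M) : ℕ → M
  | 0 => 1
  | m + 1 => s m * descProd s m

/-- The half twist (Garside element) on the generators `s 0, …, s (m - 1)`. -/
def halfTwist (s : ℕ → M) : ℕ → M
  | 0 => 1
  | m + 1 => ascProd s (m + 1) * halfTwist s m

@[simp] lemma ascProd_zero (s : ℕ → M) : ascProd s 0 = 1 := rfl

lemma ascProd_succ (s : ℕ → M) (m : ℕ) : ascProd s (m + 1) = ascProd s m * s m :=
  List.prod_range_succ s m

lemma ascProd_succ' (s : ℕ → M) (m : ℕ) :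
    ascProd s (m + 1) = s 0 * ascProd (fun i => s (i + 1)) m :=
  List.prod_range_succ' s m

lemma descProd_succ (s : ℕ → M) (m : ℕ) : descProd s (m + 1) = s m * descProd s m := rfl

end BraidSeq

namespace IsBraidSeq

variable {M : Type*} [Monoid M] {s : ℕ → M} {N : ℕ}

lemma mul_ascProd_of_lt (hs : IsBraidSeq s N) {m j : ℕ} (hm : m < j) (hj : j < N) :
    s j * ascProd s m = ascProd s m * s j := by
  induction m with
  | zero => simp
  | succ m ih =>
    rw [ascProd_succ, ← mul_assoc, ih (by omega), mul_assoc, ← hs.comm (by omega) hj, mul_assoc]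

lemma mul_halfTwist_of_lt (hs : IsBraidSeq s N) {m j : ℕ} (hm : m < j) (hj : j < N) :
    s j * halfTwist s m = halfTwist s m * s j := by
  induction m with
  | zero => simp [halfTwist]
  | succ m ih =>
    rw [halfTwist, ← mul_assoc, hs.mul_ascProd_of_lt hm hj, mul_assoc, ih (by omega), mul_assoc]

lemma ascProd_mul (hs : IsBraidSeq s N) {m i : ℕ} (hi : i + 1 < m) (hm : m ≤ N) :
    ascProd s m * s i = s (i + 1) * ascProd s m := by
  induction m with
  | zero => omega
  | succ m ih =>
    obtain h | rfl : i + 1 < m ∨ m = i + 1 := by omega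
    · rw [ascProd_succ, mul_assoc, ← hs.comm (by omega) (by omega), ← mul_assoc,
        ih h (by omega), mul_assoc]
    · rw [ascProd_succ, ascProd_succ, mul_assoc, mul_assoc, hs.braid (by omega), ← mul_assoc,
        ← hs.mul_ascProd_of_lt (Nat.lt_succ_self i) (by omega)]
      simp only [mul_assoc]

lemma ascProd_mul_ascProd (hs : IsBraidSeq s N) {m j : ℕ} (hj : j < m) (hm : m ≤ N) :
    ascProd s m * ascProd s j = ascProd (fun i => s (i + 1)) j * ascProd s m := by
  induction j with
  | zero => simp
  | succ j ih =>
    rw [ascProd_succ, ← mul_assoc, ih (by omega), mul_assoc, hs.ascProd_mul hj hm, ascProd_succ,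
      mul_assoc]

lemma ascProd_mul_self (hs : IsBraidSeq s N) {m : ℕ} (hm : m + 1 ≤ N) :
    ascProd s (m + 1) * ascProd s (m + 1) = s 0 * (ascProd s (m + 1) * ascProd s m) := by
  rw [hs.ascProd_mul_ascProd (Nat.lt_succ_self m) hm, ← mul_assoc, ← ascProd_succ']

lemma halfTwist_mul (hs : IsBraidSeq s N) {m i j : ℕ} (hij : i + j + 1 = m) (hm : m ≤ N) :
    halfTwist s m * s i = s j * halfTwist s m := by
  induction m generalizing i j with
  | zero => omega
  | succ m ih =>
    cases j with
    | succ j =>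
      rw [halfTwist, mul_assoc, ih (j := j) (by omega) (by omega), ← mul_assoc,
        hs.ascProd_mul (by omega) hm, mul_assoc]
    | zero =>
      obtain rfl : i = m := by omega
      cases i with
      | zero => simp [halfTwist, ascProd]
      | succ k =>
        rw [halfTwist, halfTwist, mul_assoc, mul_assoc,
          ← hs.mul_halfTwist_of_lt (Nat.lt_succ_self k) (by omega), ← mul_assoc (ascProd s (k + 1)),
          ← ascProd_succ, ← mul_assoc, hs.ascProd_mul_self hm]
        simp only [mul_assoc]

lemma halfTwist_succ' (hs : IsBraidSeq s N) {m : ℕ} (hm : m + 1 ≤ N) :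
    halfTwist s (m + 1) = halfTwist s m * descProd s (m + 1) := by
  induction m with
  | zero => simp [halfTwist, descProd, ascProd]
  | succ m ih =>
    calc halfTwist s (m + 2) = ascProd s (m + 1) * s (m + 1) * halfTwist s (m + 1) := by
          rw [halfTwist, ascProd_succ]
      _ = ascProd s (m + 1) * (s (m + 1) * halfTwist s m) * descProd s (m + 1) := by
          rw [ih (by omega)]; simp only [mul_assoc]
      _ = halfTwist s (m + 1) * descProd s (m + 2) := by
          rw [hs.mul_halfTwist_of_lt (Nat.lt_succ_self m) (by omega), halfTwist,
            descProd_succ s (m + 1)]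
          simp only [mul_assoc]

lemma ascProd_pow_mul (hs : IsBraidSeq s N) {i k : ℕ} (h : i + k < N) :
    ascProd s N ^ k * s i = s (i + k) * ascProd s N ^ k := by
  induction k with
  | zero => simp
  | succ k ih =>
    rw [pow_succ', mul_assoc, ih (by omega), ← mul_assoc, hs.ascProd_mul (by omega) le_rfl,
      mul_assoc, add_assoc]

/-- The full twist is central. -/
lemma ascProd_pow_succ_mul (hs : IsBraidSeq s N) {i : ℕ} (hi : i < N) :
    ascProd s N ^ (N + 1) * s i = s i * ascProd s N ^ (N + 1) := by
  obtain ⟨k, rfl⟩ : ∃ k, N = i + k + 1 := ⟨N - i - 1, by omega⟩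
  have h : ascProd s (i + k + 1) ^ 2 * s (i + k) = s 0 * ascProd s (i + k + 1) ^ 2 := by
    rw [sq]
    nth_rw 1 [hs.ascProd_mul_self le_rfl]
    rw [mul_assoc, mul_assoc, ← ascProd_succ]
  rw [show i + k + 1 + 1 = i + 2 + k by omega, pow_add, mul_assoc, hs.ascProd_pow_mul (by omega),
    ← mul_assoc, pow_add _ i 2, mul_assoc _ _ (s (i + k)), h, ← mul_assoc,
    hs.ascProd_pow_mul (by omega), zero_add]
  simp only [mul_assoc]

lemma exists_ascProd_pow_eq (hs : IsBraidSeq s N) {i : ℕ} (hi : i < N) :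
    ∃ t, ascProd s N ^ (N + 1) = s i * t := by
  obtain ⟨k, rfl⟩ : ∃ k, N = k + 1 := ⟨N - 1, by omega⟩
  refine ⟨ascProd s (k + 1) ^ i *
    (ascProd (fun i => s (i + 1)) k * ascProd s (k + 1) ^ (k + 1 - i)), ?_⟩
  have h := hs.ascProd_pow_mul (i := 0) (k := i) (by omega)
  rw [zero_add] at h
  rw [← mul_assoc, ← h, mul_assoc, ← mul_assoc (s 0), ← ascProd_succ', ← pow_succ', ← pow_add]
  congr 1
  omega

end IsBraidSeq

lemma pathGraph_triangleFree (N : ℕ) (a b c : Fin N) (hab : (SimpleGraph.pathGraph N).Adj a b)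
    (hbc : (SimpleGraph.pathGraph N).Adj b c) : ¬ (SimpleGraph.pathGraph N).Adj a c := by
  simp only [SimpleGraph.pathGraph_adj] at *
  omega

/-- The monoid of positive braids with `N` generators, that is, on `N + 1` strands. -/
abbrev BraidMonoid (N : ℕ) : Type := ArtinMonoid (SimpleGraph.pathGraph N)

namespace BraidMonoid

open ArtinMonoid

variable {N : ℕ}

/-- The generators of the braid monoid, indexed by natural numbers, with junk value `1`. -/
def s (N : ℕ) (i : ℕ) : BraidMonoid N := if h : i < N then gen _ ⟨i, h⟩ else 1

lemma s_of_lt {i : ℕ} (h : i < N) : s N i = gen _ ⟨i, h⟩ := dif_pos h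

lemma gen_eq_s (i : Fin N) : gen (SimpleGraph.pathGraph N) i = s N i := (s_of_lt i.2).symm

lemma length_s {i : ℕ} (h : i < N) : length (s N i) = 1 := by simp [s_of_lt h]

lemma isBraidSeq (N : ℕ) : IsBraidSeq (s N) N where
  comm {i j} hij hj := by
    rw [s_of_lt hj, s_of_lt (by omega)]
    simpa using gen_mul_gen_mul (G := SimpleGraph.pathGraph N) (i := ⟨i, by omega⟩) (j := ⟨j, hj⟩)
      (by rw [SimpleGraph.pathGraph_adj]; simp only; omega) 1
  braid {i} hi := by
    rw [s_of_lt hi, s_of_lt (by omega)]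
    simpa using braid_mul (G := SimpleGraph.pathGraph N) (i := ⟨i, by omega⟩) (j := ⟨i + 1, hi⟩)
      (by rw [SimpleGraph.pathGraph_adj]; simp) 1

lemma mul_left_cancel_braid {x y z : BraidMonoid N} (h : x * y = x * z) : y = z :=
  mul_left_cancel_of_triangleFree (pathGraph_triangleFree N) h

lemma exists_of_s_mul_eq_of_lt {i j : ℕ} (hij : i + 2 ≤ j) (hj : j < N) {x y : BraidMonoid N}
    (h : s N i * x = s N j * y) : ∃ z, x = s N j * z := by
  rw [s_of_lt hj, s_of_lt (by omega)] at h
  obtain ⟨z, hz, -⟩ := (lcmRel_of_gen_mul_eq (pathGraph_triangleFree N) h).of_not_adj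
    (by simp; omega) (by rw [SimpleGraph.pathGraph_adj]; simp only; omega)
  exact ⟨z, by rw [s_of_lt hj, hz]⟩

lemma exists_of_s_mul_eq_of_adj {i j : ℕ} (hij : i + 1 = j ∨ j + 1 = i) (hi : i < N) (hj : j < N)
    {x y : BraidMonoid N} (h : s N i * x = s N j * y) : ∃ z, x = s N j * (s N i * z) := by
  rw [s_of_lt hj, s_of_lt hi] at h
  obtain ⟨z, hz, -⟩ := (lcmRel_of_gen_mul_eq (pathGraph_triangleFree N) h).of_adj
    (by rw [SimpleGraph.pathGraph_adj]; exact hij)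
  exact ⟨z, by rw [s_of_lt hj, s_of_lt hi, hz]⟩

lemma s_injOn {i j : ℕ} (hi : i < N) (hj : j < N) (h : s N i = s N j) : i = j := by
  by_contra hij
  rw [s_of_lt hi, s_of_lt hj] at h
  have h' : gen (SimpleGraph.pathGraph N) ⟨i, hi⟩ * 1 = gen _ ⟨j, hj⟩ * 1 := by rw [h]
  rcases lcmRel_of_gen_mul_eq (pathGraph_triangleFree N) h' with ⟨h, -⟩ | ⟨-, -, z, h, -⟩ |
    ⟨-, z, h, -⟩
  · exact hij (by simpa using h)
  all_goals
    have := congrArg length h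
    simp only [length_one, length_mul, length_gen] at this
    omega

lemma exists_of_ascProd_mul_eq {m j : ℕ} (hm : m < j) (hj : j < N) {x y : BraidMonoid N}
    (h : ascProd (s N) m * x = s N j * y) : ∃ z, x = s N j * z := by
  induction m generalizing x with
  | zero => exact ⟨y, by simpa using h⟩
  | succ m ih =>
    rw [ascProd_succ, mul_assoc] at h
    obtain ⟨z, hz⟩ := ih (by omega) h
    exact exists_of_s_mul_eq_of_lt (by omega) hj hz

lemma exists_of_halfTwist_mul_eq_of_lt {m j : ℕ} (hm : m < j) (hj : j < N) {x y : BraidMonoid N}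
    (h : halfTwist (s N) m * x = s N j * y) : ∃ z, x = s N j * z := by
  induction m generalizing y with
  | zero => exact ⟨y, by simpa [halfTwist] using h⟩
  | succ m ih =>
    rw [halfTwist, mul_assoc] at h
    obtain ⟨z, hz⟩ := exists_of_ascProd_mul_eq hm hj h
    exact ih (by omega) hz

lemma exists_of_halfTwist_mul_eq {m : ℕ} (hm : m < N) {x y : BraidMonoid N}
    (h : halfTwist (s N) m * x = s N m * y) : ∃ z, x = descProd (s N) (m + 1) * z := by
  induction m generalizing x y with
  | zero => exact ⟨y, by simpa [halfTwist, descProd] using h⟩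
  | succ m ih =>
    rw [halfTwist, mul_assoc, ascProd_succ, mul_assoc] at h
    obtain ⟨u, hu⟩ := exists_of_ascProd_mul_eq (Nat.lt_succ_self m) hm h
    obtain ⟨t, ht⟩ := exists_of_s_mul_eq_of_adj (.inl rfl) (by omega) hm hu
    obtain ⟨x', rfl⟩ := exists_of_halfTwist_mul_eq_of_lt (Nat.lt_succ_self m) hm ht
    rw [← mul_assoc, ← (isBraidSeq N).mul_halfTwist_of_lt (Nat.lt_succ_self m) hm,
      mul_assoc] at ht
    obtain ⟨z, rfl⟩ := ih (by omega) (mul_left_cancel_braid ht)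
    exact ⟨z, by rw [descProd_succ _ (m + 1), mul_assoc]⟩

/-- The half twist is the least common multiple of the generators. -/
lemma exists_halfTwist_mul_eq {m : ℕ} (hm : m ≤ N) {w : BraidMonoid N}
    (h : ∀ i < m, ∃ t, w = s N i * t) : ∃ t, w = halfTwist (s N) m * t := by
  induction m with
  | zero => exact ⟨w, by simp [halfTwist]⟩
  | succ m ih =>
    obtain ⟨v, rfl⟩ := ih (by omega) fun i hi => h i (by omega)
    obtain ⟨t, ht⟩ := h m (Nat.lt_succ_self m)
    obtain ⟨z, rfl⟩ := exists_of_halfTwist_mul_eq hm ht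
    exact ⟨z, by rw [(isBraidSeq N).halfTwist_succ' hm, mul_assoc]⟩

/-- If `w` permutes the generators, then the set of generators dividing `w` on the left is stable
under passing to an adjacent generator. -/
lemma exists_s_mul_of_adj {w : BraidMonoid N}
    (hw : ∀ i < N, ∃ j < N, s N i * w = w * s N j) {i j : ℕ} (hij : i + 1 = j ∨ j + 1 = i)
    (hi : i < N) (hj : j < N) (h : ∃ t, w = s N i * t) : ∃ t, w = s N j * t := by
  obtain ⟨t, ht⟩ := h
  obtain ⟨i', -, hi'⟩ := hw i hi
  obtain ⟨j', -, hj'⟩ := hw j hj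
  have key : s N i * (t * (s N j' * s N i')) = s N j * (s N i * w) := by
    rw [hi', ← mul_assoc (s N j), hj', ← mul_assoc, ← ht, mul_assoc]
  obtain ⟨z, hz⟩ := exists_of_s_mul_eq_of_adj hij.symm hj hi key.symm
  exact ⟨z, mul_left_cancel_braid hz⟩

lemma exists_s_mul_of_ne_one {w : BraidMonoid N}
    (hw : ∀ i < N, ∃ j < N, s N i * w = w * s N j) (hne : w ≠ 1) {j : ℕ} (hj : j < N) :
    ∃ t, w = s N j * t := by
  obtain ⟨⟨i, hi⟩, y, hy⟩ := (eq_one_or_exists_gen_mul w).resolve_left hne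
  rw [gen_eq_s] at hy
  have up : ∀ k, i ≤ k → k < N → ∃ t, w = s N k * t := fun k hk => by
    induction k, hk using Nat.le_induction with
    | base => exact fun _ => ⟨y, hy⟩
    | succ k _ ih =>
      exact fun hk => exists_s_mul_of_adj hw (.inl rfl) (by omega) hk (ih (by omega))
  obtain h | h := le_total i j
  · exact up j h hj
  · induction h using Nat.decreasingInduction with
    | self => exact ⟨y, hy⟩
    | of_succ k hk ih =>
      exact exists_s_mul_of_adj hw (.inr rfl) (by omega) hj (ih (by omega))

/-- An element of the braid monoid which permutes the generators is a power of the half twist. -/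
theorem exists_eq_halfTwist_pow (hN : 0 < N) {w : BraidMonoid N}
    (hw : ∀ i < N, ∃ j < N, s N i * w = w * s N j) : ∃ k : ℕ, w = halfTwist (s N) N ^ k := by
  induction hl : length w using Nat.strong_induction_on generalizing w with
  | _ l ih =>
    by_cases hne : w = 1
    · exact ⟨0, by simp [hne]⟩
    obtain ⟨v, rfl⟩ := exists_halfTwist_mul_eq le_rfl fun i hi => exists_s_mul_of_ne_one hw hne hi
    have hpos : 0 < length (halfTwist (s N) N) := by
      obtain ⟨k, rfl⟩ : ∃ k, N = k + 1 := ⟨N - 1, by omega⟩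
      rw [halfTwist, length_mul, ascProd_succ, length_mul, length_s (by omega)]
      omega
    rw [length_mul] at hl
    obtain ⟨k, rfl⟩ := ih (length v) (by omega) (fun i hi => by
      obtain ⟨j, hj, h⟩ := hw (N - 1 - i) (by omega)
      refine ⟨j, hj, ?_⟩
      rw [← mul_assoc, ← (isBraidSeq N).halfTwist_mul (i := i) (by omega) le_rfl,
        mul_assoc, mul_assoc] at h
      exact mul_left_cancel_braid h) rfl
    exact ⟨k + 1, (pow_succ' _ _).symm⟩

lemma length_ascProd {m : ℕ} (hm : m ≤ N) : length (ascProd (s N) m) = m := by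
  induction m with
  | zero => simp
  | succ m ih => rw [ascProd_succ, length_mul, ih (by omega), length_s (by omega)]

lemma two_mul_length_halfTwist {m : ℕ} (hm : m ≤ N) :
    2 * length (halfTwist (s N) m) = m * (m + 1) := by
  induction m with
  | zero => simp [halfTwist]
  | succ m ih =>
    rw [halfTwist, length_mul, length_ascProd hm, mul_add, ih (by omega)]
    ring

/-- The full twist is the square of the half twist. -/
theorem ascProd_pow_eq_halfTwist_sq (hN : 0 < N) :
    ascProd (s N) N ^ (N + 1) = halfTwist (s N) N ^ 2 := by
  obtain ⟨k, hk⟩ := exists_eq_halfTwist_pow hN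
    fun i hi => ⟨i, hi, ((isBraidSeq N).ascProd_pow_succ_mul hi).symm⟩
  have hl := congrArg length hk
  rw [length_pow, length_pow, length_ascProd le_rfl] at hl
  have h := two_mul_length_halfTwist (N := N) le_rfl
  have hk2 : 2 = k := by
    refine Nat.eq_of_mul_eq_mul_right (Nat.mul_pos hN (Nat.succ_pos N)) ?_
    calc 2 * (N * (N + 1)) = 2 * ((N + 1) * N) := by ring
      _ = k * (2 * length (halfTwist (s N) N)) := by rw [hl]; ring
      _ = k * (N * N.succ) := by rw [h]
  rw [hk, ← hk2]

end BraidMonoid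

/-- The center of a left cancellative monoid satisfies the Ore condition. -/
instance oreSetCenter {M : Type*} [Monoid M] :
    OreLocalization.OreSet (Submonoid.center M) where
  ore_right_cancel r₁ r₂ c h := ⟨c, by
    have hc := Submonoid.mem_center_iff.1 c.2
    rwa [← hc, ← hc]⟩
  oreNum r _ := r
  oreDenom _ c := c
  ore_eq r c := (Submonoid.mem_center_iff.1 c.2 r).symm

lemma numeratorHom_center_injective {M : Type*} [Monoid M]
    (hM : ∀ x y z : M, x * y = x * z → y = z) :
    Function.Injective (OreLocalization.numeratorHom (R := M) (S := Submonoid.center M)) := by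
  intro x y h
  rw [OreLocalization.numeratorHom_apply, OreLocalization.numeratorHom_apply,
    OreLocalization.oreDiv_eq_iff] at h
  obtain ⟨u, v, huv, hv⟩ := h
  simp only [OneMemClass.coe_one, mul_one] at hv
  subst hv
  exact (hM _ _ _ huv).symm

namespace BraidMonoid

open ArtinMonoid

variable {N : ℕ}

lemma commute_of_forall_s {c : BraidMonoid N} (h : ∀ i < N, c * s N i = s N i * c)
    (x : BraidMonoid N) : x * c = c * x := by
  induction x using induction_gen_mul with
  | one => simp
  | gen_mul i x ih => rw [mul_assoc, ih, ← mul_assoc, gen_eq_s, ← h _ i.2, mul_assoc]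

lemma fullTwist_mem_center (N : ℕ) :
    ascProd (s N) N ^ (N + 1) ∈ Submonoid.center (BraidMonoid N) :=
  Submonoid.mem_center_iff.2 <| commute_of_forall_s fun _ hi =>
    (isBraidSeq N).ascProd_pow_succ_mul hi

lemma exists_mul_gen_eq_fullTwist (i : Fin N) :
    ∃ t, gen (SimpleGraph.pathGraph N) i * t = ascProd (s N) N ^ (N + 1) ∧
      t * gen (SimpleGraph.pathGraph N) i = ascProd (s N) N ^ (N + 1) := by
  obtain ⟨t, ht⟩ := (isBraidSeq N).exists_ascProd_pow_eq i.2
  refine ⟨t, by rw [gen_eq_s, ht], mul_left_cancel_braid (x := gen _ i) ?_⟩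
  rw [← mul_assoc, gen_eq_s, ← ht]
  exact (isBraidSeq N).ascProd_pow_succ_mul i.2

end BraidMonoid

namespace BraidGroup

open ArtinMonoid BraidMonoid

variable {n : ℕ}

lemma lift_eq_one_of_mem_braidRels {H : Type*} [Group H] (f : Fin (n - 1) → H)
    (hcomm : ∀ i j, i ≠ j → ¬ (SimpleGraph.pathGraph (n - 1)).Adj i j → f i * f j = f j * f i)
    (hbraid : ∀ i j, (SimpleGraph.pathGraph (n - 1)).Adj i j →
      f i * f j * f i = f j * f i * f j) :
    ∀ r ∈ braidRels n, FreeGroup.lift f r = 1 := by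
  rintro r (⟨i, j, hij, rfl⟩ | ⟨i, j, hij, rfl⟩)
  · simp only [map_mul, map_inv, FreeGroup.lift_apply_of]
    rw [mul_inv_eq_one]
    refine hcomm i j (fun h => by simp [h] at hij) fun h => ?_
    rw [SimpleGraph.pathGraph_adj] at h
    rw [le_abs] at hij
    omega
  · simp only [map_mul, map_inv, FreeGroup.lift_apply_of]
    rw [mul_inv_eq_one]
    refine hbraid i j ?_
    rw [SimpleGraph.pathGraph_adj]
    rw [abs_eq zero_le_one] at hij
    omega

lemma σ_comm {i j : Fin (n - 1)} (h : ¬ (SimpleGraph.pathGraph (n - 1)).Adj i j) :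
    (σ i : B n) * σ j = σ j * σ i := by
  by_cases hij : i = j
  · rw [hij]
  refine PresentedGroup.mk_eq_mk_of_mul_inv_mem (.inl ⟨i, j, ?_, rfl⟩)
  rw [SimpleGraph.pathGraph_adj] at h
  rw [Fin.ext_iff] at hij
  rw [le_abs]
  omega

lemma σ_braid {i j : Fin (n - 1)} (h : (SimpleGraph.pathGraph (n - 1)).Adj i j) :
    (σ i : B n) * σ j * σ i = σ j * σ i * σ j := by
  refine PresentedGroup.mk_eq_mk_of_mul_inv_mem (.inr ⟨i, j, ?_, rfl⟩)
  rw [SimpleGraph.pathGraph_adj] at h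
  rw [abs_eq zero_le_one]
  omega

/-- The canonical map from positive braids to braids. -/
def ofBraidMonoid (n : ℕ) : BraidMonoid (n - 1) →* B n :=
  PresentedMonoid.lift (fun i => σ i) (by
    rintro _ _ (h | h)
    · simpa using σ_comm h
    · simpa [mul_assoc] using σ_braid h)

@[simp] lemma ofBraidMonoid_gen (i : Fin (n - 1)) :
    ofBraidMonoid n (gen (SimpleGraph.pathGraph (n - 1)) i) = σ i := rfl

lemma ofBraidMonoid_injective (n : ℕ) : Function.Injective (ofBraidMonoid n) := by
  let ψ := OreLocalization.numeratorHom (R := BraidMonoid (n - 1)) (S := Submonoid.center _)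
  have hψ : Function.Injective ψ :=
    numeratorHom_center_injective fun _ _ _ h => mul_left_cancel_braid h
  have hunit (i : Fin (n - 1)) : IsUnit (ψ (gen _ i)) := by
    obtain ⟨t, h₁, h₂⟩ := exists_mul_gen_eq_fullTwist i
    have hc : Commute (ψ (gen _ i)) (ψ t) := by
      rw [Commute, SemiconjBy, ← map_mul, ← map_mul, h₁, h₂]
    refine (hc.isUnit_mul_iff.1 ?_).1
    rw [← map_mul, h₁]
    exact OreLocalization.numerator_isUnit ⟨_, fullTwist_mem_center _⟩
  have hrel := lift_eq_one_of_mem_braidRels (fun i => (hunit i).unit)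
    (fun i j _ h => by
      ext
      simpa using congrArg ψ (gen_mul_gen_mul h 1))
    (fun i j h => by
      ext
      simpa [mul_assoc] using congrArg ψ (braid_mul h 1))
  let f := PresentedGroup.toGroup hrel
  have hf : ((Units.coeHom _).comp f).comp (ofBraidMonoid n) = ψ := by
    refine PresentedMonoid.ext _ fun i => ?_
    exact congrArg Units.val (PresentedGroup.toGroup.of hrel)
  refine Function.Injective.of_comp (f := (Units.coeHom _).comp f) ?_
  rw [← MonoidHom.coe_comp, hf]
  exact hψ

lemma mem_center_of_forall_σ {z : B n} (h : ∀ i, z * σ i = σ i * z) :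
    z ∈ Subgroup.center (B n) := by
  rw [← Subgroup.centralizer_univ, ← Subgroup.coe_top, ← PresentedGroup.closure_range_of,
    Subgroup.centralizer_closure, Subgroup.mem_centralizer_iff]
  rintro _ ⟨i, rfl⟩
  exact (h i).symm

lemma exists_eq_mul_zpow (x : B n) : ∃ (w : BraidMonoid (n - 1)) (k : ℤ),
    x = ofBraidMonoid n w * ofBraidMonoid n (ascProd (s (n - 1)) (n - 1) ^ (n - 1 + 1)) ^ k := by
  set c := ascProd (s (n - 1)) (n - 1) ^ (n - 1 + 1) with hc
  have hcomm (w : BraidMonoid (n - 1)) : Commute (ofBraidMonoid n w) (ofBraidMonoid n c) := by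
    rw [Commute, SemiconjBy, ← map_mul, ← map_mul,
      Submonoid.mem_center_iff.1 (fullTwist_mem_center (n - 1)) w]
  induction x using PresentedGroup.induction_on with
  | H w =>
    induction w using FreeGroup.induction_on with
    | C1 => exact ⟨1, 0, by simp⟩
    | of i => exact ⟨gen _ i, 0, by simp; rfl⟩
    | inv_of i _ =>
      obtain ⟨t, ht, -⟩ := exists_mul_gen_eq_fullTwist i
      refine ⟨t, -1, ?_⟩
      rw [hc, ← ht, map_mul, zpow_neg_one, mul_inv_rev, mul_inv_cancel_left]
      rfl
    | mul x y hx hy =>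
      obtain ⟨w, k, hx⟩ := hx
      obtain ⟨w', k', hy⟩ := hy
      refine ⟨w * w', k + k', ?_⟩
      rw [map_mul, hx, hy, map_mul, zpow_add, mul_assoc, mul_assoc,
        ← mul_assoc _ _ (_ ^ k'), ← ((hcomm w').zpow_right k).eq, mul_assoc]

lemma ofBraidMonoid_ascProd (n : ℕ) :
    ofBraidMonoid n (ascProd (s (n - 1)) (n - 1)) =
      (List.ofFn fun i : Fin (n - 1) => (σ i : B n)).prod := by
  rw [ascProd, map_list_prod, List.map_map, List.ofFn_eq_map, ← List.map_coe_finRange_eq_range,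
    List.map_map]
  congr 2
  ext i
  simp [← gen_eq_s]

end BraidGroup

open ArtinMonoid BraidMonoid BraidGroup in
/-- For every `n ≥ 3`, the center of the braid group `B n` is the infinite cyclic
subgroup generated by the full twist `(σ 0 * σ 1 * ⋯ * σ (n-2)) ^ n`. -/
theorem center_braid_eq_zpowers_fullTwist (n : ℕ) (hn : 3 ≤ n) :
    Subgroup.center (B n)
      = Subgroup.zpowers ((List.ofFn fun i : Fin (n - 1) => σ i).prod ^ n) := by
  have hpos : 0 < n - 1 := by omega
  have hn1 : n - 1 + 1 = n := by omega
  set D := halfTwist (s (n - 1)) (n - 1) with hD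
  have hsq : (List.ofFn fun i : Fin (n - 1) => (σ i : B n)).prod ^ n = ofBraidMonoid n D ^ 2 := by
    rw [← ofBraidMonoid_ascProd, ← map_pow, ← map_pow, ← ascProd_pow_eq_halfTwist_sq hpos, hn1]
  have hcenter : ofBraidMonoid n D ^ 2 ∈ Subgroup.center (B n) := by
    refine mem_center_of_forall_σ fun i => ?_
    rw [← map_pow, ← ascProd_pow_eq_halfTwist_sq hpos, ← ofBraidMonoid_gen, ← map_mul, ← map_mul,
      Submonoid.mem_center_iff.1 (fullTwist_mem_center (n - 1))]
  have hD_center : ofBraidMonoid n D ∉ Subgroup.center (B n) := fun h => by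
    have h₁ : D * s (n - 1) 0 = s (n - 1) 0 * D :=
      ofBraidMonoid_injective n (by
        rw [map_mul, map_mul]; exact (Subgroup.mem_center_iff.1 h _).symm)
    rw [hD, (isBraidSeq _).halfTwist_mul (i := 0) (j := n - 2) (by omega) le_rfl] at h₁
    have h₂ := congrArg (ofBraidMonoid n) h₁
    rw [map_mul, map_mul] at h₂
    have := s_injOn (by omega) (by omega) (ofBraidMonoid_injective n (mul_right_cancel h₂))
    omega
  rw [hsq]
  refine le_antisymm (fun z hz => ?_) ((Subgroup.zpowers_le).2 hcenter)
  obtain ⟨w, k, rfl⟩ := exists_eq_mul_zpow z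
  rw [ascProd_pow_eq_halfTwist_sq hpos, map_pow, ← hD] at hz ⊢
  have hw : ofBraidMonoid n w ∈ Subgroup.center (B n) :=
    (Subgroup.mul_mem_cancel_right _ (Subgroup.zpow_mem _ hcenter k)).1 hz
  obtain ⟨m, rfl⟩ := exists_eq_halfTwist_pow hpos (w := w) fun i hi => ⟨i, hi,
    ofBraidMonoid_injective n (by rw [map_mul, map_mul]; exact Subgroup.mem_center_iff.1 hw _)⟩
  refine Subgroup.mul_mem _ ?_ (Subgroup.zpow_mem_zpowers _ k)
  rw [map_pow, ← hD] at hw ⊢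
  obtain ⟨l, rfl | rfl⟩ := m.even_or_odd'
  · rw [pow_mul]
    exact Subgroup.npow_mem_zpowers _ l
  · rw [pow_succ, pow_mul] at hw
    exact absurd ((Subgroup.mul_mem_cancel_left _ (Subgroup.pow_mem _ hcenter l)).1 hw) hD_center
end
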